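/- Let A be a countable set and ρ = ⊗_{i∈ℤ} ρ_i a product probability measure on A^ℤ that is nonsingular for the left shift S and has a limiting measure p, meaning ρ_i → p in total variation as |i| → ∞. Then for every real number α < H(p) (where H(p) = −∑_{a∈A} p(a) log p(a) may be infinite) there exist a finite set B, a probability measure q on B with H(q) > α, and a finitary factor map φ: A^ℤ → B^ℤ with φ∘S = S∘φ ρ-almost everywhere and ρ∘φ^{-1} equivalent to q^ℤ. -/

import Mathlib

open MeasureTheory Filter Set Topology ENNReal

/-- The cylinder set of points agreeing with `y` on the finite coordinate set `s`. -/
def cylinder {A : Type*} (s : Finset ℤ) (y : ℤ → A) : Set (ℤ → A) :=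
  {x | ∀ i ∈ s, x i = y i}

/-- `μ` is the product measure on `A^ℤ` with marginals `ρ i`. -/
def IsProductMeasure {A : Type*} [MeasurableSpace A]
    (μ : Measure (ℤ → A)) (ρ : ℤ → A → ℝ) : Prop :=
  ∀ (s : Finset ℤ) (y : ℤ → A), μ (cylinder s y) = ∏ i ∈ s, ENNReal.ofReal (ρ i (y i))

/-- The left shift on `A^ℤ`. -/
def shift {A : Type*} : (ℤ → A) → (ℤ → A) := fun x i => x (i + 1)

/-- Two measures are equivalent if they have the same null sets. -/
def MeasEquiv {X : Type*} [MeasurableSpace X] (μ ν : Measure X) : Prop :=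
  μ ≪ ν ∧ ν ≪ μ

/-- `p` is a probability vector on a countable set. -/
def IsProbVecC {A : Type*} (p : A → ℝ) : Prop :=
  (∀ a, 0 ≤ p a) ∧ HasSum p 1

/-- `q` is a probability vector on a finite set. -/
def IsProbVec {B : Type*} [Fintype B] (q : B → ℝ) : Prop :=
  (∀ b, 0 ≤ q b) ∧ ∑ b, q b = 1

/-- Shannon entropy (in bits) of a probability vector on a finite set. -/
noncomputable def entropy {B : Type*} [Fintype B] (q : B → ℝ) : ℝ :=
  -∑ b, q b * Real.logb 2 (q b)

/-- Shannon entropy (in bits), valued in `[0,∞]`, of a probability vector on a countable set. -/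
noncomputable def entropyENN {A : Type*} (p : A → ℝ) : ℝ≥0∞ :=
  ∑' a, ENNReal.ofReal (-(p a * Real.logb 2 (p a)))

/-- `φ` is finitary. -/
def IsFinitary {A B : Type*} [MeasurableSpace A] (μ : Measure (ℤ → A))
    (φ : (ℤ → A) → (ℤ → B)) : Prop :=
  ∀ b : B, ∃ (s : ℕ → Finset ℤ) (y : ℕ → ℤ → A),
    μ (symmDiff {x | φ x 0 = b} (⋃ n, cylinder (s n) (y n))) = 0


open MeasureTheory Filter Set Topology ENNReal

set_option linter.unusedSectionVars false
set_option linter.unusedVariables false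
set_option linter.unusedSimpArgs false

namespace NOF

section tools
variable {F γ : Type*} [MeasurableSpace F] [MeasurableSingletonClass F]

theorem measurable_of_dep [Countable F] [MeasurableSpace γ] (s : Finset ℤ) (f : (ℤ → F) → γ)
    (h : ∀ x x', (∀ i ∈ s, x i = x' i) → f x = f x') : Measurable f := by
  rcases isEmpty_or_nonempty (ℤ → F) with hE | ⟨⟨x0⟩⟩
  · exact measurable_of_empty f
  · classical
    have : f = (fun w : s → F => f (fun i => if hi : i ∈ s then w ⟨i, hi⟩ else x0 i)) ∘ s.restrict := by
      funext x
      apply h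
      intro i hi
      simp [hi]
    rw [this]
    exact (measurable_of_countable _).comp (Finset.measurable_restrict s)

theorem measurableSet_cyl [Countable F] (s : Finset ℤ) (y : ℤ → F) :
    MeasurableSet (_root_.cylinder s y) := by
  have := measurable_of_dep (γ := Prop) s (fun x => x ∈ _root_.cylinder s y) (by
    intro x x' h
    simp only [_root_.cylinder, mem_ofPred_eq, eq_iff_iff]
    constructor
    · intro h1 i hi; rw [← h i hi]; exact h1 i hi
    · intro h1 i hi; rw [h i hi]; exact h1 i hi)
  exact measurableSet_setOfPred.2 this

theorem ext_cyl [Countable F] (μ ν : Measure (ℤ → F)) [IsFiniteMeasure μ] [IsFiniteMeasure ν]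
    (h : ∀ s0 : Finset ℤ, ∃ s, s0 ⊆ s ∧ ∀ y, μ (_root_.cylinder s y) = ν (_root_.cylinder s y)) :
    μ = ν := by
  classical
  have key : ∀ s0 : Finset ℤ, μ.map s0.restrict = ν.map s0.restrict := by
    intro s0
    obtain ⟨s, hs, hy⟩ := h s0
    have h1 : μ.map s.restrict = ν.map s.restrict := by
      apply Measure.ext_of_singleton
      intro w
      rw [Measure.map_apply (Finset.measurable_restrict s) (measurableSet_singleton _),
        Measure.map_apply (Finset.measurable_restrict s) (measurableSet_singleton _)]
      rcases isEmpty_or_nonempty (ℤ → F) with hE | ⟨⟨x0⟩⟩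
      · rw [Set.eq_empty_of_isEmpty ((s.restrict : (ℤ → F) → _) ⁻¹' {w})]; simp
      · have : (s.restrict ⁻¹' {w} : Set (ℤ → F))
            = _root_.cylinder s (fun i => if hi : i ∈ s then w ⟨i, hi⟩ else x0 i) := by
          ext x
          simp only [mem_preimage, mem_singleton_iff, _root_.cylinder, mem_ofPred_eq]
          constructor
          · rintro rfl i hi; simp [hi]
          · intro hx; funext ⟨i, hi⟩; simpa [hi] using hx i hi
        rw [this]; exact hy _
    have h2 : (s0.restrict : (ℤ → F) → _) = Finset.restrict₂ hs ∘ s.restrict := rfl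
    rw [h2, ← Measure.map_map (by fun_prop) (by fun_prop), h1, Measure.map_map (by fun_prop) (by fun_prop)]
  have hν : IsProjectiveLimit ν (fun J : Finset ℤ => ν.map J.restrict) := fun J => rfl
  have hμ : IsProjectiveLimit μ (fun J : Finset ℤ => ν.map J.restrict) := fun J => key J
  exact hμ.unique hν

/-- measure on `F` with weights `q` -/
noncomputable def pm (q : F → ℝ) : Measure F := Measure.sum (fun a => ENNReal.ofReal (q a) • Measure.dirac a)

theorem pm_singleton (q : F → ℝ) (a : F) : pm q {a} = ENNReal.ofReal (q a) := by
  classical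
  rw [pm, Measure.sum_apply _ (measurableSet_singleton a), tsum_eq_single a]
  · simp
  · intro b hb
    simp [hb]

theorem pm_prob {q : F → ℝ} (h0 : ∀ a, 0 ≤ q a) (h1 : HasSum q 1) : IsProbabilityMeasure (pm q) := by
  constructor
  rw [pm, Measure.sum_apply _ MeasurableSet.univ]
  simp only [Measure.smul_apply, measure_univ, smul_eq_mul, mul_one]
  rw [← ENNReal.ofReal_tsum_of_nonneg h0 h1.summable, h1.tsum_eq, ENNReal.ofReal_one]

theorem prod_prob {μ : Measure (ℤ → F)} {ρ : ℤ → F → ℝ} (hμ : IsProductMeasure μ ρ)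
    (hne : Nonempty F) : IsProbabilityMeasure μ := by
  obtain ⟨a⟩ := hne
  constructor
  have := hμ ∅ (fun _ => a)
  simpa [_root_.cylinder] using this

theorem infinitePi_prod [Countable F] (ρ : ℤ → F → ℝ) [∀ i, IsProbabilityMeasure (pm (ρ i))] :
    IsProductMeasure (Measure.infinitePi (fun i => pm (ρ i))) ρ := by
  intro s y
  have : _root_.cylinder s y = Set.pi (s : Set ℤ) (fun i => {y i}) := by
    ext x; simp [_root_.cylinder]
  rw [this, Measure.infinitePi_pi _ (fun i _ => measurableSet_singleton _)]
  simp [pm_singleton]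

theorem prod_eq_infinitePi [Countable F] {μ : Measure (ℤ → F)} {ρ : ℤ → F → ℝ}
    (hμ : IsProductMeasure μ ρ) (hρ : ∀ i, IsProbVecC (ρ i)) (hne : Nonempty F)
    [∀ i, IsProbabilityMeasure (pm (ρ i))] :
    μ = Measure.infinitePi (fun i => pm (ρ i)) := by
  have := prod_prob hμ hne
  apply ext_cyl
  intro s0
  exact ⟨s0, subset_rfl, fun y => by rw [hμ, infinitePi_prod ρ]⟩

theorem exists_prod [Countable F] (ρ : ℤ → F → ℝ) (hρ : ∀ i, IsProbVecC (ρ i)) :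
    ∃ μ : Measure (ℤ → F), IsProductMeasure μ ρ := by
  have : ∀ i, IsProbabilityMeasure (pm (ρ i)) := fun i => pm_prob (hρ i).1 (hρ i).2
  exact ⟨_, infinitePi_prod ρ⟩

theorem prod_unique [Countable F] {μ ν : Measure (ℤ → F)} {ρ : ℤ → F → ℝ}
    (hμ : IsProductMeasure μ ρ) (hν : IsProductMeasure ν ρ) (hne : Nonempty F) : μ = ν := by
  have := prod_prob hμ hne
  have := prod_prob hν hne
  apply ext_cyl
  intro s0
  exact ⟨s0, subset_rfl, fun y => by rw [hμ, hν]⟩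

/-- independence of functions of disjoint windows -/
theorem indep_dep [Countable F] {μ : Measure (ℤ → F)} {ρ : ℤ → F → ℝ}
    (hμ : IsProductMeasure μ ρ) (hρ : ∀ i, IsProbVecC (ρ i)) (hne : Nonempty F)
    {γ δ : Type*} [MeasurableSpace γ] [MeasurableSpace δ]
    (s t : Finset ℤ) (hd : Disjoint s t) (f : (ℤ → F) → γ) (g : (ℤ → F) → δ)
    (hf : ∀ x x', (∀ i ∈ s, x i = x' i) → f x = f x')
    (hg : ∀ x x', (∀ i ∈ t, x i = x' i) → g x = g x') :
    ProbabilityTheory.IndepFun f g μ := by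
  classical
  have : ∀ i, IsProbabilityMeasure (pm (ρ i)) := fun i => pm_prob (hρ i).1 (hρ i).2
  obtain ⟨a⟩ := id hne
  have h1 : ProbabilityTheory.iIndepFun (fun (i : ℤ) (x : ℤ → F) => x i) μ := by
    rw [prod_eq_infinitePi hμ hρ hne]
    exact ProbabilityTheory.iIndepFun_infinitePi (X := fun i (x : F) => x) (fun i => measurable_id)
  have h2 := h1.indepFun_finset s t hd (fun i => measurable_pi_apply i)
  have ef : f = (fun w : s → F => f (fun i => if hi : i ∈ s then w ⟨i, hi⟩ else a)) ∘
      (fun x (i : s) => x i) := by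
    funext x
    apply hf
    intro i hi
    simp [hi]
  have eg : g = (fun w : t → F => g (fun i => if hi : i ∈ t then w ⟨i, hi⟩ else a)) ∘
      (fun x (i : t) => x i) := by
    funext x
    apply hg
    intro i hi
    simp [hi]
  rw [ef, eg]
  exact h2.comp (measurable_of_countable _) (measurable_of_countable _)

end tools
end NOF

open MeasureTheory Filter Set Topology ENNReal
set_option linter.unusedSectionVars false
set_option linter.unusedVariables false
set_option linter.unusedSimpArgs false

namespace NOF

/-- word of length `L` of `x` starting at `j` -/
def wd {A : Type*} (L : ℕ) (x : ℤ → A) (j : ℤ) : Fin L → A := fun i => x (j + (i : ℕ))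

structure Sys (A : Type*) (L g N : ℕ) where
  InJ : (ℤ → A) → ℤ → Prop
  dig : (Fin L → A) → (Fin g → ZMod N)
  act : (Fin g → ZMod N) → (Fin L → A) → (Fin L → A)
  R : ℕ
  gL : g ≤ L
  LR : L ≤ R
  equi : ∀ (x : ℤ → A) (j k : ℤ), InJ (fun z => x (z + k)) j ↔ InJ x (j + k)
  loc : ∀ (x x' : ℤ → A) (j : ℤ), (∀ z : ℤ, j - R ≤ z → z ≤ j + R → x z = x' z) → (InJ x j ↔ InJ x' j)
  disj : ∀ (x : ℤ → A) (j j' : ℤ), InJ x j → InJ x j' → j < j' → j + L ≤ j'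
  act_zero : ∀ u, act 0 u = u
  act_add : ∀ c c' u, act (c + c') u = act c (act c' u)
  dig_act : ∀ x j c, InJ x j → dig (act c (wd L x j)) = dig (wd L x j) + c
  perm : ∀ c u, ∃ σ : Equiv.Perm (Fin L), act c u = u ∘ σ
  inv : ∀ x x', (∀ j, InJ x j → ∃ c, wd L x' j = act c (wd L x j)) →
    (∀ z, (∀ i : Fin L, ¬ InJ x (z - (i : ℕ))) → x' z = x z) → ∀ j, InJ x' j ↔ InJ x j

namespace Sys
variable {A : Type*} {L g N : ℕ} (Q : Sys A L g N)

theorem disj' {x : ℤ → A} {j j' : ℤ} {i i' : ℕ} (h : Q.InJ x j) (h' : Q.InJ x j') (hi : i < L)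
    (hi' : i' < L) (e : j + i = j' + i') : j = j' := by
  rcases lt_trichotomy j j' with hlt | rfl | hlt
  · have := Q.disj x j j' h h' hlt; omega
  · rfl
  · have := Q.disj x j' j h' h hlt; omega

open Classical in
/-- act on all blocks -/
noncomputable def T (c : ℤ → Fin g → ZMod N) (x : ℤ → A) : ℤ → A := fun z =>
  if h : ∃ i : Fin L, Q.InJ x (z - (i : ℕ)) then
    Q.act (c (z - (h.choose : ℕ))) (wd L x (z - (h.choose : ℕ))) h.choose else x z

theorem T_cov (c : ℤ → Fin g → ZMod N) {x : ℤ → A} {j : ℤ} (h : Q.InJ x j) (i : Fin L) :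
    Q.T c x (j + (i : ℕ)) = Q.act (c j) (wd L x j) i := by
  have hh : ∃ i' : Fin L, Q.InJ x (j + (i : ℕ) - (i' : ℕ)) := ⟨i, by simpa using h⟩
  rw [T, dif_pos hh]
  have hs := hh.choose_spec
  have e := Q.disj' hs h hh.choose.2 i.2 (by ring)
  have e2 : hh.choose = i := by ext; omega
  simp only [e]
  rw [e2]

theorem T_uncov (c : ℤ → Fin g → ZMod N) {x : ℤ → A} {z : ℤ}
    (h : ∀ i : Fin L, ¬ Q.InJ x (z - (i : ℕ))) : Q.T c x z = x z := by
  rw [T, dif_neg]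
  push Not
  exact h

theorem wd_T (c : ℤ → Fin g → ZMod N) {x : ℤ → A} {j : ℤ} (h : Q.InJ x j) :
    wd L (Q.T c x) j = Q.act (c j) (wd L x j) := by
  funext i
  exact Q.T_cov c h i

theorem InJ_T (c : ℤ → Fin g → ZMod N) (x : ℤ → A) (j : ℤ) : Q.InJ (Q.T c x) j ↔ Q.InJ x j :=
  Q.inv x (Q.T c x) (fun j hj => ⟨c j, Q.wd_T c hj⟩) (fun z hz => Q.T_uncov c hz) j

theorem T_ext {x x' : ℤ → A} (hJ : ∀ j, Q.InJ x j ↔ Q.InJ x' j)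
    (h1 : ∀ j, Q.InJ x j → wd L x j = wd L x' j)
    (h2 : ∀ z, (∀ i : Fin L, ¬ Q.InJ x (z - (i : ℕ))) → x z = x' z) : x = x' := by
  funext z
  by_cases h : ∃ i : Fin L, Q.InJ x (z - (i : ℕ))
  · obtain ⟨i, hi⟩ := h
    have := congrFun (h1 _ hi) i
    simpa [wd] using this
  · push Not at h
    exact h2 z h

theorem T_add (c c' : ℤ → Fin g → ZMod N) (x : ℤ → A) : Q.T (c + c') x = Q.T c (Q.T c' x) := by
  apply Q.T_ext
  · intro j; rw [InJ_T, InJ_T, InJ_T]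
  · intro j hj
    rw [InJ_T] at hj
    rw [wd_T _ _ hj, wd_T _ _ ((Q.InJ_T _ _ _).2 hj), wd_T _ _ hj]
    exact Q.act_add _ _ _
  · intro z hz
    simp only [InJ_T] at hz
    rw [T_uncov _ _ hz, T_uncov _ _ (by simpa only [InJ_T] using hz), T_uncov _ _ hz]

theorem T_zero (x : ℤ → A) : Q.T 0 x = x := by
  apply Q.T_ext
  · intro j; rw [InJ_T]
  · intro j hj
    rw [InJ_T] at hj
    rw [wd_T _ _ hj]
    exact Q.act_zero _
  · intro z hz
    simp only [InJ_T] at hz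
    rw [T_uncov _ _ hz]

theorem T_neg (c : ℤ → Fin g → ZMod N) (x : ℤ → A) : Q.T (-c) (Q.T c x) = x := by
  rw [← T_add, neg_add_cancel, T_zero]

theorem T_neg' (c : ℤ → Fin g → ZMod N) (x : ℤ → A) : Q.T c (Q.T (-c) x) = x := by
  rw [← T_add, add_neg_cancel, T_zero]

/-- locality of `T` -/
theorem T_loc {c c' : ℤ → Fin g → ZMod N} {x x' : ℤ → A} {z : ℤ}
    (hx : ∀ w, z - 2 * Q.R ≤ w → w ≤ z + 2 * Q.R → x w = x' w)
    (hc : ∀ j, z - L < j → j ≤ z → c j = c' j) : Q.T c x z = Q.T c' x' z := by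
  have hLR := Q.LR
  have hJ : ∀ i : Fin L, Q.InJ x (z - (i : ℕ)) ↔ Q.InJ x' (z - (i : ℕ)) := by
    intro i
    have hi := i.2
    apply Q.loc
    intro w h1 h2
    apply hx <;> omega
  by_cases h : ∃ i : Fin L, Q.InJ x (z - (i : ℕ))
  · obtain ⟨i, hi⟩ := h
    have hi2 := i.2
    have e : z = z - (i : ℕ) + (i : ℕ) := by ring
    rw [e, Q.T_cov c hi, Q.T_cov c' ((hJ i).1 hi)]
    have : wd L x (z - (i : ℕ)) = wd L x' (z - (i : ℕ)) := by
      funext k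
      have := k.2
      apply hx <;> omega
    rw [this, hc _ (by omega) (by omega)]
  · push Not at h
    rw [Q.T_uncov c h, Q.T_uncov c' (fun i hi => h i ((hJ i).2 hi))]
    apply hx <;> omega

theorem T_measurable [Countable A] [MeasurableSpace A] [MeasurableSingletonClass A]
    (c : ℤ → Fin g → ZMod N) : Measurable (Q.T c) := by
  rw [measurable_pi_iff]
  intro z
  apply measurable_of_dep (Finset.Icc (z - 2 * Q.R) (z + 2 * Q.R))
  intro x x' h
  apply Q.T_loc _ (fun _ _ _ => rfl)
  intro w h1 h2
  exact h w (by simp [h1, h2])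

end Sys
end NOF

open MeasureTheory Filter Set Topology ENNReal
set_option linter.unusedSectionVars false
set_option linter.unusedVariables false
set_option linter.unusedSimpArgs false

namespace NOF
namespace Sys
variable {A : Type*} {L g N : ℕ} (Q : Sys A L g N)

theorem T_fix (c : ℤ → Fin g → ZMod N) {x : ℤ → A} {z : ℤ}
    (h : ∀ i : Fin L, Q.InJ x (z - (i : ℕ)) → c (z - (i : ℕ)) = 0) : Q.T c x z = x z := by
  by_cases h' : ∃ i : Fin L, Q.InJ x (z - (i : ℕ))
  · obtain ⟨i, hi⟩ := h'
    have e : z = z - (i : ℕ) + (i : ℕ) := by ring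
    rw [e, Q.T_cov c hi, h i hi, Q.act_zero]
    rfl
  · push Not at h'
    exact Q.T_uncov c h'

theorem T_single_of_not (j : ℤ) (d : Fin g → ZMod N) {x : ℤ → A} (h : ¬ Q.InJ x j) :
    Q.T (Pi.single j d) x = x := by
  funext z
  apply Q.T_fix
  intro i hi
  rw [Pi.single_eq_of_ne]
  rintro e
  rw [e] at hi
  exact h hi

theorem T_single_off (j : ℤ) (d : Fin g → ZMod N) {x : ℤ → A} {z : ℤ}
    (h : ∀ i : Fin L, z ≠ j + (i : ℕ)) :
    Q.T (Pi.single j d) x z = x z := by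
  apply Q.T_fix
  intro i hi
  rw [Pi.single_eq_of_ne]
  rintro e
  exact h i (by omega)

theorem T_single_agree (j : ℤ) (d : Fin g → ZMod N) {x x' : ℤ → A} {s : Finset ℤ}
    (hs : Finset.Icc (j - Q.R) (j + Q.R) ⊆ s) (h : ∀ i ∈ s, x i = x' i) :
    ∀ i ∈ s, Q.T (Pi.single j d) x i = Q.T (Pi.single j d) x' i := by
  intro z hz
  have hLR := Q.LR
  have h0 : ∀ z : ℤ, j - Q.R ≤ z → z ≤ j + Q.R → x z = x' z := fun w h1 h2 =>
    h w (hs (by simp [h1, h2]))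
  have hJ := Q.loc x x' j h0
  by_cases hj : Q.InJ x j
  · by_cases hb : ∃ i : Fin L, z = j + (i : ℕ)
    · obtain ⟨i, rfl⟩ := hb
      rw [Q.T_cov _ hj, Q.T_cov _ (hJ.1 hj)]
      have : wd L x j = wd L x' j := by
        funext k
        have := k.2
        apply h0 <;> omega
      rw [this]
    · push Not at hb
      rw [Q.T_single_off j d hb, Q.T_single_off j d hb, h z hz]
  · rw [Q.T_single_of_not j d hj, Q.T_single_of_not j d (fun h => hj (hJ.2 h)), h z hz]

open Classical in
/-- density ratio -/
noncomputable def rr (ρ : ℤ → A → ℝ) (j : ℤ) (d : Fin g → ZMod N) (x : ℤ → A) : ℝ :=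
  if Q.InJ x j then ∏ i : Fin L, (ρ (j + (i : ℕ)) (Q.act (-d) (wd L x j) i) /
    ρ (j + (i : ℕ)) (wd L x j i)) else 1

theorem rr_nonneg {ρ : ℤ → A → ℝ} (h0 : ∀ i a, 0 < ρ i a) (j : ℤ) (d : Fin g → ZMod N) (x : ℤ → A) :
    0 ≤ Q.rr ρ j d x := by
  unfold rr
  split_ifs
  · exact Finset.prod_nonneg fun i _ => div_nonneg (h0 _ _).le (h0 _ _).le
  · exact zero_le_one

theorem rr_loc (ρ : ℤ → A → ℝ) (j : ℤ) (d : Fin g → ZMod N) {x x' : ℤ → A}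
    (h0 : ∀ z : ℤ, j - Q.R ≤ z → z ≤ j + Q.R → x z = x' z) : Q.rr ρ j d x = Q.rr ρ j d x' := by
  have hLR := Q.LR
  have hJ := Q.loc x x' j h0
  have : wd L x j = wd L x' j := by
    funext k
    have := k.2
    apply h0 <;> omega
  by_cases h : Q.InJ x j
  · rw [rr, rr, if_pos h, if_pos (hJ.1 h), this]
  · rw [rr, rr, if_neg h, if_neg (fun h' => h (hJ.2 h'))]

theorem rr_T_single (ρ : ℤ → A → ℝ) {j j' : ℤ} (hjj : j ≠ j') (d d' : Fin g → ZMod N) (x : ℤ → A) :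
    Q.rr ρ j d (Q.T (Pi.single j' d') x) = Q.rr ρ j d x := by
  by_cases h : Q.InJ x j
  · rw [rr, rr, if_pos h, if_pos ((Q.InJ_T _ _ _).2 h), Q.wd_T _ h, Pi.single_eq_of_ne hjj, Q.act_zero]
  · rw [rr, rr, if_neg h, if_neg (fun h' => h ((Q.InJ_T _ _ _).1 h'))]

variable [Finite A] [MeasurableSpace A] [MeasurableSingletonClass A]

theorem rr_meas (ρ : ℤ → A → ℝ) (j : ℤ) (d : Fin g → ZMod N) :
    Measurable (Q.rr ρ j d) := by
  apply measurable_of_dep (Finset.Icc (j - Q.R) (j + Q.R))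
  intro x x' h
  apply Q.rr_loc
  intro z h1 h2
  exact h z (by simp [h1, h2])

theorem cyl_preim (j : ℤ) (d : Fin g → ZMod N) (y : ℤ → A) {s : Finset ℤ}
    (hs : Finset.Icc (j - Q.R) (j + Q.R) ⊆ s) :
    Q.T (Pi.single j d) ⁻¹' (_root_.cylinder s y) =
      _root_.cylinder s (Q.T (Pi.single j (-d)) y) := by
  ext x
  simp only [mem_preimage, _root_.cylinder, mem_ofPred_eq]
  have e : (Pi.single j (-d) : ℤ → Fin g → ZMod N) = - Pi.single j d := by
    rw [Pi.single_neg]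
  constructor
  · intro h
    have := Q.T_single_agree j (-d) hs h
    rw [e, Q.T_neg] at this
    rw [e]
    exact this
  · intro h
    have := Q.T_single_agree j d hs h
    rw [e, Q.T_neg'] at this
    exact this

theorem prod_T_single {ρ : ℤ → A → ℝ} (h0 : ∀ i a, 0 < ρ i a) (j : ℤ) (d : Fin g → ZMod N)
    (y : ℤ → A) {s : Finset ℤ} (hs : Finset.Icc (j - Q.R) (j + Q.R) ⊆ s) :
    ∏ i ∈ s, ρ i (Q.T (Pi.single j (-d)) y i) = Q.rr ρ j d y * ∏ i ∈ s, ρ i (y i) := by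
  have hLR := Q.LR
  by_cases h : Q.InJ y j
  · let b : Finset ℤ := Finset.univ.image (fun i : Fin L => j + (i : ℕ))
    have hinj : Function.Injective (fun i : Fin L => j + ((i : ℕ) : ℤ)) := by
      intro i i' e
      ext; simpa using e
    have hb : b ⊆ s := by
      intro z hz
      simp only [b, Finset.mem_image, Finset.mem_univ, true_and] at hz
      obtain ⟨i, rfl⟩ := hz
      have := i.2
      apply hs
      simp only [Finset.mem_Icc]
      omega
    rw [← Finset.prod_sdiff hb, ← Finset.prod_sdiff (f := fun i => ρ i (y i)) hb]
    have e1 : ∏ i ∈ s \ b, ρ i (Q.T (Pi.single j (-d)) y i) = ∏ i ∈ s \ b, ρ i (y i) := by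
      apply Finset.prod_congr rfl
      intro z hz
      rw [Q.T_single_off]
      intro i e
      apply (Finset.mem_sdiff.1 hz).2
      simp only [b, Finset.mem_image, Finset.mem_univ, true_and]
      exact ⟨i, e.symm⟩
    rw [e1]
    simp only [b]
    rw [Finset.prod_image hinj.injOn, Finset.prod_image hinj.injOn]
    rw [rr, if_pos h]
    have e2 : ∀ i : Fin L, ρ (j + (i : ℕ)) (Q.T (Pi.single j (-d)) y (j + (i : ℕ)))
      = ρ (j + (i : ℕ)) (Q.act (-d) (wd L y j) i) := by
      intro i
      rw [Q.T_cov _ h, Pi.single_eq_same]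
    simp only [e2]
    rw [Finset.prod_div_distrib]
    have : ∏ i : Fin L, ρ (j + (i : ℕ)) (wd L y j i) ≠ 0 :=
      Finset.prod_ne_zero_iff.2 fun i _ => (h0 _ _).ne'
    have e3 : ∏ i : Fin L, ρ (j + (i : ℕ)) (y (j + (i : ℕ))) =
      ∏ i : Fin L, ρ (j + (i : ℕ)) (wd L y j i) := rfl
    rw [e3]
    field_simp
  · rw [rr, if_neg h, one_mul, Q.T_single_of_not _ _ h]

theorem map_single {μ : Measure (ℤ → A)} [IsProbabilityMeasure μ] {ρ : ℤ → A → ℝ}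
    (hμ : IsProductMeasure μ ρ) (h0 : ∀ i a, 0 < ρ i a) (j : ℤ) (d : Fin g → ZMod N)
    {M : ℝ} (hM : ∀ x, Q.rr ρ j d x ≤ M) :
    μ.map (Q.T (Pi.single j d)) = μ.withDensity (fun x => ENNReal.ofReal (Q.rr ρ j d x)) := by
  have : IsFiniteMeasure (μ.withDensity (fun x => ENNReal.ofReal (Q.rr ρ j d x))) := by
    apply isFiniteMeasure_withDensity
    have : ∫⁻ x, ENNReal.ofReal (Q.rr ρ j d x) ∂μ ≤ ∫⁻ x, ENNReal.ofReal M ∂μ :=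
      lintegral_mono fun x => ENNReal.ofReal_le_ofReal (hM x)
    refine ne_top_of_le_ne_top ?_ this
    simp
  have := Measure.isProbabilityMeasure_map (μ := μ) (Q.T_measurable (Pi.single j d)).aemeasurable
  apply ext_cyl
  intro s0
  refine ⟨s0 ∪ Finset.Icc (j - Q.R) (j + Q.R), Finset.subset_union_left, fun y => ?_⟩
  set s := s0 ∪ Finset.Icc (j - Q.R) (j + Q.R)
  have hs : Finset.Icc (j - Q.R) (j + Q.R) ⊆ s := Finset.subset_union_right
  rw [Measure.map_apply (Q.T_measurable _) (measurableSet_cyl _ _), Q.cyl_preim j d y hs,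
    withDensity_apply _ (measurableSet_cyl _ _), hμ]
  have : ∫⁻ x in _root_.cylinder s y, ENNReal.ofReal (Q.rr ρ j d x) ∂μ
      = ∫⁻ x in _root_.cylinder s y, ENNReal.ofReal (Q.rr ρ j d y) ∂μ := by
    apply setLIntegral_congr_fun (measurableSet_cyl _ _)
    intro x hx
    simp only
    rw [Q.rr_loc ρ j d (x' := y)]
    intro z h1 h2
    exact hx z (hs (by simp [h1, h2]))
  rw [this, setLIntegral_const, hμ, ← ENNReal.ofReal_prod_of_nonneg (fun i _ => (h0 _ _).le),
    ← ENNReal.ofReal_prod_of_nonneg (fun i _ => (h0 _ _).le),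
    ← ENNReal.ofReal_mul (Q.rr_nonneg h0 _ _ _), Q.prod_T_single h0 j d y hs]

open Classical in
/-- restrict a control -/
noncomputable def rc (c : ℤ → Fin g → ZMod N) (S : Finset ℤ) : ℤ → Fin g → ZMod N :=
  fun j => if j ∈ S then c j else 0

/-- product density -/
noncomputable def DD (ρ : ℤ → A → ℝ) (c : ℤ → Fin g → ZMod N) (S : Finset ℤ) (x : ℤ → A) : ℝ≥0∞ :=
  ∏ j ∈ S, ENNReal.ofReal (Q.rr ρ j (c j) x)

theorem DD_meas (ρ : ℤ → A → ℝ) (c : ℤ → Fin g → ZMod N) (S : Finset ℤ) : Measurable (Q.DD ρ c S) :=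
  Finset.measurable_prod _ fun j _ => (Q.rr_meas ρ j (c j)).ennreal_ofReal

theorem DD_T (ρ : ℤ → A → ℝ) (c : ℤ → Fin g → ZMod N) {S : Finset ℤ} {j : ℤ} (hj : j ∉ S)
    (d : Fin g → ZMod N) (x : ℤ → A) :
    Q.DD ρ c S (Q.T (Pi.single j d) x) = Q.DD ρ c S x := by
  unfold DD
  apply Finset.prod_congr rfl
  intro i hi
  rw [Q.rr_T_single]
  rintro rfl
  exact hj hi

theorem rc_insert (c : ℤ → Fin g → ZMod N) {S : Finset ℤ} {j : ℤ} (hj : j ∉ S) :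
    rc c (insert j S) = Pi.single j (c j) + rc c S := by
  funext i
  by_cases h : i = j
  · subst h; simp [rc, hj]
  · simp [rc, h]

theorem map_multi {μ : Measure (ℤ → A)} [IsProbabilityMeasure μ] {ρ : ℤ → A → ℝ}
    (hμ : IsProductMeasure μ ρ) (h0 : ∀ i a, 0 < ρ i a)
    (hM : ∀ j d, ∃ M, ∀ x, Q.rr ρ j d x ≤ M) (c : ℤ → Fin g → ZMod N) (S : Finset ℤ) :
    μ.map (Q.T (rc c S)) = μ.withDensity (Q.DD ρ c S) := by
  classical
  induction S using Finset.induction_on with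
  | empty =>
    have e1 : Q.T (rc c ∅) = id := by
      funext x
      have : rc c ∅ = 0 := by funext i; simp [rc]
      rw [this, Q.T_zero]; rfl
    have e2 : Q.DD ρ c ∅ = 1 := by funext x; simp [DD]
    rw [e1, e2, Measure.map_id, withDensity_one]
  | insert j S hj ih =>
    have e1 : Q.T (rc c (insert j S)) = Q.T (Pi.single j (c j)) ∘ Q.T (rc c S) := by
      funext x
      rw [rc_insert c hj, Q.T_add]; rfl
    obtain ⟨M, hM⟩ := hM j (c j)
    rw [e1, ← Measure.map_map (Q.T_measurable _) (Q.T_measurable _), ih]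
    ext E hE
    rw [Measure.map_apply (Q.T_measurable _) hE, withDensity_apply _ (Q.T_measurable _ hE),
      withDensity_apply _ hE]
    have e2 : ∫⁻ x in Q.T (Pi.single j (c j)) ⁻¹' E, Q.DD ρ c S x ∂μ
      = ∫⁻ x in Q.T (Pi.single j (c j)) ⁻¹' E, Q.DD ρ c S (Q.T (Pi.single j (c j)) x) ∂μ := by
      simp only [Q.DD_T ρ c hj]
    rw [e2, ← setLIntegral_map hE (Q.DD_meas ρ c S) (Q.T_measurable _),
      Q.map_single hμ h0 j (c j) hM, restrict_withDensity hE,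
      lintegral_withDensity_eq_lintegral_mul _ (Q.rr_meas ρ j (c j)).ennreal_ofReal (Q.DD_meas ρ c S)]
    apply lintegral_congr
    intro x
    simp [DD, Finset.prod_insert hj]

theorem second_moment {μ : Measure (ℤ → A)} [IsProbabilityMeasure μ] {ρ : ℤ → A → ℝ}
    (hμ : IsProductMeasure μ ρ) (h0 : ∀ i a, 0 < ρ i a)
    (k : ℤ → ℝ) (hk : ∀ j d x, (Q.rr ρ j d x - 1) ^ 2 ≤ k j)
    (hM : ∀ j d, ∃ M, ∀ x, Q.rr ρ j d x ≤ M) (c : ℤ → Fin g → ZMod N) (S : Finset ℤ) :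
    ∫⁻ x, Q.DD ρ c S x ^ 2 ∂μ ≤ ∏ j ∈ S, (ENNReal.ofReal (k j) + 1) := by
  classical
  induction S using Finset.induction_on with
  | empty => simp [DD]
  | insert j S hj ih =>
    obtain ⟨M, hM⟩ := hM j (c j)
    set r : (ℤ → A) → ℝ≥0∞ := fun x => ENNReal.ofReal (Q.rr ρ j (c j) x) with hr
    have hrm : Measurable r := (Q.rr_meas ρ j (c j)).ennreal_ofReal
    have hDm := Q.DD_meas ρ c S
    set b := ∫⁻ x, Q.DD ρ c S x ^ 2 ∂μ with hb
    have hbt : b ≠ ∞ := by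
      refine ne_top_of_le_ne_top ?_ ih
      exact ENNReal.prod_ne_top fun i _ => by simp
    have e1 : ∫⁻ x, Q.DD ρ c S x ^ 2 * r x ∂μ = b := by
      have : ∫⁻ x, Q.DD ρ c S x ^ 2 ∂(μ.map (Q.T (Pi.single j (c j)))) = b := by
        rw [lintegral_map (hDm.pow_const 2) (Q.T_measurable _)]
        simp only [Q.DD_T ρ c hj, hb]
      rw [Q.map_single hμ h0 j (c j) hM, lintegral_withDensity_eq_lintegral_mul _ hrm (hDm.pow_const 2)] at this
      rw [← this]
      apply lintegral_congr
      intro x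
      simp [mul_comm]
    have pt : ∀ x, r x ^ 2 + 1 ≤ ENNReal.ofReal (k j) + 2 * r x := by
      intro x
      have h1 := hk j (c j) x
      have h2 := Q.rr_nonneg h0 j (c j) x
      have h3 : 0 ≤ k j := le_trans (sq_nonneg _) h1
      simp only [hr]
      rw [← ENNReal.ofReal_pow h2, ← ENNReal.ofReal_one, ← ENNReal.ofReal_add (by positivity) (by norm_num),
        show (2 : ℝ≥0∞) = ENNReal.ofReal 2 by simp, ← ENNReal.ofReal_mul (by norm_num),
        ← ENNReal.ofReal_add h3 (by positivity)]
      apply ENNReal.ofReal_le_ofReal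
      nlinarith
    have e2 : ∫⁻ x, Q.DD ρ c S x ^ 2 * r x ^ 2 ∂μ + b ≤ (ENNReal.ofReal (k j) + 1) * b + b := by
      calc ∫⁻ x, Q.DD ρ c S x ^ 2 * r x ^ 2 ∂μ + b
          = ∫⁻ x, (Q.DD ρ c S x ^ 2 * r x ^ 2 + Q.DD ρ c S x ^ 2) ∂μ := by
            rw [lintegral_add_right _ (hDm.pow_const 2)]
        _ ≤ ∫⁻ x, (ENNReal.ofReal (k j) * Q.DD ρ c S x ^ 2 + 2 * (Q.DD ρ c S x ^ 2 * r x)) ∂μ := by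
            apply lintegral_mono
            intro x
            calc Q.DD ρ c S x ^ 2 * r x ^ 2 + Q.DD ρ c S x ^ 2
                = Q.DD ρ c S x ^ 2 * (r x ^ 2 + 1) := by ring
              _ ≤ Q.DD ρ c S x ^ 2 * (ENNReal.ofReal (k j) + 2 * r x) := mul_le_mul_right (pt x) _
              _ = _ := by ring
        _ = ENNReal.ofReal (k j) * b + 2 * b := by
            rw [lintegral_add_left ((hDm.pow_const 2).const_mul _), lintegral_const_mul _ (hDm.pow_const 2),
              lintegral_const_mul (2 : ℝ≥0∞) (f := fun x => Q.DD ρ c S x ^ 2 * r x) ((hDm.pow_const 2).mul hrm), e1]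
        _ = _ := by ring
    have e3 := (ENNReal.add_le_add_iff_right hbt).1 e2
    calc ∫⁻ x, Q.DD ρ c (insert j S) x ^ 2 ∂μ = ∫⁻ x, Q.DD ρ c S x ^ 2 * r x ^ 2 ∂μ := by
          apply lintegral_congr
          intro x
          simp only [DD, Finset.prod_insert hj, hr]
          ring
      _ ≤ _ := e3
      _ ≤ (ENNReal.ofReal (k j) + 1) * ∏ j ∈ S, (ENNReal.ofReal (k j) + 1) := by gcongr
      _ = _ := by rw [Finset.prod_insert hj]

theorem absCont {μ : Measure (ℤ → A)} [IsProbabilityMeasure μ] {ρ : ℤ → A → ℝ}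
    (hμ : IsProductMeasure μ ρ) (h0 : ∀ i a, 0 < ρ i a)
    (k : ℤ → ℝ) (hk : ∀ j d x, (Q.rr ρ j d x - 1) ^ 2 ≤ k j) (hks : Summable k)
    (c : ℤ → Fin g → ZMod N) : μ.map (Q.T c) ≪ μ := by
  classical
  have hM : ∀ j d, ∃ M, ∀ x, Q.rr ρ j d x ≤ M := by
    intro j d
    refine ⟨1 + (k j + 1), fun x => ?_⟩
    have := hk j d x
    nlinarith [sq_nonneg (Q.rr ρ j d x - 1 - 1)]
  rcases isEmpty_or_nonempty (ℤ → A) with hE | hE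
  · rw [Measure.eq_zero_of_isEmpty (μ.map _)]
    exact Measure.AbsolutelyContinuous.zero _
  obtain ⟨x0⟩ := hE
  have hk0 : ∀ j, 0 ≤ k j := fun j => le_trans (sq_nonneg _) (hk j 0 x0)
  set C : ℝ≥0∞ := ENNReal.ofReal (Real.exp (∑' j, k j)) with hC
  have hCb : ∀ S, ∫⁻ x, Q.DD ρ c S x ^ 2 ∂μ ≤ C := by
    intro S
    refine (Q.second_moment hμ h0 k hk hM c S).trans ?_
    have : ∀ j, ENNReal.ofReal (k j) + 1 = ENNReal.ofReal (k j + 1) := by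
      intro j
      rw [ENNReal.ofReal_add (hk0 j) zero_le_one, ENNReal.ofReal_one]
    simp only [this]
    rw [← ENNReal.ofReal_prod_of_nonneg (fun i _ => by linarith [hk0 i])]
    apply ENNReal.ofReal_le_ofReal
    calc ∏ j ∈ S, (k j + 1) ≤ ∏ j ∈ S, Real.exp (k j) :=
          Finset.prod_le_prod (fun i _ => by linarith [hk0 i]) (fun i _ => Real.add_one_le_exp _)
      _ = Real.exp (∑ j ∈ S, k j) := (Real.exp_sum _ _).symm
      _ ≤ _ := Real.exp_le_exp.2 (hks.sum_le_tsum S (fun i _ => hk0 i))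
  -- finite window estimate
  have win : ∀ E ∈ measurableCylinders (fun _ : ℤ => A), ∀ M : ℝ≥0∞, M ≠ 0 → M ≠ ∞ →
      μ.map (Q.T c) E ≤ M * μ E + M⁻¹ * C := by
    intro E hE M hM0 hMt
    have hEm : MeasurableSet E := MeasurableSet.of_mem_measurableCylinders hE
    rw [mem_measurableCylinders] at hE
    obtain ⟨s, U, hU, rfl⟩ := hE
    let S : Finset ℤ := s.biUnion (fun z => Finset.Icc (z - L) z)
    have e1 : μ.map (Q.T c) (MeasureTheory.cylinder s U) = μ.map (Q.T (rc c S)) (MeasureTheory.cylinder s U) := by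
      rw [Measure.map_apply (Q.T_measurable _) hEm, Measure.map_apply (Q.T_measurable _) hEm]
      congr 1
      ext x
      simp only [mem_preimage, MeasureTheory.mem_cylinder]
      have : s.restrict (Q.T c x) = s.restrict (Q.T (rc c S) x) := by
        funext ⟨z, hz⟩
        simp only [Finset.restrict]
        apply Q.T_loc (fun _ _ _ => rfl)
        intro j h1 h2
        rw [rc, if_pos]
        simp only [S, Finset.mem_biUnion, Finset.mem_Icc]
        exact ⟨z, hz, by omega, by omega⟩
      rw [this]
    rw [e1, Q.map_multi hμ h0 hM c S, withDensity_apply _ hEm]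
    have pt : ∀ D : ℝ≥0∞, D ≤ M + M⁻¹ * D ^ 2 := by
      intro D
      rcases le_total D M with h | h
      · exact h.trans le_self_add
      · calc D = M⁻¹ * M * D := by rw [ENNReal.inv_mul_cancel hM0 hMt, one_mul]
          _ ≤ M⁻¹ * D * D := by gcongr
          _ = M⁻¹ * D ^ 2 := by ring
          _ ≤ _ := le_add_self
    calc ∫⁻ x in MeasureTheory.cylinder s U, Q.DD ρ c S x ∂μ
        ≤ ∫⁻ x in MeasureTheory.cylinder s U, (M + M⁻¹ * Q.DD ρ c S x ^ 2) ∂μ :=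
          lintegral_mono fun x => pt _
      _ = M * μ (MeasureTheory.cylinder s U) + M⁻¹ * ∫⁻ x in MeasureTheory.cylinder s U, Q.DD ρ c S x ^ 2 ∂μ := by
          rw [lintegral_add_left measurable_const, setLIntegral_const,
            lintegral_const_mul _ ((Q.DD_meas ρ c S).pow_const 2)]
      _ ≤ _ := by
          gcongr
          exact (setLIntegral_le_lintegral _ _).trans (hCb S)
  intro E0 hE0
  obtain ⟨E, hE0E, hE, hμE⟩ := exists_measurable_superset_of_null hE0
  refine measure_mono_null hE0E ?_
  have := Measure.isProbabilityMeasure_map (μ := μ) (Q.T_measurable c).aemeasurable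
  have dense := Measure.MeasureDense.of_generateFrom_isSetAlgebra_finite (μ := μ + μ.map (Q.T c))
    (𝒜 := measurableCylinders (fun _ : ℤ => A)) isSetAlgebra_measurableCylinders
    generateFrom_measurableCylinders.symm
  by_contra hpos
  set v := μ.map (Q.T c) E with hv
  have hvt : v ≠ ∞ := measure_ne_top _ _
  -- choose M with C/M ≤ v/4
  have hvr : 0 < v.toReal := ENNReal.toReal_pos hpos hvt
  set e := v.toReal with he
  have hve : v = ENNReal.ofReal e := (ENNReal.ofReal_toReal hvt).symm
  set Cr := Real.exp (∑' j, k j) with hCr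
  have hCr0 : 0 < Cr := Real.exp_pos _
  set Mr : ℝ := 4 * Cr / e with hMr
  have hMr0 : 0 < Mr := by positivity
  set ε : ℝ := e / (4 * (Mr + 1)) with hε
  have hε0 : 0 < ε := by positivity
  obtain ⟨t, ht, hEt⟩ := dense.approx E hE (measure_ne_top _ _) ε hε0
  have hw := win t ht (ENNReal.ofReal Mr) (by simpa using hMr0) (by simp)
  have h1 : μ t ≤ ENNReal.ofReal ε := by
    calc μ t ≤ μ (E ∪ symmDiff E t) := measure_mono (by
            intro x hx
            by_cases hxE : x ∈ E
            · exact Or.inl hxE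
            · exact Or.inr (Or.inr ⟨hx, hxE⟩))
      _ ≤ μ E + μ (symmDiff E t) := measure_union_le _ _
      _ ≤ 0 + (μ + μ.map (Q.T c)) (symmDiff E t) := by
          rw [hμE]; gcongr; exact Measure.le_add_right le_rfl
      _ ≤ _ := by rw [zero_add]; exact hEt.le
  have h2 : v ≤ μ.map (Q.T c) t + ENNReal.ofReal ε := by
    calc v ≤ μ.map (Q.T c) (t ∪ symmDiff E t) := measure_mono (by
            intro x hx
            by_cases hxE : x ∈ t
            · exact Or.inl hxE
            · exact Or.inr (Or.inl ⟨hx, hxE⟩))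
      _ ≤ μ.map (Q.T c) t + μ.map (Q.T c) (symmDiff E t) := measure_union_le _ _
      _ ≤ μ.map (Q.T c) t + (μ + μ.map (Q.T c)) (symmDiff E t) := by
          gcongr; exact Measure.le_add_left le_rfl
      _ ≤ _ := by gcongr
  have h3 : v ≤ ENNReal.ofReal (Mr * ε + Mr⁻¹ * Cr + ε) := by
    refine h2.trans ?_
    rw [ENNReal.ofReal_add (by positivity) (by positivity), ENNReal.ofReal_add (by positivity) (by positivity),
      ENNReal.ofReal_mul (by positivity), ENNReal.ofReal_mul (by positivity),
      ENNReal.ofReal_inv_of_pos hMr0]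
    gcongr
    refine hw.trans ?_
    gcongr
  rw [hve, ENNReal.ofReal_le_ofReal_iff (by positivity)] at h3
  have h4 : Mr⁻¹ * Cr = e / 4 := by rw [hMr]; field_simp
  have h5 : Mr * ε + ε = e / 4 := by rw [hε]; field_simp
  linarith

end Sys
end NOF

open MeasureTheory Filter Set Topology ENNReal
set_option linter.unusedSectionVars false
set_option linter.unusedVariables false
set_option linter.unusedSimpArgs false

namespace NOF

section unif
variable {G : Type*} [Fintype G] [Nonempty G] [MeasurableSpace G] [MeasurableSingletonClass G]

/-- uniform product measure on sequences -/
def IsUnif (K : Measure (ℤ → G)) : Prop :=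
  IsProductMeasure K (fun _ _ => ((Fintype.card G : ℝ)⁻¹))

theorem unif_vec : IsProbVecC (fun _ : G => ((Fintype.card G : ℝ)⁻¹)) := by
  refine ⟨fun _ => by positivity, ?_⟩
  have := hasSum_fintype (fun _ : G => ((Fintype.card G : ℝ)⁻¹))
  simpa using this

theorem exists_unif : ∃ K : Measure (ℤ → G), IsUnif K := exists_prod _ (fun _ => unif_vec)

theorem IsUnif.prob {K : Measure (ℤ → G)} (h : IsUnif K) : IsProbabilityMeasure K :=
  prod_prob h inferInstance

theorem IsUnif.cyl {K : Measure (ℤ → G)} (h : IsUnif K) (s : Finset ℤ) (y : ℤ → G) :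
    K (_root_.cylinder s y) = (ENNReal.ofReal ((Fintype.card G : ℝ)⁻¹)) ^ s.card := by
  rw [h s y, Finset.prod_const]

open Classical in
/-- selection of coordinates from two sequences -/
noncomputable def sel (P : ℤ → Prop) (m : ℤ → ℤ) (uw : (ℤ → G) × (ℤ → G)) : ℤ → G :=
  fun z => if P z then uw.1 (m z) else uw.2 z

theorem sel_meas (P : ℤ → Prop) (m : ℤ → ℤ) : Measurable (sel (G := G) P m) := by
  rw [measurable_pi_iff]
  intro z
  unfold sel
  split_ifs
  · exact (measurable_pi_apply _).comp measurable_fst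
  · exact (measurable_pi_apply _).comp measurable_snd

theorem sel_map {H : Measure (ℤ → G)} (hH : IsUnif H) (P : ℤ → Prop) (m : ℤ → ℤ)
    (hm : ∀ z z', P z → P z' → m z = m z' → z = z') :
    (H.prod H).map (sel P m) = H := by
  classical
  have := hH.prob
  have := Measure.isProbabilityMeasure_map (μ := H.prod H) (sel_meas (G := G) P m).aemeasurable
  apply ext_cyl
  intro s0
  refine ⟨s0, subset_rfl, fun y => ?_⟩
  rw [Measure.map_apply (sel_meas _ _) (measurableSet_cyl _ _), hH.cyl]
  let y' : ℤ → G := fun w => if h : ∃ z ∈ s0, P z ∧ m z = w then y h.choose else Classical.arbitrary G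
  have hy' : ∀ z ∈ s0, P z → y' (m z) = y z := by
    intro z hz hP
    have h : ∃ z' ∈ s0, P z' ∧ m z' = m z := ⟨z, hz, hP, rfl⟩
    simp only [y', dif_pos h]
    rw [hm _ _ h.choose_spec.2.1 hP h.choose_spec.2.2]
  have e : sel P m ⁻¹' _root_.cylinder s0 y =
      (_root_.cylinder ((s0.filter P).image m) y') ×ˢ (_root_.cylinder (s0.filter (fun z => ¬ P z)) y) := by
    ext ⟨u, w⟩
    simp only [mem_preimage, _root_.cylinder, mem_ofPred_eq, Set.mem_prod, Finset.mem_image,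
      Finset.mem_filter, sel]
    constructor
    · intro h
      refine ⟨?_, ?_⟩
      · rintro _ ⟨z, ⟨hz, hP⟩, rfl⟩
        have := h z hz
        rw [if_pos hP] at this
        rw [this, hy' z hz hP]
      · rintro z ⟨hz, hP⟩
        have := h z hz
        rwa [if_neg hP] at this
    · rintro ⟨h1, h2⟩ z hz
      split_ifs with hP
      · rw [h1 _ ⟨z, ⟨hz, hP⟩, rfl⟩, hy' z hz hP]
      · exact h2 z ⟨hz, hP⟩
  rw [e, Measure.prod_prod, hH.cyl, hH.cyl, ← pow_add]
  congr 1
  rw [Finset.card_image_of_injOn]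
  · exact Finset.card_filter_add_card_filter_not _
  · intro z hz z' hz' e
    simp only [Finset.coe_filter, mem_ofPred_eq] at hz hz'
    exact hm z z' hz.2 hz'.2 e

theorem pair_unif {H : Measure (ℤ → G)} (hH : IsUnif H) :
    IsUnif ((H.prod H).map (fun (vt : (ℤ → G) × (ℤ → G)) z => (vt.1 z, vt.2 z))) := by
  have := hH.prob
  have hm : Measurable (fun (vt : (ℤ → G) × (ℤ → G)) z => (vt.1 z, vt.2 z)) := by
    rw [measurable_pi_iff]
    intro z
    exact ((measurable_pi_apply z).comp measurable_fst).prodMk ((measurable_pi_apply z).comp measurable_snd)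
  intro s y
  rw [Measure.map_apply hm (measurableSet_cyl _ _)]
  have e : (fun (vt : (ℤ → G) × (ℤ → G)) z => (vt.1 z, vt.2 z)) ⁻¹' _root_.cylinder s y =
      (_root_.cylinder s (fun z => (y z).1)) ×ˢ (_root_.cylinder s (fun z => (y z).2)) := by
    ext ⟨u, w⟩
    simp only [mem_preimage, _root_.cylinder, mem_ofPred_eq, Set.mem_prod, Prod.ext_iff]
    constructor
    · intro h; exact ⟨fun i hi => (h i hi).1, fun i hi => (h i hi).2⟩
    · intro h i hi; exact ⟨h.1 i hi, h.2 i hi⟩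
  rw [e, Measure.prod_prod, hH.cyl, hH.cyl, ← mul_pow, Finset.prod_const,
    ← ENNReal.ofReal_mul (by positivity)]
  congr 2
  rw [Fintype.card_prod]
  push_cast
  rw [mul_inv]

/-- disjoint blocks -/
def DisjB (L : ℕ) (J : ℤ → Prop) : Prop := ∀ j j', J j → J j' → j < j' → j + L ≤ j'

theorem DisjB.eq {L : ℕ} {J : ℤ → Prop} (hJ : DisjB L J) {j j' : ℤ} {i i' : ℕ} (h : J j) (h' : J j')
    (hi : i < L) (hi' : i' < L) (e : j + i = j' + i') : j = j' := by
  rcases lt_trichotomy j j' with hlt | rfl | hlt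
  · have := hJ j j' h h' hlt; omega
  · rfl
  · have := hJ j' j h' h hlt; omega

open Classical in
/-- blockwise map -/
noncomputable def Bl {G G' : Type*} (L : ℕ) (J : ℤ → Prop) (pp : (Fin L → G) → (Fin L → G')) (f : G → G')
    (k : ℤ → G) : ℤ → G' :=
  fun z => if h : ∃ i : Fin L, J (z - (i : ℕ)) then pp (wd L k (z - (h.choose : ℕ))) h.choose else f (k z)

theorem Bl_cov {G G' : Type*} {L : ℕ} {J : ℤ → Prop} (hJ : DisjB L J) (pp : (Fin L → G) → (Fin L → G')) (f : G → G')
    (k : ℤ → G) {j : ℤ} (h : J j) (i : Fin L) : Bl L J pp f k (j + (i : ℕ)) = pp (wd L k j) i := by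
  have hh : ∃ i' : Fin L, J (j + (i : ℕ) - (i' : ℕ)) := ⟨i, by simpa using h⟩
  rw [Bl, dif_pos hh]
  have e := hJ.eq hh.choose_spec h hh.choose.2 i.2 (by ring)
  have e2 : hh.choose = i := by ext; omega
  simp only [e]
  rw [e2]

theorem Bl_uncov {G G' : Type*} {L : ℕ} {J : ℤ → Prop} (pp : (Fin L → G) → (Fin L → G')) (f : G → G')
    (k : ℤ → G) {z : ℤ} (h : ∀ i : Fin L, ¬ J (z - (i : ℕ))) : Bl L J pp f k z = f (k z) := by
  rw [Bl, dif_neg]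
  push Not
  exact h

theorem Bl_ext {G : Type*} {L : ℕ} {J : ℤ → Prop} {x x' : ℤ → G}
    (h1 : ∀ j, J j → ∀ i : Fin L, x (j + (i : ℕ)) = x' (j + (i : ℕ)))
    (h2 : ∀ z, (∀ i : Fin L, ¬ J (z - (i : ℕ))) → x z = x' z) : x = x' := by
  funext z
  by_cases h : ∃ i : Fin L, J (z - (i : ℕ))
  · obtain ⟨i, hi⟩ := h
    have := h1 _ hi i
    simpa using this
  · push Not at h
    exact h2 z h

theorem Bl_loc {G G' : Type*} {L : ℕ} {J : ℤ → Prop} (hJ : DisjB L J) (pp : (Fin L → G) → (Fin L → G')) (f : G → G')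
    {k k' : ℤ → G} {s : Finset ℤ} (hs : ∀ z ∈ s, ∀ i : Fin L, J (z - (i : ℕ)) → ∀ l : Fin L, z - (i : ℕ) + (l : ℕ) ∈ s)
    (h : ∀ z ∈ s, k z = k' z) : ∀ z ∈ s, Bl L J pp f k z = Bl L J pp f k' z := by
  intro z hz
  by_cases hc : ∃ i : Fin L, J (z - (i : ℕ))
  · obtain ⟨i, hi⟩ := hc
    have e : z = z - (i : ℕ) + (i : ℕ) := by ring
    rw [e, Bl_cov hJ _ _ _ hi, Bl_cov hJ _ _ _ hi]
    have : wd L k (z - (i : ℕ)) = wd L k' (z - (i : ℕ)) := by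
      funext l
      exact h _ (hs z hz i hi l)
    rw [this]
  · push Not at hc
    rw [Bl_uncov _ _ _ hc, Bl_uncov _ _ _ hc, h z hz]

theorem Bl_meas {G G' : Type*} [Countable G] [MeasurableSpace G] [MeasurableSingletonClass G] [MeasurableSpace G']
    (L : ℕ) (J : ℤ → Prop) (pp : (Fin L → G) → (Fin L → G')) (f : G → G') : Measurable (Bl L J pp f) := by
  classical
  rw [measurable_pi_iff]
  intro z
  apply measurable_of_dep (Finset.Icc (z - L) (z + L))
  intro x x' h
  unfold Bl
  split_ifs with hh
  · congr 1
    have : wd L x (z - (hh.choose : ℕ)) = wd L x' (z - (hh.choose : ℕ)) := by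
      funext l
      apply h
      have := hh.choose.2
      have := l.2
      simp only [Finset.mem_Icc]
      omega
    rw [this]
  · rw [h z (by simp)]

theorem Bl_inv {G : Type*} {L : ℕ} {J : ℤ → Prop} (hJ : DisjB L J) (pp : Equiv.Perm (Fin L → G)) (k : ℤ → G) :
    Bl L J pp.symm id (Bl L J pp id k) = k := by
  apply Bl_ext (L := L) (J := J)
  · intro j hj i
    rw [Bl_cov hJ _ _ _ hj]
    have : wd L (Bl L J pp id k) j = pp (wd L k j) := by
      funext l
      exact Bl_cov hJ _ _ _ hj l
    rw [this, Equiv.symm_apply_apply]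
    rfl
  · intro z hz
    rw [Bl_uncov _ _ _ hz, Bl_uncov _ _ _ hz]
    rfl

theorem exists_sat {L : ℕ} {J : ℤ → Prop} (hJ : DisjB L J) (s0 : Finset ℤ) : ∃ s : Finset ℤ, s0 ⊆ s ∧
    ∀ z ∈ s, ∀ i : Fin L, J (z - (i : ℕ)) → ∀ l : Fin L, z - (i : ℕ) + (l : ℕ) ∈ s := by
  classical
  refine ⟨(s0.biUnion (fun z => Finset.Icc (z - L) (z + L))).filter
    (fun w => w ∈ s0 ∨ ∃ j, J j ∧ (∃ i : Fin L, w = j + (i : ℕ)) ∧ ∃ i : Fin L, j + (i : ℕ) ∈ s0), ?_, ?_⟩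
  · intro z hz
    simp only [Finset.mem_filter, Finset.mem_biUnion, Finset.mem_Icc]
    exact ⟨⟨z, hz, by omega, by omega⟩, Or.inl hz⟩
  · intro z hz i hi l
    have hl := l.2
    simp only [Finset.mem_filter, Finset.mem_biUnion, Finset.mem_Icc] at hz ⊢
    obtain ⟨-, h | ⟨j, hj, ⟨i1, h1⟩, ⟨i2, h2⟩⟩⟩ := hz
    · have := i.2
      refine ⟨⟨z, h, by omega, by omega⟩, Or.inr ⟨z - (i : ℕ), hi, ⟨l, rfl⟩, ⟨i, by simpa using h⟩⟩⟩
    · have e := hJ.eq hi hj i.2 i1.2 (by omega)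
      rw [e]
      have := i2.2
      exact ⟨⟨_, h2, by omega, by omega⟩, Or.inr ⟨j, hj, ⟨l, rfl⟩, ⟨i2, h2⟩⟩⟩

theorem Bl_map {K : Measure (ℤ → G)} (hK : IsUnif K) {L : ℕ} {J : ℤ → Prop} (hJ : DisjB L J)
    (pp : Equiv.Perm (Fin L → G)) : K.map (Bl L J pp id) = K := by
  have := hK.prob
  have := Measure.isProbabilityMeasure_map (μ := K) (Bl_meas (G := G) L J pp id).aemeasurable
  apply ext_cyl
  intro s0
  obtain ⟨s, hs0, hs⟩ := exists_sat hJ s0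
  refine ⟨s, hs0, fun y => ?_⟩
  rw [Measure.map_apply (Bl_meas _ _ _ _) (measurableSet_cyl _ _), hK.cyl]
  have : Bl L J pp id ⁻¹' _root_.cylinder s y = _root_.cylinder s (Bl L J pp.symm id y) := by
    ext x
    simp only [mem_preimage, _root_.cylinder, mem_ofPred_eq]
    constructor
    · intro h
      have := Bl_loc hJ pp.symm id hs h
      rwa [Bl_inv hJ] at this
    · intro h
      have := Bl_loc hJ pp id hs h
      have h2 := Bl_inv hJ pp.symm y
      rw [Equiv.symm_symm] at h2
      rwa [h2] at this
  rw [this, hK.cyl]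

theorem coord_map {K : Measure (ℤ → G)} (hK : IsUnif K) {B : Type*} [Countable B] [DecidableEq B] [MeasurableSpace B]
    [MeasurableSingletonClass B] (β : G → B) :
    IsProductMeasure (K.map (fun k z => β (k z)))
      (fun _ b => ((Finset.univ.filter (fun a => β a = b)).card : ℝ) / Fintype.card G) := by
  have hm : Measurable (fun (k : ℤ → G) z => β (k z)) := by
    rw [measurable_pi_iff]
    intro z
    exact (measurable_of_countable β).comp (measurable_pi_apply z)
  have hpr : IsProbabilityMeasure (pm (fun _ : G => ((Fintype.card G : ℝ)⁻¹))) :=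
    pm_prob unif_vec.1 unif_vec.2
  intro s y
  rw [Measure.map_apply hm (measurableSet_cyl _ _),
    prod_eq_infinitePi hK (fun _ => unif_vec) inferInstance]
  have : (fun (k : ℤ → G) z => β (k z)) ⁻¹' _root_.cylinder s y = Set.pi (s : Set ℤ) (fun i => β ⁻¹' {y i}) := by
    ext x; simp [_root_.cylinder]
  rw [this, Measure.infinitePi_pi _ (fun i _ => (Set.toFinite _).measurableSet)]
  apply Finset.prod_congr rfl
  intro i _
  have e : (β ⁻¹' {y i}) = ((Finset.univ.filter (fun a => β a = y i) : Finset G) : Set G) := by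
    ext a; simp
  rw [e, ← sum_measure_singleton]
  simp only [pm_singleton, Finset.sum_const, nsmul_eq_mul]
  rw [div_eq_mul_inv, ENNReal.ofReal_mul (by positivity), ENNReal.ofReal_natCast]

end unif
end NOF

open MeasureTheory Filter Set Topology ENNReal
set_option linter.unusedSectionVars false
set_option linter.unusedVariables false
set_option linter.unusedSimpArgs false

namespace NOF

section matching

/-- partial sums -/
def SS (e : ℤ → ℤ) (z : ℤ) (n : ℕ) : ℤ := ∑ k ∈ Finset.range (n + 1), e (z + k)

/-- first time partial sums are nonpositive -/
noncomputable def mt (e : ℤ → ℤ) (z : ℤ) : ℕ := sInf {n : ℕ | SS e z n ≤ 0}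

theorem mt_spec {e : ℤ → ℤ} {z : ℤ} (h : ∃ n, SS e z n ≤ 0) : SS e z (mt e z) ≤ 0 :=
  Nat.sInf_mem (s := {n : ℕ | SS e z n ≤ 0}) h

theorem mt_lt {e : ℤ → ℤ} {z : ℤ} {k : ℕ} (h : k < mt e z) : 0 < SS e z k := by
  by_contra hk
  push Not at hk
  exact absurd h (not_lt.2 (Nat.sInf_le (s := {n : ℕ | SS e z n ≤ 0}) hk))

theorem SS_succ (e : ℤ → ℤ) (z : ℤ) (n : ℕ) : SS e z (n + 1) = SS e z n + e (z + (n + 1 : ℕ)) := by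
  unfold SS
  rw [Finset.sum_range_succ]

theorem SS_split (e : ℤ → ℤ) (z : ℤ) (a n : ℕ) :
    SS e z (a + 1 + n) = SS e z a + SS e (z + (a + 1 : ℕ)) n := by
  unfold SS
  rw [show a + 1 + n + 1 = (a + 1) + (n + 1) by ring, Finset.sum_range_add]
  congr 1
  apply Finset.sum_congr rfl
  intro k _
  push_cast
  ring_nf

open Classical in
/-- demand minus supply -/
noncomputable def ee (D U : ℤ → Prop) (z : ℤ) : ℤ := (if D z then 1 else 0) - (if U z then 1 else 0)

theorem mt_last {D U : ℤ → Prop} {z : ℤ} (hD : D z) (h : ∃ n, SS (ee D U) z n ≤ 0) :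
    (mt (ee D U) z = 0 ∧ U z) ∨
    (0 < mt (ee D U) z ∧ ee D U (z + mt (ee D U) z) = -1 ∧ SS (ee D U) z (mt (ee D U) z) = 0) := by
  have h1 := mt_spec h
  rcases hn : mt (ee D U) z with _ | n
  · left
    refine ⟨rfl, ?_⟩
    rw [hn] at h1
    have e0 : SS (ee D U) z 0 = ee D U z := by simp [SS]
    rw [e0, ee, if_pos hD] at h1
    by_contra hU
    rw [if_neg hU] at h1
    omega
  · right
    rw [hn] at h1
    have h2 : 0 < SS (ee D U) z n := mt_lt (by omega)
    have h3 := SS_succ (ee D U) z n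
    have h4 : -1 ≤ ee D U (z + (n + 1 : ℕ)) := by
      unfold ee
      split_ifs <;> norm_num
    exact ⟨by omega, by omega, by omega⟩

theorem mt_U {D U : ℤ → Prop} {z : ℤ} (hD : D z) (h : ∃ n, SS (ee D U) z n ≤ 0) :
    U (z + mt (ee D U) z) := by
  rcases mt_last hD h with ⟨h1, h2⟩ | ⟨h1, h2, h3⟩
  · rw [h1]; simpa using h2
  · by_contra hU
    simp only [ee, if_neg hU] at h2
    split_ifs at h2 <;> omega

theorem mt_inj_lt {D U : ℤ → Prop} {z z' : ℤ} (hz : z < z') (hD : D z) (h : ∃ n, SS (ee D U) z n ≤ 0)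
    (hD' : D z') (h' : ∃ n, SS (ee D U) z' n ≤ 0)
    (e : z + mt (ee D U) z = z' + mt (ee D U) z') : False := by
  obtain ⟨a, rfl⟩ : ∃ a : ℕ, z' = z + (a + 1 : ℕ) := ⟨(z' - z - 1).toNat, by push_cast; omega⟩
  rcases mt_last hD h with ⟨h1, h2⟩ | ⟨h1, h2, h3⟩
  · push_cast at e; omega
  rcases mt_last hD' h' with ⟨h1', h2'⟩ | ⟨h1', h2', h3'⟩
  · rw [e, h1', Nat.cast_zero, add_zero, ee, if_pos hD', if_pos h2'] at h2
    omega
  · have e2 : mt (ee D U) z = a + 1 + mt (ee D U) (z + (a + 1 : ℕ)) := by omega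
    rw [e2, SS_split, h3'] at h3
    have := mt_lt (e := ee D U) (z := z) (k := a) (by omega)
    omega

theorem mt_inj {D U : ℤ → Prop} {z z' : ℤ} (hD : D z) (h : ∃ n, SS (ee D U) z n ≤ 0)
    (hD' : D z') (h' : ∃ n, SS (ee D U) z' n ≤ 0)
    (e : z + mt (ee D U) z = z' + mt (ee D U) z') : z = z' := by
  rcases lt_trichotomy z z' with hlt | rfl | hlt
  · exact (mt_inj_lt hlt hD h hD' h' e).elim
  · rfl
  · exact (mt_inj_lt hlt hD' h' hD h e.symm).elim

end matching

structure Tab (L g1 g2 N m : ℕ) where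
  out : (Fin g1 → ZMod N) → (Fin L → ZMod N) → (Fin L → Fin m)
  Fl : (Fin g1 → ZMod N) → Prop
  β : ZMod N → Fin m
  hL : g2 + g1 ≤ L
  const : ∀ v, ¬ Fl v → ∀ t t', out v t = out v t'
  hpp : ∃ pp : Equiv.Perm (Fin L → ZMod N × ZMod N), ∀ w i,
    β (pp w i).2 = out (fun k : Fin g1 => (w ⟨g2 + k, by omega⟩).1) (fun k => (w k).2) i

namespace Tab
variable {L g1 g2 N m : ℕ} [NeZero N] (B : Tab L g1 g2 N m)

/-- control word of a block -/
def Vv (B : Tab L g1 g2 N m) (η : ℤ → ZMod N) (j : ℤ) : Fin g1 → ZMod N := fun i => η (j + (g2 + i : ℕ))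

/-- supply sites -/
def Us (B : Tab L g1 g2 N m) (J : ℤ → Prop) (z : ℤ) : Prop := ∃ i : Fin g2, J (z - (i : ℕ))

/-- demand sites -/
def Dm (J : ℤ → Prop) (η : ℤ → ZMod N) (z : ℤ) : Prop :=
  ∀ i : Fin L, J (z - (i : ℕ)) → B.Fl (B.Vv η (z - (i : ℕ)))

/-- score -/
noncomputable def es (J : ℤ → Prop) (η : ℤ → ZMod N) : ℤ → ℤ := ee (B.Dm J η) (B.Us J)

/-- matched demand -/
def PM (J : ℤ → Prop) (η : ℤ → ZMod N) (z : ℤ) : Prop := B.Dm J η z ∧ ∃ n, SS (B.es J η) z n ≤ 0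

/-- supply-transported digits -/
noncomputable def tt (J : ℤ → Prop) (η w : ℤ → ZMod N) : ℤ → ZMod N :=
  sel (B.PM J η) (fun z => z + mt (B.es J η) z) (η, w)

/-- table on pair words -/
def outP (W : Fin L → ZMod N × ZMod N) : Fin L → Fin m :=
  B.out (fun k : Fin g1 => (W ⟨g2 + k, by have := B.hL; omega⟩).1) (fun k => (W k).2)

/-- output given control and digits -/
noncomputable def Bk (J : ℤ → Prop) (v t : ℤ → ZMod N) : ℤ → Fin m :=
  Bl L J B.outP (fun G => B.β G.2) (fun z => (v z, t z))

/-- the output sequence -/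
noncomputable def YY (J : ℤ → Prop) (η w : ℤ → ZMod N) : ℤ → Fin m := B.Bk J η (B.tt J η w)

theorem Bk_uncov {J : ℤ → Prop} {v t : ℤ → ZMod N} {z : ℤ} (h : ∀ i : Fin L, ¬ J (z - (i : ℕ))) :
    B.Bk J v t z = B.β (t z) := by
  unfold Bk
  rw [Bl_uncov _ _ _ h]

theorem Bk_cov {J : ℤ → Prop} (hJ : DisjB L J) {v t : ℤ → ZMod N} {j : ℤ} (h : J j) (i : Fin L) :
    B.Bk J v t (j + (i : ℕ)) = B.out (B.Vv v j) (wd L t j) i := by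
  unfold Bk
  rw [Bl_cov hJ _ _ _ h]
  rfl

theorem Dm_of_block {J : ℤ → Prop} (hJ : DisjB L J) {η : ℤ → ZMod N} {j : ℤ} (hj : J j)
    (hF : B.Fl (B.Vv η j)) (k : Fin L) : B.Dm J η (j + (k : ℕ)) := by
  intro i hi
  rw [hJ.eq hi hj i.2 k.2 (by ring)]
  exact hF

theorem YY_indep {J : ℤ → Prop} (hJ : DisjB L J) {η : ℤ → ZMod N}
    (hm : ∀ z, B.Dm J η z → ∃ n, SS (B.es J η) z n ≤ 0) (w w' : ℤ → ZMod N) :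
    B.YY J η w = B.YY J η w' := by
  have key : ∀ z, B.Dm J η z → B.tt J η w z = B.tt J η w' z := by
    intro z hz
    simp only [tt, sel]
    rw [if_pos ⟨hz, hm z hz⟩, if_pos ⟨hz, hm z hz⟩]
  apply Bl_ext (L := L) (J := J)
  · intro j hj i
    rw [YY, YY, B.Bk_cov hJ hj, B.Bk_cov hJ hj]
    by_cases hF : B.Fl (B.Vv η j)
    · have : wd L (B.tt J η w) j = wd L (B.tt J η w') j := by
        funext k
        exact key _ (B.Dm_of_block hJ hj hF k)
      rw [this]
    · rw [B.const _ hF]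
  · intro z hz
    rw [YY, YY, B.Bk_uncov hz, B.Bk_uncov hz, key z (fun i hi => (hz i hi).elim)]

/-- control sites -/
def Vs (B : Tab L g1 g2 N m) (J : ℤ → Prop) (z : ℤ) : Prop := ∃ j, J j ∧ ∃ i : Fin g1, z = j + (g2 + i : ℕ)

theorem Vv_congr {J : ℤ → Prop} {v v' : ℤ → ZMod N} (h : ∀ z, B.Vs J z → v z = v' z) {j : ℤ} (hj : J j) :
    B.Vv v j = B.Vv v' j := by
  funext i
  exact h _ ⟨j, hj, i, rfl⟩

theorem Dm_congr {J : ℤ → Prop} {v v' : ℤ → ZMod N} (h : ∀ z, B.Vs J z → v z = v' z) :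
    B.Dm J v = B.Dm J v' := by
  funext z
  unfold Dm
  apply propext
  apply forall_congr'
  intro i
  constructor
  · intro h1 hj; rw [← B.Vv_congr h hj]; exact h1 hj
  · intro h1 hj; rw [B.Vv_congr h hj]; exact h1 hj

theorem Bk_congr {J : ℤ → Prop} (hJ : DisjB L J) {v v' t : ℤ → ZMod N} (h : ∀ z, B.Vs J z → v z = v' z) :
    B.Bk J v t = B.Bk J v' t := by
  apply Bl_ext (L := L) (J := J)
  · intro j hj i
    rw [B.Bk_cov hJ hj, B.Bk_cov hJ hj, B.Vv_congr h hj]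
  · intro z hz
    rw [B.Bk_uncov hz, B.Bk_uncov hz]

theorem Us_not_Vs {J : ℤ → Prop} (hJ : DisjB L J) {z : ℤ} (hU : B.Us J z) : ¬ B.Vs J z := by
  rintro ⟨j, hj, i, rfl⟩
  obtain ⟨i', h⟩ := hU
  have := B.hL
  have e := hJ.eq h hj (i := i') (i' := g2 + i) (by omega) (by omega) (by ring)
  have := i'.2
  push_cast at e
  omega

theorem YY_merge {J : ℤ → Prop} (hJ : DisjB L J) (v u w : ℤ → ZMod N) :
    B.YY J (sel (B.Vs J) id (v, u)) w =
      B.Bk J v (sel (B.PM J v) (fun z => z + mt (B.es J v) z) (u, w)) := by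
  have h : ∀ z, B.Vs J z → sel (B.Vs J) id (v, u) z = v z := by
    intro z hz
    simp [sel, hz]
  have hD := B.Dm_congr h
  have he : B.es J (sel (B.Vs J) id (v, u)) = B.es J v := by rw [es, es, hD]
  have hP : B.PM J (sel (B.Vs J) id (v, u)) = B.PM J v := by
    funext z; rw [PM, PM, hD, he]
  rw [YY, B.Bk_congr hJ h]
  congr 1
  unfold tt
  rw [hP, he]
  funext z
  simp only [sel]
  split_ifs with h1 h2
  · exact (B.Us_not_Vs hJ (mt_U h1.1 h1.2) h2).elim
  · rfl
  · rfl

theorem meas_sInf {X : Type*} [MeasurableSpace X] {p : X → ℕ → Prop} (hp : ∀ n, MeasurableSet {x | p x n}) :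
    Measurable (fun x => sInf {n | p x n}) := by
  classical
  apply measurable_to_countable'
  intro n
  have : (fun x => sInf {n | p x n}) ⁻¹' {n} =
      ({x | p x n} ∩ ⋂ k ∈ Finset.range n, {x | p x k}ᶜ) ∪ (if n = 0 then ⋂ k, {x | p x k}ᶜ else ∅) := by
    ext x
    simp only [mem_preimage, mem_singleton_iff, mem_union, mem_inter_iff, mem_ofPred_eq, mem_iInter,
      Finset.mem_range, mem_compl_iff]
    constructor
    · rintro rfl
      by_cases h : ∃ n, p x n
      · left
        exact ⟨Nat.sInf_mem (s := {n | p x n}) h, fun k hk hk2 => absurd hk (not_lt.2 (Nat.sInf_le hk2))⟩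
      · right
        push Not at h
        have : {n | p x n} = ∅ := by ext; simp [h]
        rw [this, Nat.sInf_empty, if_pos rfl]
        simp [h]
    · rintro (⟨h1, h2⟩ | h)
      · apply le_antisymm (Nat.sInf_le h1)
        by_contra hlt
        push Not at hlt
        exact h2 _ hlt (Nat.sInf_mem (s := {n | p x n}) ⟨n, h1⟩)
      · split_ifs at h with h0
        · subst h0
          have : {n | p x n} = ∅ := by
            ext k
            simp only [mem_iInter, mem_compl_iff, mem_ofPred_eq] at h
            simp [h k]
          rw [this, Nat.sInf_empty]
        · exact h.elim
  rw [this]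
  apply MeasurableSet.union
  · exact (hp n).inter (Finset.measurableSet_biInter _ fun k _ => (hp k).compl)
  · split_ifs
    · exact MeasurableSet.iInter fun k => (hp k).compl
    · exact MeasurableSet.empty

theorem Dm_meas (J : ℤ → Prop) (z : ℤ) : MeasurableSet {η | B.Dm J η z} := by
  rw [measurableSet_setOfPred]
  apply measurable_of_dep (Finset.Icc (z - L) (z + L))
  intro x x' h
  unfold Dm
  apply propext
  apply forall_congr'
  intro i
  have : B.Vv x (z - (i : ℕ)) = B.Vv x' (z - (i : ℕ)) := by
    funext k
    apply h
    have := B.hL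
    have := i.2
    have := k.2
    simp only [Finset.mem_Icc]
    push_cast
    omega
  rw [this]

theorem SS_meas (J : ℤ → Prop) (z : ℤ) (n : ℕ) : MeasurableSet {η | SS (B.es J η) z n ≤ 0} := by
  classical
  have : Measurable (fun η => SS (B.es J η) z n) := by
    unfold SS
    apply Finset.measurable_sum
    intro k _
    unfold es ee
    apply Measurable.sub _ measurable_const
    exact Measurable.ite (B.Dm_meas J _) measurable_const measurable_const
  exact this measurableSet_Iic

theorem PM_meas (J : ℤ → Prop) (z : ℤ) : MeasurableSet {η | B.PM J η z} := by
  have h0 : {η | B.PM J η z} = {η | B.Dm J η z} ∩ {η | ∃ n, SS (B.es J η) z n ≤ 0} := rfl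
  rw [h0]
  apply (B.Dm_meas J z).inter
  have : {η | ∃ n, SS (B.es J η) z n ≤ 0} = ⋃ n, {η | SS (B.es J η) z n ≤ 0} := by ext; simp
  rw [this]
  exact MeasurableSet.iUnion fun n => B.SS_meas J z n

theorem tt_meas (J : ℤ → Prop) (z : ℤ) :
    Measurable (fun ηw : (ℤ → ZMod N) × (ℤ → ZMod N) => B.tt J ηw.1 ηw.2 z) := by
  classical
  unfold tt sel
  apply Measurable.ite
  · exact measurable_fst (B.PM_meas J z)
  · have h1 : Measurable (fun η : ℤ → ZMod N => η (z + (mt (B.es J η) z : ℕ))) := by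
      have : Measurable (fun ηn : (ℤ → ZMod N) × ℕ => ηn.1 (z + (ηn.2 : ℕ))) :=
        measurable_from_prod_countable_left fun n => measurable_pi_apply (z + (n : ℕ))
      exact this.comp (measurable_id.prodMk (meas_sInf (fun n => B.SS_meas J z n)))
    exact h1.comp measurable_fst
  · exact (measurable_pi_apply z).comp measurable_snd

theorem Bk_meas (J : ℤ → Prop) :
    Measurable (fun vt : (ℤ → ZMod N) × (ℤ → ZMod N) => B.Bk J vt.1 vt.2) := by
  apply (Bl_meas L J B.outP _).comp
  rw [measurable_pi_iff]
  intro z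
  exact ((measurable_pi_apply z).comp measurable_fst).prodMk ((measurable_pi_apply z).comp measurable_snd)

theorem YY_meas (J : ℤ → Prop) :
    Measurable (fun ηw : (ℤ → ZMod N) × (ℤ → ZMod N) => B.YY J ηw.1 ηw.2) := by
  apply (B.Bk_meas J).comp (measurable_fst.prodMk _)
  rw [measurable_pi_iff]
  exact fun z => B.tt_meas J z

theorem law_prod {H : Measure (ℤ → ZMod N)} (hH : IsUnif H) {J : ℤ → Prop} (hJ : DisjB L J) :
    IsProductMeasure ((H.prod H).map (fun ηw => B.YY J ηw.1 ηw.2))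
      (fun _ b => ((Finset.univ.filter (fun a => B.β a = b)).card : ℝ) / N) := by
  classical
  have := hH.prob
  obtain ⟨pp, hpp⟩ := B.hpp
  set K := (H.prod H).map (fun (vt : (ℤ → ZMod N) × (ℤ → ZMod N)) z => (vt.1 z, vt.2 z)) with hKd
  have hK : IsUnif K := pair_unif hH
  have hpm : Measurable (fun (vt : (ℤ → ZMod N) × (ℤ → ZMod N)) z => (vt.1 z, vt.2 z)) := by
    rw [measurable_pi_iff]
    intro z
    exact ((measurable_pi_apply z).comp measurable_fst).prodMk ((measurable_pi_apply z).comp measurable_snd)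
  have hβm : Measurable (fun (k : ℤ → ZMod N × ZMod N) z => B.β (k z).2) := by
    rw [measurable_pi_iff]
    intro z
    exact (measurable_of_countable (fun p : ZMod N × ZMod N => B.β p.2)).comp (measurable_pi_apply z)
  have h1 := coord_map hK (fun p : ZMod N × ZMod N => B.β p.2)
  have h2 : (H.prod H).map (fun ηw => B.YY J ηw.1 ηw.2) = K.map (fun k z => B.β (k z).2) := by
    have eB : (fun vt : (ℤ → ZMod N) × (ℤ → ZMod N) => B.Bk J vt.1 vt.2)
        = ((fun (k : ℤ → ZMod N × ZMod N) z => B.β (k z).2) ∘ Bl L J pp id) ∘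
          (fun (vt : (ℤ → ZMod N) × (ℤ → ZMod N)) z => (vt.1 z, vt.2 z)) := by
      funext vt
      apply Bl_ext (L := L) (J := J)
      · intro j hj i
        rw [B.Bk_cov hJ hj]
        simp only [Function.comp]
        rw [Bl_cov hJ _ _ _ hj, hpp]
        rfl
      · intro z hz
        rw [B.Bk_uncov hz]
        simp only [Function.comp]
        rw [Bl_uncov _ _ _ hz]
        rfl
    have h3 : K.map (fun k z => B.β (k z).2) = (H.prod H).map (fun vt => B.Bk J vt.1 vt.2) := by
      rw [eB, ← Measure.map_map (hβm.comp (Bl_meas _ _ _ _)) hpm, ← hKd,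
        ← Measure.map_map hβm (Bl_meas _ _ _ _), Bl_map hK hJ]
    rw [h3]
    ext E hE
    rw [Measure.map_apply (B.YY_meas J) hE, Measure.map_apply (B.Bk_meas J) hE,
      Measure.prod_apply (B.YY_meas J hE), Measure.prod_apply (B.Bk_meas J hE)]
    have hmeas := measurable_measure_prodMk_left (ν := H) (B.YY_meas J hE)
    have hsm := sel_map hH (B.Vs J) id (fun z z' _ _ h => h)
    have e0 : ∫⁻ x, H (Prod.mk x ⁻¹' ((fun ηw : (ℤ → ZMod N) × (ℤ → ZMod N) => B.YY J ηw.1 ηw.2) ⁻¹' E)) ∂H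
      = ∫⁻ x, H (Prod.mk x ⁻¹' ((fun ηw : (ℤ → ZMod N) × (ℤ → ZMod N) => B.YY J ηw.1 ηw.2) ⁻¹' E))
        ∂((H.prod H).map (sel (B.Vs J) id)) := by rw [hsm]
    have hmc : Measurable (fun a => H (Prod.mk (sel (B.Vs J) id a) ⁻¹'
      ((fun ηw : (ℤ → ZMod N) × (ℤ → ZMod N) => B.YY J ηw.1 ηw.2) ⁻¹' E))) := hmeas.comp (sel_meas _ _)
    rw [e0, lintegral_map hmeas (sel_meas _ _), lintegral_prod _ hmc.aemeasurable]
    apply lintegral_congr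
    intro v
    have hBv : Measurable (fun t => B.Bk J v t) := (B.Bk_meas J).comp (measurable_const.prodMk measurable_id)
    have hs := sel_map hH (B.PM J v) (fun z => z + mt (B.es J v) z)
      (fun z z' h h' e => mt_inj h.1 h.2 h'.1 h'.2 e)
    have e1 : H (Prod.mk v ⁻¹' ((fun vt : (ℤ → ZMod N) × (ℤ → ZMod N) => B.Bk J vt.1 vt.2) ⁻¹' E))
        = H ((fun t => B.Bk J v t) ⁻¹' E) := rfl
    rw [e1]
    have e2 : H ((fun t => B.Bk J v t) ⁻¹' E) = ((H.prod H).map (sel (B.PM J v) (fun z => z + mt (B.es J v) z)))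
        ((fun t => B.Bk J v t) ⁻¹' E) := by rw [hs]
    rw [e2]
    rw [Measure.map_apply (sel_meas _ _) (hBv hE), Measure.prod_apply (sel_meas _ _ (hBv hE))]
    apply lintegral_congr
    intro u
    congr 1
    ext w
    simp only [mem_preimage]
    rw [B.YY_merge hJ]
  rw [h2]
  intro s y
  rw [h1 s y]
  apply Finset.prod_congr rfl
  intro i _
  congr 1
  have hcard : (Finset.univ.filter (fun a : ZMod N × ZMod N => B.β a.2 = y i)).card
      = N * (Finset.univ.filter (fun a : ZMod N => B.β a = y i)).card := by
    have : (Finset.univ.filter (fun a : ZMod N × ZMod N => B.β a.2 = y i))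
      = (Finset.univ : Finset (ZMod N)) ×ˢ (Finset.univ.filter (fun a : ZMod N => B.β a = y i)) := by
      ext ⟨a, b⟩; simp
    rw [this, Finset.card_product, Finset.card_univ, ZMod.card]
  have hN : (N : ℝ) ≠ 0 := Nat.cast_ne_zero.2 (NeZero.ne N)
  simp only [hcard, Fintype.card_prod, ZMod.card]
  push_cast
  field_simp

theorem law {H : Measure (ℤ → ZMod N)} (hH : IsUnif H) {J : ℤ → Prop} (hJ : DisjB L J)
    (hm : ∀ᵐ η ∂H, ∀ z, B.Dm J η z → ∃ n, SS (B.es J η) z n ≤ 0) :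
    IsProductMeasure (H.map (fun η => B.YY J η 0))
      (fun _ b => ((Finset.univ.filter (fun a => B.β a = b)).card : ℝ) / N) := by
  have := hH.prob
  have hYm : Measurable (fun η => B.YY J η 0) := (B.YY_meas J).comp (measurable_id.prodMk measurable_const)
  have e : H.map (fun η => B.YY J η 0) = (H.prod H).map (fun ηw => B.YY J ηw.1 ηw.2) := by
    have : H = (H.prod H).map Prod.fst := by rw [Measure.map_fst_prod]; simp
    conv_lhs => rw [this]
    rw [Measure.map_map hYm measurable_fst]
    apply Measure.map_congr
    have hm2 := Measure.quasiMeasurePreserving_fst (μ := H) (ν := H) |>.ae hm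
    filter_upwards [hm2] with ηw h
    exact B.YY_indep hJ h _ _
  rw [e]
  exact B.law_prod hH hJ

end Tab
end NOF

open MeasureTheory Filter Set Topology ENNReal
set_option linter.unusedSectionVars false
set_option linter.unusedVariables false
set_option linter.unusedSimpArgs false

namespace NOF

namespace Tab
variable {L g1 g2 N m : ℕ} [NeZero N] (B : Tab L g1 g2 N m)

/-- `YY` reads the digits only inside the blocks -/
theorem YY_dig {J : ℤ → Prop} (hJ : DisjB L J) {η η' : ℤ → ZMod N}
    (h : ∀ j, J j → ∀ i : Fin (g2 + g1), η (j + (i : ℕ)) = η' (j + (i : ℕ))) :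
    B.Dm J η = B.Dm J η' ∧ B.YY J η 0 = B.YY J η' 0 := by
  have hV : ∀ z, B.Vs J z → η z = η' z := by
    rintro _ ⟨j, hj, i, rfl⟩
    exact h j hj ⟨g2 + i, by omega⟩
  have hU : ∀ z, B.Us J z → η z = η' z := by
    rintro z ⟨i, hi⟩
    have := h _ hi ⟨i, by omega⟩
    simpa using this
  have hD := B.Dm_congr hV
  refine ⟨hD, ?_⟩
  have he : B.es J η = B.es J η' := by rw [es, es, hD]
  have hP : B.PM J η = B.PM J η' := by funext z; rw [PM, PM, hD, he]
  rw [YY, YY, B.Bk_congr hJ hV]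
  congr 1
  unfold tt
  rw [hP, he]
  funext z
  simp only [sel]
  split_ifs with h1
  · exact hU _ (mt_U h1.1 h1.2)
  · rfl

/-- all demands are matched -/
def AllM (J : ℤ → Prop) (η : ℤ → ZMod N) : Prop := ∀ z, B.Dm J η z → ∃ n, SS (B.es J η) z n ≤ 0

theorem Dm_shift (J : ℤ → Prop) (η : ℤ → ZMod N) (k z : ℤ) :
    B.Dm (fun j => J (j + k)) (fun j => η (j + k)) z ↔ B.Dm J η (z + k) := by
  unfold Dm
  apply forall_congr'
  intro i
  have e : z - ((i : ℕ) : ℤ) + k = z + k - (i : ℕ) := by ring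
  have e2 : B.Vv (fun j => η (j + k)) (z - (i : ℕ)) = B.Vv η (z + k - (i : ℕ)) := by
    funext l
    simp only [Vv]
    congr 1
    ring
  beta_reduce
  rw [e, e2]

theorem es_shift (J : ℤ → Prop) (η : ℤ → ZMod N) (k z : ℤ) :
    B.es (fun j => J (j + k)) (fun j => η (j + k)) z = B.es J η (z + k) := by
  have h2 : B.Us (fun j => J (j + k)) z ↔ B.Us J (z + k) := by
    unfold Us
    apply exists_congr
    intro i
    beta_reduce
    rw [show z - ((i : ℕ) : ℤ) + k = z + k - (i : ℕ) by ring]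
  classical
  unfold es ee
  simp only [B.Dm_shift, h2]

theorem SS_shift (J : ℤ → Prop) (η : ℤ → ZMod N) (k z : ℤ) (n : ℕ) :
    SS (B.es (fun j => J (j + k)) (fun j => η (j + k))) z n = SS (B.es J η) (z + k) n := by
  unfold SS
  apply Finset.sum_congr rfl
  intro i _
  rw [B.es_shift]
  congr 1
  ring

theorem AllM_shift {J : ℤ → Prop} {η : ℤ → ZMod N} (h : B.AllM J η) (k : ℤ) :
    B.AllM (fun j => J (j + k)) (fun j => η (j + k)) := by
  intro z hz
  simp only [B.SS_shift]
  exact h _ ((B.Dm_shift _ _ _ _).1 hz)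

theorem tt_shift (J : ℤ → Prop) (η : ℤ → ZMod N) (k z : ℤ) :
    B.tt (fun j => J (j + k)) (fun j => η (j + k)) 0 z = B.tt J η 0 (z + k) := by
  have hm : mt (B.es (fun j => J (j + k)) (fun j => η (j + k))) z = mt (B.es J η) (z + k) := by
    unfold mt
    simp only [B.SS_shift]
  have hP : B.PM (fun j => J (j + k)) (fun j => η (j + k)) z ↔ B.PM J η (z + k) := by
    unfold PM
    rw [B.Dm_shift]
    simp only [B.SS_shift]
  classical
  simp only [tt, sel]
  simp only [hP, hm]
  simp only [Pi.zero_apply]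
  split_ifs
  · congr 1; ring
  · rfl

theorem YY_shift {J : ℤ → Prop} (hJ : DisjB L J) (η : ℤ → ZMod N) (k z : ℤ) :
    B.YY (fun j => J (j + k)) (fun j => η (j + k)) 0 z = B.YY J η 0 (z + k) := by
  have hJ' : DisjB L (fun j => J (j + k)) := by
    intro j j' h h' hlt
    have := hJ _ _ h h' (by omega)
    omega
  unfold YY
  by_cases h : ∃ i : Fin L, J (z + k - (i : ℕ))
  · obtain ⟨i, hi⟩ := h
    have e1 : z = z - (i : ℕ) + (i : ℕ) := by ring
    have e2 : z + k = z + k - (i : ℕ) + (i : ℕ) := by ring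
    have hi' : (fun j => J (j + k)) (z - (i : ℕ)) := by
      show J _
      rwa [show z - ((i : ℕ) : ℤ) + k = z + k - (i : ℕ) by ring]
    rw [e2, B.Bk_cov hJ hi]
    conv_lhs => rw [e1]
    rw [B.Bk_cov hJ' hi']
    have hv : B.Vv (fun j => η (j + k)) (z - (i : ℕ)) = B.Vv η (z + k - (i : ℕ)) := by
      funext l
      simp only [Vv]
      congr 1
      ring
    have hw : ∀ l : ℤ, B.tt (fun j => J (j + k)) (fun j => η (j + k)) 0 (z - (i : ℕ) + l)
        = B.tt J η 0 (z + k - (i : ℕ) + l) := by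
      intro l
      rw [B.tt_shift]
      congr 1
      ring
    rw [hv]
    rw [show wd L (B.tt (fun j => J (j + k)) (fun j => η (j + k)) 0) (z - (i : ℕ)) = wd L (B.tt J η 0) (z + k - (i : ℕ)) from funext fun l => hw _]
  · push Not at h
    rw [B.Bk_uncov h, B.Bk_uncov, B.tt_shift]
    intro i
    rw [show z - ((i : ℕ) : ℤ) + k = z + k - (i : ℕ) by ring]
    exact h i

theorem SS_congr {e e' : ℤ → ℤ} {z : ℤ} {n : ℕ} (h : ∀ w, z ≤ w → w ≤ z + n → e w = e' w) :
    SS e z n = SS e' z n := by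
  unfold SS
  apply Finset.sum_congr rfl
  intro k hk
  have := Finset.mem_range.1 hk
  apply h <;> omega

theorem mt_congr {e e' : ℤ → ℤ} {z : ℤ} (hm : ∃ n, SS e z n ≤ 0)
    (h : ∀ w, z ≤ w → w ≤ z + mt e z → e w = e' w) :
    mt e' z = mt e z ∧ ∃ n, SS e' z n ≤ 0 := by
  have h1 : SS e' z (mt e z) ≤ 0 := by
    rw [← SS_congr h]; exact mt_spec hm
  refine ⟨?_, _, h1⟩
  have hle : mt e' z ≤ mt e z := Nat.sInf_le h1
  rcases hle.lt_or_eq with hlt | heq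
  swap
  · exact heq
  exfalso
  have h2 := mt_lt hlt
  have h3 := mt_spec ⟨_, h1⟩
  rw [← SS_congr (e := e) (n := mt e' z) (fun w h4 h5 => h w h4 (by omega))] at h3
  omega

theorem YY_loc {J : ℤ → Prop} (hJ : DisjB L J) {η : ℤ → ZMod N} (hm : B.AllM J η) :
    ∃ M : ℕ, ∀ (J' : ℤ → Prop) (η' : ℤ → ZMod N), DisjB L J' →
      (∀ z : ℤ, -M ≤ z → z ≤ M → (J z ↔ J' z) ∧ η z = η' z) → B.YY J' η' 0 0 = B.YY J η 0 0 := by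
  obtain ⟨Nm, hNm⟩ : ∃ Nm : ℕ, ∀ z ∈ Finset.Icc (-(L : ℤ)) L, mt (B.es J η) z ≤ Nm :=
    ⟨(Finset.Icc (-(L : ℤ)) L).sup (fun z => mt (B.es J η) z), fun z hz => Finset.le_sup (f := fun z => mt (B.es J η) z) hz⟩
  refine ⟨Nm + 3 * L, fun J' η' hJ' hag => ?_⟩
  have hhL := B.hL
  push_cast at hag
  have hV : ∀ j : ℤ, -(2 * L : ℤ) ≤ j → j ≤ Nm + 2 * L → B.Vv η j = B.Vv η' j := by
    intro j h1 h2
    funext l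
    have := l.2
    exact (hag _ (by push_cast; omega) (by push_cast; omega)).2
  have hD : ∀ z : ℤ, -(L : ℤ) ≤ z → z ≤ Nm + 2 * L → (B.Dm J η z ↔ B.Dm J' η' z) := by
    intro z h1 h2
    unfold Dm
    apply forall_congr'
    intro i
    have := i.2
    rw [(hag (z - (i : ℕ)) (by omega) (by omega)).1, hV (z - (i : ℕ)) (by omega) (by omega)]
  have hU : ∀ z : ℤ, -(L : ℤ) ≤ z → z ≤ Nm + 2 * L → (B.Us J z ↔ B.Us J' z) := by
    intro z h1 h2
    unfold Us
    apply exists_congr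
    intro i
    have := i.2
    rw [(hag (z - (i : ℕ)) (by omega) (by omega)).1]
  have he : ∀ z : ℤ, -(L : ℤ) ≤ z → z ≤ Nm + 2 * L → B.es J η z = B.es J' η' z := by
    intro z h1 h2
    unfold es ee
    classical
    simp only [hD z h1 h2, hU z h1 h2]
  have ht : ∀ z : ℤ, -(L : ℤ) ≤ z → z ≤ L → B.tt J' η' 0 z = B.tt J η 0 z := by
    intro z h1 h2
    have hn := hNm z (by simp [h1, h2])
    by_cases hz : B.Dm J η z
    · have hz' := (hD z h1 (by omega)).1 hz
      obtain ⟨e1, e2⟩ := mt_congr (hm z hz) (e' := B.es J' η') (fun w h3 h4 => he w (by omega) (by omega))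
      simp only [tt, sel]
      rw [if_pos ⟨hz', e2⟩, if_pos ⟨hz, hm z hz⟩, e1]
      exact ((hag _ (by omega) (by omega)).2).symm
    · have hz' : ¬ B.Dm J' η' z := fun h => hz ((hD z h1 (by omega)).2 h)
      simp only [tt, sel]
      rw [if_neg (fun h => hz' h.1), if_neg (fun h => hz h.1)]
  unfold YY
  by_cases h : ∃ i : Fin L, J (0 - (i : ℕ))
  · obtain ⟨i, hi⟩ := h
    have := i.2
    have e1 : (0 : ℤ) = 0 - (i : ℕ) + (i : ℕ) := by ring
    have hi' : J' (0 - (i : ℕ)) := (hag _ (by omega) (by omega)).1.1 hi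
    have k1 := B.Bk_cov hJ (v := η) (t := B.tt J η 0) hi i
    have k2 := B.Bk_cov hJ' (v := η') (t := B.tt J' η' 0) hi' i
    rw [← e1] at k1 k2
    rw [k1, k2, hV _ (by omega) (by omega)]
    congr 1
    funext l
    have := l.2
    exact ht _ (by omega) (by omega)
  · push Not at h
    rw [B.Bk_uncov h, B.Bk_uncov, ht 0 (by omega) (by omega)]
    intro i hi
    have := i.2
    exact h i ((hag _ (by omega) (by omega)).1.2 hi)

end Tab

theorem unif_translate {G : Type*} [Fintype G] [AddGroup G] [MeasurableSpace G] [MeasurableSingletonClass G]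
    {H : Measure (ℤ → G)} (hH : IsUnif H) (ξ : ℤ → G) : H.map (fun ω => ξ + ω) = H := by
  have := hH.prob
  have hm : Measurable (fun ω : ℤ → G => ξ + ω) := by
    rw [measurable_pi_iff]
    intro z
    exact (measurable_of_countable (fun a : G => ξ z + a)).comp (measurable_pi_apply z)
  have := Measure.isProbabilityMeasure_map (μ := H) hm.aemeasurable
  apply ext_cyl
  intro s
  refine ⟨s, subset_rfl, fun y => ?_⟩
  rw [Measure.map_apply hm (measurableSet_cyl _ _)]
  have : (fun ω => ξ + ω) ⁻¹' _root_.cylinder s y = _root_.cylinder s (-ξ + y) := by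
    ext ω
    simp only [mem_preimage, _root_.cylinder, mem_ofPred_eq, Pi.add_apply, Pi.neg_apply]
    apply forall₂_congr
    intro i _
    rw [eq_neg_add_iff_add_eq]
  rw [this, hH.cyl, hH.cyl]

namespace Sys
variable {A : Type*} {L g1 g2 N m : ℕ} [NeZero N] (Q : Sys A L (g2 + g1) N) (B : Tab L g1 g2 N m)

theorem DJ (x : ℤ → A) : DisjB L (Q.InJ x) := Q.disj x

open Classical in
/-- digit sequence -/
noncomputable def xi (x : ℤ → A) : ℤ → ZMod N := fun z =>
  if h : ∃ i : Fin (g2 + g1), Q.InJ x (z - (i : ℕ)) then Q.dig (wd L x (z - (h.choose : ℕ))) h.choose else 0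

theorem xi_cov {x : ℤ → A} {j : ℤ} (h : Q.InJ x j) (i : Fin (g2 + g1)) :
    Q.xi x (j + (i : ℕ)) = Q.dig (wd L x j) i := by
  have hh : ∃ i' : Fin (g2 + g1), Q.InJ x (j + (i : ℕ) - (i' : ℕ)) := ⟨i, by simpa using h⟩
  rw [xi, dif_pos hh]
  have hs := hh.choose_spec
  have gL := Q.gL
  have h1 := hh.choose.2
  have e := Q.disj' hs h (i := hh.choose) (i' := i) (by omega) (by omega) (by ring)
  have e2 : hh.choose = i := by ext; omega
  simp only [e]
  rw [e2]

theorem xi_uncov {x : ℤ → A} {z : ℤ} (h : ∀ i : Fin (g2 + g1), ¬ Q.InJ x (z - (i : ℕ))) : Q.xi x z = 0 := by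
  rw [xi, dif_neg]
  push Not
  exact h

theorem xi_loc {x x' : ℤ → A} {z : ℤ}
    (hx : ∀ w, z - 2 * Q.R ≤ w → w ≤ z + 2 * Q.R → x w = x' w) : Q.xi x z = Q.xi x' z := by
  have hLR := Q.LR
  have gL := Q.gL
  have hJ : ∀ i : Fin (g2 + g1), Q.InJ x (z - (i : ℕ)) ↔ Q.InJ x' (z - (i : ℕ)) := by
    intro i
    have hi := i.2
    apply Q.loc
    intro w h1 h2
    apply hx <;> omega
  by_cases h : ∃ i : Fin (g2 + g1), Q.InJ x (z - (i : ℕ))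
  · obtain ⟨i, hi⟩ := h
    have hi2 := i.2
    have e : z = z - (i : ℕ) + (i : ℕ) := by ring
    rw [e, Q.xi_cov hi, Q.xi_cov ((hJ i).1 hi)]
    have : wd L x (z - (i : ℕ)) = wd L x' (z - (i : ℕ)) := by
      funext k
      have := k.2
      apply hx <;> omega
    rw [this]
  · push Not at h
    rw [Q.xi_uncov h, Q.xi_uncov (fun i hi => h i ((hJ i).2 hi))]

theorem xi_shift (x : ℤ → A) (k z : ℤ) : Q.xi (fun j => x (j + k)) z = Q.xi x (z + k) := by
  by_cases h : ∃ i : Fin (g2 + g1), Q.InJ x (z + k - (i : ℕ))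
  · obtain ⟨i, hi⟩ := h
    have e1 : z = z - (i : ℕ) + (i : ℕ) := by ring
    have e2 : z + k = z + k - (i : ℕ) + (i : ℕ) := by ring
    have e3 : z - ((i : ℕ) : ℤ) + k = z + k - (i : ℕ) := by ring
    have hi' : Q.InJ (fun j => x (j + k)) (z - (i : ℕ)) := by
      rw [Q.equi, e3]; exact hi
    rw [e2, Q.xi_cov hi]
    conv_lhs => rw [e1]
    rw [Q.xi_cov hi']
    have hw : wd L (fun j => x (j + k)) (z - (i : ℕ)) = wd L x (z + k - (i : ℕ)) := by
      funext l
      simp only [wd]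
      congr 1
      ring
    rw [hw]
  · push Not at h
    rw [Q.xi_uncov h, Q.xi_uncov]
    intro i
    rw [Q.equi, show z - ((i : ℕ) : ℤ) + k = z + k - (i : ℕ) by ring]
    exact h i

/-- raw coding -/
noncomputable def yy (x : ℤ → A) : ℤ → Fin m := B.YY (Q.InJ x) (Q.xi x) 0

theorem yy_shift (x : ℤ → A) (k z : ℤ) : Q.yy B (fun j => x (j + k)) z = Q.yy B x (z + k) := by
  unfold yy
  rw [← B.YY_shift (Q.DJ x)]
  congr 1
  · funext j; exact propext (Q.equi x j k)
  · funext j; exact Q.xi_shift x k j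

/-- good points -/
def Good (x : ℤ → A) : Prop := B.AllM (Q.InJ x) (Q.xi x)

theorem Good_shift {x : ℤ → A} (h : Q.Good B x) (k : ℤ) : Q.Good B (fun j => x (j + k)) := by
  have := B.AllM_shift h k
  unfold Good
  convert this using 1
  · funext j; exact propext (Q.equi x j k)
  · funext j; exact Q.xi_shift x k j

/-- locally determined points -/
def Od (b : Fin m) (n : ℕ) : Set (ℤ → A) :=
  {x | ∀ x', (∀ i : ℤ, -n ≤ i → i ≤ n → x' i = x i) → Q.yy B x' 0 = b}

theorem Good_loc {x : ℤ → A} (h : Q.Good B x) : ∃ n, x ∈ Q.Od B (Q.yy B x 0) n := by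
  obtain ⟨M, hM⟩ := B.YY_loc (Q.DJ x) h
  refine ⟨M + 2 * Q.R, fun x' hx' => ?_⟩
  apply hM _ _ (Q.DJ x')
  intro z h1 h2
  push_cast at hx'
  constructor
  · apply Q.loc
    intro w h3 h4
    exact (hx' w (by omega) (by omega)).symm
  · apply Q.xi_loc
    intro w h3 h4
    exact (hx' w (by omega) (by omega)).symm

open Classical in
/-- measurable version of the coding -/
noncomputable def ph0 (b0 : Fin m) (x : ℤ → A) : Fin m := if ∃ b n, x ∈ Q.Od B b n then Q.yy B x 0 else b0

theorem Od_yy {x : ℤ → A} {b : Fin m} {n : ℕ} (h : x ∈ Q.Od B b n) : Q.yy B x 0 = b := h x (fun _ _ _ => rfl)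

theorem Od_mono {x x' : ℤ → A} {b : Fin m} {n : ℕ} (h : x ∈ Q.Od B b n)
    (hx : ∀ i : ℤ, -n ≤ i → i ≤ n → x' i = x i) : x' ∈ Q.Od B b n := by
  intro x'' h''
  apply h
  intro i h1 h2
  rw [h'' i h1 h2, hx i h1 h2]

/-- the coding map -/
noncomputable def ph (b0 : Fin m) (x : ℤ → A) : ℤ → Fin m := fun z => Q.ph0 B b0 (fun j => x (j + z))

theorem ph_good (b0 : Fin m) {x : ℤ → A} (h : Q.Good B x) : Q.ph B b0 x = Q.yy B x := by
  funext z
  unfold ph ph0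
  obtain ⟨n, hn⟩ := Q.Good_loc B (Q.Good_shift B h z)
  rw [if_pos ⟨_, n, hn⟩, Q.yy_shift, zero_add]

theorem ph_loc (b0 : Fin m) {x : ℤ → A} (h : Q.Good B x) :
    ∃ n : ℕ, ∀ x', (∀ i : ℤ, -n ≤ i → i ≤ n → x' i = x i) → Q.ph B b0 x' 0 = Q.ph B b0 x 0 := by
  obtain ⟨n, hn⟩ := Q.Good_loc B h
  refine ⟨n, fun x' hx' => ?_⟩
  unfold ph
  simp only [add_zero]
  have h' := Q.Od_mono B hn hx'
  unfold ph0
  rw [if_pos ⟨_, n, h'⟩, if_pos ⟨_, n, hn⟩, Q.Od_yy B h']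

variable [Finite A] [MeasurableSpace A] [MeasurableSingletonClass A]

theorem Od_meas (b : Fin m) (n : ℕ) : MeasurableSet (Q.Od B b n) := by
  have : MeasurableSet {x | x ∈ Q.Od B b n} := by
    rw [measurableSet_setOfPred]
    apply measurable_of_dep (Finset.Icc (-(n : ℤ)) n)
    intro x x' h
    apply propext
    constructor
    · intro hx; exact Q.Od_mono B hx (fun i h1 h2 => (h i (by simp [h1, h2])).symm)
    · intro hx; exact Q.Od_mono B hx (fun i h1 h2 => (h i (by simp [h1, h2])))
  exact this

theorem ph0_meas (b0 : Fin m) : Measurable (Q.ph0 B b0) := by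
  classical
  apply measurable_to_countable'
  intro b
  have h1 : MeasurableSet (⋃ n, Q.Od B b n) := MeasurableSet.iUnion fun n => Q.Od_meas B b n
  have h2 : MeasurableSet (⋃ b, ⋃ n, Q.Od B b n) :=
    MeasurableSet.iUnion fun b => MeasurableSet.iUnion fun n => Q.Od_meas B b n
  have : Q.ph0 B b0 ⁻¹' {b} = (⋃ n, Q.Od B b n) ∪ (if b = b0 then (⋃ b, ⋃ n, Q.Od B b n)ᶜ else ∅) := by
    ext x
    simp only [mem_preimage, mem_singleton_iff, mem_union, mem_iUnion, ph0]
    constructor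
    · intro h
      by_cases hh : ∃ b n, x ∈ Q.Od B b n
      · rw [if_pos hh] at h
        obtain ⟨b', n, hn⟩ := hh
        have := Q.Od_yy B hn
        left
        refine ⟨n, ?_⟩
        rw [← h, this]; exact hn
      · rw [if_neg hh] at h
        right
        rw [if_pos h.symm]
        simp only [mem_compl_iff, mem_iUnion]
        exact hh
    · rintro (⟨n, hn⟩ | h)
      · rw [if_pos ⟨b, n, hn⟩, Q.Od_yy B hn]
      · split_ifs at h with hb
        · simp only [mem_compl_iff, mem_iUnion] at h
          rw [if_neg h, hb]
        · exact h.elim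
  rw [this]
  apply h1.union
  split_ifs
  · exact h2.compl
  · exact MeasurableSet.empty

theorem ph_meas (b0 : Fin m) : Measurable (Q.ph B b0) := by
  rw [measurable_pi_iff]
  intro z
  apply (Q.ph0_meas B b0).comp
  rw [measurable_pi_iff]
  intro j
  exact measurable_pi_apply _

/-- control from a digit shift -/
def cw (ω : ℤ → ZMod N) : ℤ → Fin (g2 + g1) → ZMod N := fun j i => ω (j + (i : ℕ))

theorem T_joint : Measurable (fun xw : (ℤ → A) × (ℤ → ZMod N) => Q.T (cw xw.2) xw.1) := by
  rw [measurable_pi_iff]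
  intro z
  have h1 : Measurable (fun v : ℤ → A × ZMod N => Q.T (cw (fun i => (v i).2)) (fun i => (v i).1) z) := by
    apply measurable_of_dep (Finset.Icc (z - 2 * Q.R - L) (z + 2 * Q.R + L))
    intro v v' h
    apply Q.T_loc
    · intro w h1 h2
      rw [h w (by simp only [Finset.mem_Icc]; omega)]
    · intro j h1 h2
      funext i
      have := i.2
      have := Q.gL
      have := Q.LR
      simp only [cw]
      rw [h _ (by simp only [Finset.mem_Icc]; omega)]
  have h2 : Measurable (fun (xw : (ℤ → A) × (ℤ → ZMod N)) (i : ℤ) => (xw.1 i, xw.2 i)) := by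
    rw [measurable_pi_iff]
    intro z
    exact ((measurable_pi_apply z).comp measurable_fst).prodMk ((measurable_pi_apply z).comp measurable_snd)
  exact h1.comp h2

theorem dig_T (x : ℤ → A) (ω : ℤ → ZMod N) :
    B.Dm (Q.InJ (Q.T (cw ω) x)) (Q.xi (Q.T (cw ω) x)) = B.Dm (Q.InJ x) (Q.xi x + ω) ∧
    Q.yy B (Q.T (cw ω) x) = B.YY (Q.InJ x) (Q.xi x + ω) 0 := by
  have hJ : Q.InJ (Q.T (cw ω) x) = Q.InJ x := by
    funext j; exact propext (Q.InJ_T _ _ _)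
  unfold yy
  rw [hJ]
  apply B.YY_dig (Q.DJ x)
  intro j hj i
  rw [Q.xi_cov ((Q.InJ_T _ _ _).2 hj), Q.wd_T _ hj, Q.dig_act x j _ hj, Pi.add_apply, Pi.add_apply, Q.xi_cov hj]
  rfl

theorem Good_T (x : ℤ → A) (ω : ℤ → ZMod N) (h : Q.Good B (Q.T (cw ω) x)) : B.AllM (Q.InJ x) (Q.xi x + ω) := by
  have hJ : Q.InJ (Q.T (cw ω) x) = Q.InJ x := by
    funext j; exact propext (Q.InJ_T _ _ _)
  have h1 := (Q.dig_T B x ω).1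
  unfold Good Tab.AllM Tab.es at h
  unfold Tab.AllM Tab.es
  rw [h1, hJ] at h
  exact h

theorem core {μ : Measure (ℤ → A)} [IsProbabilityMeasure μ]
    (hac : ∀ c, μ.map (Q.T c) ≪ μ) (hgood : ∀ᵐ x ∂μ, Q.Good B x)
    {ν : Measure (ℤ → Fin m)}
    (hν : IsProductMeasure ν (fun _ b => ((Finset.univ.filter (fun a => B.β a = b)).card : ℝ) / N)) :
    ∃ φ : (ℤ → A) → (ℤ → Fin m), Measurable φ ∧ (∀ x k z, φ (fun j => x (j + k)) z = φ x (z + k)) ∧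
      MeasEquiv (μ.map φ) ν ∧
      ∀ᵐ x ∂μ, ∃ n : ℕ, ∀ x', (∀ i : ℤ, -n ≤ i → i ≤ n → x' i = x i) → φ x' 0 = φ x 0 := by
  set b0 : Fin m := B.β 0
  set φ := Q.ph B b0 with hφ
  have hφm : Measurable φ := Q.ph_meas B b0
  refine ⟨φ, hφm, ?_, ?_, ?_⟩
  · intro x k z
    simp only [hφ, ph]
    congr 1
    funext j
    congr 1
    ring
  swap
  · filter_upwards [hgood] with x hx
    exact Q.ph_loc B b0 hx
  obtain ⟨H, hH⟩ := exists_unif (G := ZMod N)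
  have := hH.prob
  have hTj := Q.T_joint
  -- null set
  obtain ⟨Nn, hNn, hNm, hN0⟩ := exists_measurable_superset_of_null (ae_iff.1 hgood)
  have hprod0 : ∀ F : Set (ℤ → A), MeasurableSet F → μ F = 0 →
      (μ.prod H) ((fun xw : (ℤ → A) × (ℤ → ZMod N) => Q.T (cw xw.2) xw.1) ⁻¹' F) = 0 := by
    intro F hF h0
    rw [Measure.prod_apply_symm (hTj hF)]
    apply lintegral_eq_zero_of_ae_eq_zero
    apply ae_of_all
    intro ω
    have := hac (cw ω) h0
    rw [Measure.map_apply (Q.T_measurable _) hF] at this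
    exact this
  have hne : Nonempty (Fin m) := ⟨b0⟩
  have key : ∀ E : Set (ℤ → Fin m), MeasurableSet E →
      ∀ᵐ x ∂μ, H {ω | φ (Q.T (cw ω) x) ∈ E} = ν E := by
    intro E hE
    have h1 := (Measure.measure_prod_null (hTj hNm)).1 (hprod0 Nn hNm hN0)
    filter_upwards [h1] with x hx
    have hg : ∀ᵐ ω ∂H, Q.Good B (Q.T (cw ω) x) := by
      rw [ae_iff]
      refine measure_mono_null ?_ hx
      intro ω hω
      exact hNn hω
    have hall : ∀ᵐ ω ∂H, B.AllM (Q.InJ x) (Q.xi x + ω) := hg.mono fun ω h => Q.Good_T B x ω h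
    have htr := unif_translate hH (Q.xi x)
    have hall2 : ∀ᵐ η ∂H, B.AllM (Q.InJ x) η := by
      have hmeas : MeasurableSet {η | B.AllM (Q.InJ x) η} := by
        have : {η | B.AllM (Q.InJ x) η} = ⋂ z, ({η | B.Dm (Q.InJ x) η z}ᶜ ∪ ⋃ n, {η | SS (B.es (Q.InJ x) η) z n ≤ 0}) := by
          ext η
          simp only [Tab.AllM, mem_ofPred_eq, mem_iInter, mem_union, mem_compl_iff, mem_iUnion]
          exact forall_congr' fun z => imp_iff_not_or
        rw [this]
        exact MeasurableSet.iInter fun z => (B.Dm_meas _ z).compl.union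
          (MeasurableSet.iUnion fun n => B.SS_meas _ z n)
      have hm : Measurable (fun ω : ℤ → ZMod N => Q.xi x + ω) := by
        rw [measurable_pi_iff]
        intro z
        exact (measurable_of_countable (fun a : ZMod N => Q.xi x z + a)).comp (measurable_pi_apply z)
      rw [← htr, ae_map_iff hm.aemeasurable hmeas]
      exact hall
    have hYm : Measurable (fun η => B.YY (Q.InJ x) η 0) :=
      (B.YY_meas _).comp (measurable_id.prodMk measurable_const)
    have hlaw := B.law hH (Q.DJ x) hall2
    have hνe := prod_unique hlaw hν hne
    rw [← hνe, Measure.map_apply hYm hE]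
    conv_rhs => rw [← htr]
    have hm : Measurable (fun ω : ℤ → ZMod N => Q.xi x + ω) := by
      rw [measurable_pi_iff]
      intro z
      exact (measurable_of_countable (fun a : ZMod N => Q.xi x z + a)).comp (measurable_pi_apply z)
    rw [Measure.map_apply hm (hYm hE)]
    apply measure_congr
    filter_upwards [hg] with ω hω
    have : φ (Q.T (cw ω) x) = B.YY (Q.InJ x) (Q.xi x + ω) 0 := by
      rw [hφ, Q.ph_good B b0 hω, (Q.dig_T B x ω).2]
    apply propext
    show φ (Q.T (cw ω) x) ∈ E ↔ B.YY (Q.InJ x) (Q.xi x + ω) 0 ∈ E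
    rw [this]
  constructor
  · -- ν E = 0 → μ (φ⁻¹ E) = 0
    refine Measure.AbsolutelyContinuous.mk fun E hE h0 => ?_
    rw [Measure.map_apply hφm hE]
    have h1 : (μ.prod H) ((fun xw : (ℤ → A) × (ℤ → ZMod N) => Q.T (cw xw.2) xw.1) ⁻¹' (φ ⁻¹' E)) = 0 := by
      rw [Measure.measure_prod_null (hTj (hφm hE))]
      filter_upwards [key E hE] with x hx
      rw [h0] at hx
      exact hx
    rw [Measure.prod_apply_symm (hTj (hφm hE)), lintegral_eq_zero_iff
      (measurable_measure_prodMk_right (hTj (hφm hE)))] at h1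
    obtain ⟨ω, hω⟩ := h1.exists
    have h2 := hac (-cw ω) hω
    have hms : MeasurableSet ((fun x => (x, ω)) ⁻¹' ((fun xw : (ℤ → A) × (ℤ → ZMod N) => Q.T (cw xw.2) xw.1) ⁻¹' (φ ⁻¹' E))) :=
      (measurable_id.prodMk measurable_const) (hTj (hφm hE))
    rw [Measure.map_apply (Q.T_measurable _) hms] at h2
    refine measure_mono_null ?_ h2
    intro x hx
    simp only [mem_preimage, Q.T_neg']
    exact hx
  · refine Measure.AbsolutelyContinuous.mk fun E hE h0 => ?_
    rw [Measure.map_apply hφm hE] at h0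
    have h1 := (Measure.measure_prod_null (hTj (hφm hE))).1 (hprod0 _ (hφm hE) h0)
    obtain ⟨x, hx1, hx2⟩ := (h1.and (key E hE)).exists
    rw [← hx2]
    exact hx1

end Sys
end NOF

open MeasureTheory Filter Set Topology ENNReal
set_option linter.unusedSectionVars false
set_option linter.unusedVariables false
set_option linter.unusedSimpArgs false

namespace NOF

section cheb
open ProbabilityTheory
variable {Ω : Type*} [MeasurableSpace Ω] {μ : Measure Ω} [IsProbabilityMeasure μ]

theorem memLp_bdd {X : Ω → ℝ} {M : ℝ} (hm : Measurable X) (hb : ∀ x, |X x| ≤ M) : MemLp X 2 μ :=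
  MemLp.of_bound hm.aestronglyMeasurable M (ae_of_all _ hb)

theorem int_bdd {X : Ω → ℝ} {M : ℝ} (hb : ∀ x, |X x| ≤ M) : |∫ x, X x ∂μ| ≤ M := by
  have := norm_integral_le_of_norm_le_const (μ := μ) (f := X) (C := M) (ae_of_all _ hb)
  simpa using this

theorem cov_bdd {X Y : Ω → ℝ} {M : ℝ} (hX : ∀ x, |X x| ≤ M) (hY : ∀ x, |Y x| ≤ M) :
    cov[X, Y; μ] ≤ 4 * M ^ 2 := by
  have h1 := int_bdd (μ := μ) hX
  have h2 := int_bdd (μ := μ) hY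
  have := int_bdd (μ := μ) (X := fun x => (X x - ∫ x, X x ∂μ) * (Y x - ∫ x, Y x ∂μ)) (M := 4 * M ^ 2) (by
    intro x
    rw [abs_mul]
    have h3 : |X x - ∫ x, X x ∂μ| ≤ 2 * M := by
      have := abs_sub (X x) (∫ x, X x ∂μ)
      have := hX x
      linarith
    have h4 : |Y x - ∫ x, Y x ∂μ| ≤ 2 * M := by
      have := abs_sub (Y x) (∫ x, Y x ∂μ)
      have := hY x
      linarith
    have := mul_le_mul h3 h4 (abs_nonneg _) ((abs_nonneg _).trans h3)
    linarith)
  exact (le_abs_self _).trans this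

theorem var_sum_le {X : ℕ → Ω → ℝ} {M : ℝ} (hm : ∀ k, Measurable (X k)) (hb : ∀ k x, |X k x| ≤ M) (D : ℕ)
    (hc : ∀ k l, k + D < l → IndepFun (X k) (X l) μ) (n : ℕ) :
    Var[fun x => ∑ k ∈ Finset.range n, X k x; μ] ≤ n * ((2 * D + 1) * (4 * M ^ 2)) := by
  have hL : ∀ k, MemLp (X k) 2 μ := fun k => memLp_bdd (hm k) (hb k)
  have h0 : ∀ k l, k + D < l → cov[X k, X l; μ] = 0 := fun k l h => (hc k l h).covariance_eq_zero (hL k) (hL l)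
  rw [variance_fun_sum' (fun i _ => hL i)]
  have : ∀ k ∈ Finset.range n, ∑ l ∈ Finset.range n, cov[X k, X l; μ] ≤ (2 * D + 1) * (4 * M ^ 2) := by
    intro k _
    have hz : ∀ l, l ∉ Finset.Icc (k - D) (k + D) → cov[X k, X l; μ] = 0 := by
      intro l hl
      simp only [Finset.mem_Icc] at hl
      rcases lt_or_ge (k + D) l with h | h
      · exact h0 _ _ h
      · rw [covariance_comm]; exact h0 _ _ (by omega)
    calc ∑ l ∈ Finset.range n, cov[X k, X l; μ]
        = ∑ l ∈ Finset.range n with l ∈ Finset.Icc (k - D) (k + D), cov[X k, X l; μ] := by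
          symm
          apply Finset.sum_filter_of_ne
          intro l _ h
          by_contra hh
          exact h (hz l hh)
      _ ≤ ∑ l ∈ Finset.range n with l ∈ Finset.Icc (k - D) (k + D), 4 * M ^ 2 :=
          Finset.sum_le_sum fun l _ => cov_bdd (hb k) (hb l)
      _ ≤ (2 * D + 1) * (4 * M ^ 2) := by
          rw [Finset.sum_const, nsmul_eq_mul]
          apply mul_le_mul_of_nonneg_right _ (by positivity)
          have : ((Finset.range n).filter (fun l => l ∈ Finset.Icc (k - D) (k + D))).card ≤ 2 * D + 1 := by
            refine (Finset.card_le_card (t := Finset.Icc (k - D) (k + D)) ?_).trans ?_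
            · intro l hl; exact (Finset.mem_filter.1 hl).2
            · rw [Nat.card_Icc]; omega
          exact_mod_cast this
  calc _ ≤ ∑ k ∈ Finset.range n, (2 * D + 1) * (4 * M ^ 2) := Finset.sum_le_sum this
    _ = _ := by rw [Finset.sum_const, Finset.card_range, nsmul_eq_mul]

/-- Chebyshev for finite range dependent bounded variables -/
theorem cheb {X : ℕ → Ω → ℝ} {M : ℝ} (hm : ∀ k, Measurable (X k)) (hb : ∀ k x, |X k x| ≤ M) (D : ℕ)
    (hc : ∀ k l, k + D < l → IndepFun (X k) (X l) μ) (n : ℕ) {c : ℝ} (hcp : 0 < c) :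
    μ.real {x | c ≤ |∑ k ∈ Finset.range n, X k x - ∑ k ∈ Finset.range n, ∫ x, X k x ∂μ|} ≤
      n * ((2 * D + 1) * (4 * M ^ 2)) / c ^ 2 := by
  have hL : ∀ k, MemLp (X k) 2 μ := fun k => memLp_bdd (hm k) (hb k)
  have hS : MemLp (fun x => ∑ k ∈ Finset.range n, X k x) 2 μ := memLp_finsetSum _ fun k _ => hL k
  have h1 := meas_ge_le_variance_div_sq hS hcp
  have h2 : ∫ x, ∑ k ∈ Finset.range n, X k x ∂μ = ∑ k ∈ Finset.range n, ∫ x, X k x ∂μ :=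
    integral_finsetSum _ fun k _ => (hL k).integrable (by norm_num)
  rw [h2] at h1
  have h3 := var_sum_le (μ := μ) hm hb D hc n
  unfold Measure.real
  apply ENNReal.toReal_le_of_le_ofReal (by positivity)
  refine h1.trans (ENNReal.ofReal_le_ofReal ?_)
  gcongr

end cheb

variable {A : Type*} [Finite A] [MeasurableSpace A] [MeasurableSingletonClass A]

theorem IsProbVecC.le_one {p : A → ℝ} (h : IsProbVecC p) (a : A) : p a ≤ 1 := by
  have := h.2.summable.le_tsum a (fun b _ => h.1 b)
  rwa [h.2.tsum_eq] at this

/-- expectations of local functions converge -/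
theorem int_dep [Fintype A] {μ : Measure (ℤ → A)} [IsProbabilityMeasure μ] {ρ : ℤ → A → ℝ} (hμ : IsProductMeasure μ ρ)
    (h0 : ∀ i a, 0 ≤ ρ i a) (s : Finset ℤ) (y0 : ℤ → A) (f : (ℤ → A) → ℝ)
    (hf : ∀ x x', (∀ i ∈ s, x i = x' i) → f x = f x') :
    ∫ x, f x ∂μ = ∑ w : s → A, (∏ i : s, ρ i (w i)) * f (fun i => if h : i ∈ s then w ⟨i, h⟩ else y0 i) := by
  classical
  set ex : (s → A) → ℤ → A := fun w i => if h : i ∈ s then w ⟨i, h⟩ else y0 i with hex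
  have hr : Measurable (fun x : ℤ → A => (fun i : s => x i)) := by
    rw [measurable_pi_iff]; intro i; exact measurable_pi_apply _
  have h1 : ∀ x, f x = (f ∘ ex) (fun i : s => x i) := by
    intro x
    apply hf
    intro i hi
    simp [hex, hi]
  have : ∫ x, f x ∂μ = ∫ w, (f ∘ ex) w ∂(μ.map (fun x : ℤ → A => (fun i : s => x i))) := by
    rw [integral_map hr.aemeasurable (by exact (measurable_of_countable _).aestronglyMeasurable)]
    simp_rw [← h1]
  have := Measure.isProbabilityMeasure_map (μ := μ) hr.aemeasurable
  rw [‹∫ x, f x ∂μ = _›, integral_fintype (Integrable.of_finite)]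
  apply Finset.sum_congr rfl
  intro w _
  rw [smul_eq_mul, Measure.real, Measure.map_apply hr (measurableSet_singleton _)]
  have e : (fun x : ℤ → A => (fun i : s => x i)) ⁻¹' {w} = _root_.cylinder s (ex w) := by
    ext x
    simp only [mem_preimage, mem_singleton_iff, _root_.cylinder, mem_ofPred_eq, funext_iff, Subtype.forall]
    apply forall₂_congr
    intro i hi
    simp [hex, hi]
  rw [e, hμ, ENNReal.toReal_prod, ← Finset.prod_attach]
  congr 1
  apply Finset.prod_congr rfl
  intro i _
  rw [ENNReal.toReal_ofReal (h0 _ _)]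
  simp [hex]

/-- the shifted measure -/
theorem shift_prod {μ : Measure (ℤ → A)} {ρ : ℤ → A → ℝ} (hμ : IsProductMeasure μ ρ) (k : ℤ) :
    IsProductMeasure (μ.map (fun x j => x (j + k))) (fun i => ρ (i + k)) := by
  intro s y
  have hm : Measurable (fun (x : ℤ → A) (j : ℤ) => x (j + k)) := by
    rw [measurable_pi_iff]; intro i; exact measurable_pi_apply _
  rw [Measure.map_apply hm (measurableSet_cyl _ _)]
  have : (fun (x : ℤ → A) (j : ℤ) => x (j + k)) ⁻¹' _root_.cylinder s y
      = _root_.cylinder (s.map (addRightEmbedding k)) (fun i => y (i - k)) := by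
    ext x
    simp [_root_.cylinder]
  rw [this, hμ]
  simp

theorem lln {μ P : Measure (ℤ → A)} [IsProbabilityMeasure μ] [IsProbabilityMeasure P] {ρ : ℤ → A → ℝ} {p : A → ℝ}
    (hμ : IsProductMeasure μ ρ) (hP : IsProductMeasure P (fun _ => p)) (hρ : ∀ i, IsProbVecC (ρ i))
    (hp : IsProbVecC p) (hlim : ∀ a, Tendsto (fun i : ℤ => ρ i a) atTop (𝓝 (p a)))
    (f : (ℤ → A) → ℝ) {M : ℝ} (hb : ∀ x, |f x| ≤ M) (R : ℕ)
    (hf : ∀ x x' : ℤ → A, (∀ i : ℤ, -R ≤ i → i ≤ R → x i = x' i) → f x = f x')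
    (hneg : ∫ x, f x ∂P < 0) :
    ∀ᵐ x ∂μ, ∀ z : ℤ, ∃ n : ℕ, ∑ k ∈ Finset.range (n + 1), f (fun j => x (j + (z + k))) ≤ 0 := by
  classical
  have := Fintype.ofFinite A
  rw [ae_all_iff]
  intro z
  have hneA : Nonempty A := by
    by_contra hh
    rw [not_nonempty_iff] at hh
    have := hp.2.unique (hasSum_empty)
    norm_num at this
  obtain ⟨a0⟩ := hneA
  set y0 : ℤ → A := fun _ => a0
  set X : ℕ → (ℤ → A) → ℝ := fun k x => f (fun j => x (j + (z + k))) with hX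
  have hdep : ∀ (k : ℕ) (x x' : ℤ → A), (∀ i ∈ Finset.Icc (z + k - R) (z + k + R), x i = x' i) → X k x = X k x' := by
    intro k x x' h
    apply hf
    intro i h1 h2
    apply h
    simp only [Finset.mem_Icc]
    omega
  have hm : ∀ k, Measurable (X k) := fun k => measurable_of_dep _ _ (hdep k)
  have hXb : ∀ k x, |X k x| ≤ M := fun k x => hb _
  have hind : ∀ k l, k + 2 * R < l → ProbabilityTheory.IndepFun (X k) (X l) μ := by
    intro k l h
    refine indep_dep hμ hρ ⟨a0⟩ _ _ ?_ _ _ (hdep k) (hdep l)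
    rw [Finset.disjoint_left]
    intro i h1 h2
    simp only [Finset.mem_Icc] at h1 h2
    omega
  set s : Finset ℤ := Finset.Icc (-R : ℤ) R
  have hfs : ∀ x x' : ℤ → A, (∀ i ∈ s, x i = x' i) → f x = f x' := by
    intro x x' h
    apply hf
    intro i h1 h2
    exact h i (by simp [s, h1, h2])
  have hE : Tendsto (fun k : ℕ => ∫ x, X k x ∂μ) atTop (𝓝 (∫ x, f x ∂P)) := by
    rw [int_dep hP (fun _ => hp.1) s y0 f hfs]
    have h1 : ∀ k : ℕ, ∫ x, X k x ∂μ = ∑ w : s → A, (∏ i : s, ρ (i + (z + k)) (w i)) * f (fun i => if h : i ∈ s then w ⟨i, h⟩ else y0 i) := by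
      intro k
      have hsm : Measurable (fun (x : ℤ → A) (j : ℤ) => x (j + (z + k))) := by
        rw [measurable_pi_iff]; intro i; exact measurable_pi_apply _
      have := Measure.isProbabilityMeasure_map (μ := μ) hsm.aemeasurable
      rw [← int_dep (shift_prod hμ (z + k)) (fun i => (hρ _).1) s y0 f hfs,
        integral_map hsm.aemeasurable (measurable_of_dep s f hfs).aestronglyMeasurable]
    simp_rw [h1]
    apply tendsto_finsetSum
    intro w _
    apply Filter.Tendsto.mul_const
    apply tendsto_finsetProd
    intro i _
    apply (hlim (w i)).comp
    have : Tendsto (fun k : ℕ => (k : ℤ)) atTop atTop := tendsto_natCast_atTop_atTop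
    have h2 := tendsto_atTop_add_const_left atTop ((i : ℤ) + z) this
    simpa [add_assoc] using h2
  set c := -(∫ x, f x ∂P) / 2 with hc
  have hcp : 0 < c := by rw [hc]; linarith
  obtain ⟨K, hK⟩ := eventually_atTop.1 (hE.eventually (gt_mem_nhds (show ∫ x, f x ∂P < -c by rw [hc]; linarith)))
  have hM : 0 ≤ M := (abs_nonneg _).trans (hb y0)
  have hES : ∀ n ≥ K, ∑ k ∈ Finset.range n, ∫ x, X k x ∂μ ≤ -c * n + K * (M + c) := by
    intro n hn
    induction n, hn using Nat.le_induction with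
    | base =>
      calc _ ≤ ∑ k ∈ Finset.range K, M := Finset.sum_le_sum fun k _ => (le_abs_self _).trans (int_bdd (hXb k))
        _ = K * M := by simp
        _ ≤ _ := by nlinarith
    | succ n hn ih =>
      rw [Finset.sum_range_succ]
      have := hK n hn
      push_cast
      linarith
  -- the bad set
  rw [ae_iff]
  set Bd := {x : ℤ → A | ¬ ∃ n : ℕ, ∑ k ∈ Finset.range (n + 1), f (fun j => x (j + (z + k))) ≤ 0}
  have hbd : ∀ᶠ n : ℕ in atTop, μ.real Bd ≤ n * ((2 * (2 * R : ℕ) + 1) * (4 * M ^ 2)) / (c / 2 * n) ^ 2 := by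
    obtain ⟨K2, hK2⟩ := exists_nat_gt (2 * (K * (M + c)) / c)
    filter_upwards [eventually_ge_atTop (max (K + 1) (K2 + 1))] with n hn
    have hn1 : K ≤ n := by omega
    have hn2 : K2 ≤ n := by omega
    have hn0 : 0 < n := by omega
    have hn0' : (0 : ℝ) < n := by exact_mod_cast hn0
    refine le_trans ?_ (cheb hm hXb (2 * R) hind n (c := c / 2 * n) (by positivity))
    refine measureReal_mono ?_ (measure_ne_top _ _)
    intro x hx
    have hx' : 0 < ∑ k ∈ Finset.range n, X k x := by
      obtain ⟨n', rfl⟩ : ∃ n', n = n' + 1 := ⟨n - 1, by omega⟩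
      by_contra hcon
      exact hx ⟨n', not_lt.1 hcon⟩
    have h1 := hES n hn1
    have h2 : 2 * (K * (M + c)) < c * n := by
      have : 2 * (K * (M + c)) / c < n := hK2.trans_le (by exact_mod_cast hn2)
      rw [div_lt_iff₀ hcp] at this
      linarith
    show c / 2 * n ≤ _
    refine le_trans ?_ (le_abs_self _)
    linarith
  have hz : Tendsto (fun n : ℕ => n * ((2 * (2 * R : ℕ) + 1) * (4 * M ^ 2)) / (c / 2 * n) ^ 2) atTop (𝓝 0) := by
    have h1 : Tendsto (fun n : ℕ => ((2 * (2 * R : ℕ) + 1) * (4 * M ^ 2)) / (c / 2) ^ 2 * (n : ℝ)⁻¹) atTop (𝓝 0) := by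
      have := (tendsto_inv_atTop_nhds_zero_nat (𝕜 := ℝ)).const_mul (((2 * (2 * R : ℕ) + 1) * (4 * M ^ 2)) / (c / 2) ^ 2)
      simpa using this
    refine h1.congr' ?_
    filter_upwards [eventually_gt_atTop 0] with n hn
    have : (0 : ℝ) < n := by exact_mod_cast hn
    field_simp
  have hle : μ.real Bd ≤ 0 := ge_of_tendsto hz hbd
  have := le_antisymm hle measureReal_nonneg
  rwa [measureReal_eq_zero_iff] at this

end NOF

open MeasureTheory Filter Set Topology ENNReal
set_option linter.unusedSectionVars false
set_option linter.unusedVariables false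
set_option linter.unusedSimpArgs false

namespace NOF
namespace Sys

variable {A : Type*} [Finite A] [MeasurableSpace A] [MeasurableSingletonClass A]

section
variable {L g N : ℕ} (Q : Sys A L g N)

theorem InJ_meas (j : ℤ) : MeasurableSet {x | Q.InJ x j} := by
  rw [measurableSet_setOfPred]
  apply measurable_of_dep (Finset.Icc (j - Q.R) (j + Q.R))
  intro x x' h
  apply propext
  apply Q.loc
  intro z h1 h2
  exact h z (by simp [h1, h2])

theorem rr_iid [NeZero N] {p : A → ℝ} (hp : ∀ a, 0 < p a) (j : ℤ) (d : Fin g → ZMod N) (x : ℤ → A) :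
    Q.rr (fun _ => p) j d x = 1 := by
  unfold rr
  split_ifs with h
  · obtain ⟨σ, hσ⟩ := Q.perm (-d) (wd L x j)
    rw [Finset.prod_div_distrib, hσ]
    have : ∏ i : Fin L, p ((wd L x j ∘ σ) i) = ∏ i, p (wd L x j i) :=
      Equiv.prod_comp σ (fun i => p (wd L x j i))
    rw [this]
    exact div_self (Finset.prod_ne_zero_iff.2 fun i _ => (hp _).ne')
  · rfl

theorem map_iid [NeZero N] {P : Measure (ℤ → A)} [IsProbabilityMeasure P] {p : A → ℝ} (hp : ∀ a, 0 < p a)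
    (hP : IsProductMeasure P (fun _ => p)) (j : ℤ) (d : Fin g → ZMod N) :
    P.map (Q.T (Pi.single j d)) = P := by
  rw [Q.map_single hP (fun _ => hp) j d (M := 1) (fun x => (Q.rr_iid hp j d x).le)]
  simp [Q.rr_iid hp]

/-- digits are uniform under the iid measure -/
theorem dig_unif [NeZero N] {P : Measure (ℤ → A)} [IsProbabilityMeasure P] {p : A → ℝ} (hp : ∀ a, 0 < p a)
    (hP : IsProductMeasure P (fun _ => p)) (F : Finset (Fin g → ZMod N)) :
    P.real {x | Q.InJ x 0 ∧ Q.dig (wd L x 0) ∈ F} * (N : ℝ) ^ g = F.card * P.real {x | Q.InJ x 0} := by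
  classical
  have hm : Measurable (fun x : ℤ → A => Q.dig (wd L x 0)) := by
    apply measurable_of_dep (Finset.Icc 0 L)
    intro x x' h
    have : wd L x 0 = wd L x' 0 := by
      funext i
      have := i.2
      exact h _ (by simp only [Finset.mem_Icc]; omega)
    rw [this]
  set lam : Measure (Fin g → ZMod N) := (P.restrict {x | Q.InJ x 0}).map (fun x => Q.dig (wd L x 0)) with hlam
  have hfin : IsFiniteMeasure lam := by
    rw [hlam]; infer_instance
  have hval : ∀ G : Set (Fin g → ZMod N), lam.real G = P.real {x | Q.InJ x 0 ∧ Q.dig (wd L x 0) ∈ G} := by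
    intro G
    have hG : MeasurableSet G := G.toFinite.measurableSet
    rw [Measure.real, hlam, Measure.map_apply hm hG, Measure.restrict_apply (hm hG), Measure.real]
    congr 2
    ext x
    simp [and_comm]
  have heq : ∀ d, lam.real {d} = lam.real {0} := by
    intro d
    rw [hval, hval]
    have h1 := Q.map_iid hp hP 0 d
    have hms : MeasurableSet {x | Q.InJ x 0 ∧ Q.dig (wd L x 0) ∈ ({d} : Set (Fin g → ZMod N))} :=
      (Q.InJ_meas 0).inter (hm (Set.toFinite _).measurableSet)
    conv_lhs => rw [← h1, Measure.real, Measure.map_apply (Q.T_measurable _) hms]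
    rw [Measure.real]
    congr 2
    ext x
    simp only [mem_preimage, mem_ofPred_eq, mem_singleton_iff, Q.InJ_T]
    apply and_congr_right
    intro hx
    rw [Q.wd_T _ hx, Q.dig_act x 0 _ hx, Pi.single_eq_same]
    simp
  have hs : ∀ G : Finset (Fin g → ZMod N), lam.real G = G.card * lam.real {0} := by
    intro G
    rw [← sum_measureReal_singleton]
    simp only [heq, Finset.sum_const, nsmul_eq_mul]
  have e1 := hs F
  have e2 := hs Finset.univ
  rw [hval] at e1 e2
  have e3 : {x | Q.InJ x 0 ∧ Q.dig (wd L x 0) ∈ (↑(Finset.univ : Finset (Fin g → ZMod N)) : Set (Fin g → ZMod N))} = {x | Q.InJ x 0} := by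
    ext x; simp
  rw [e3] at e2
  have e4 : ((Finset.univ : Finset (Fin g → ZMod N)).card : ℝ) = (N : ℝ) ^ g := by
    rw [Finset.card_univ, Fintype.card_fun, ZMod.card, Fintype.card_fin]; push_cast; rfl
  rw [e4] at e2
  have e1' : P.real {x | Q.InJ x 0 ∧ Q.dig (wd L x 0) ∈ F} = F.card * lam.real {0} := e1
  rw [e1', e2]
  ring
end

variable {L g1 g2 N m : ℕ} [NeZero N] (Q : Sys A L (g2 + g1) N) (B : Tab L g1 g2 N m)

theorem tail_card (F : Finset (Fin g1 → ZMod N)) :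
    (Finset.univ.filter (fun a : Fin (g2 + g1) → ZMod N => (fun k : Fin g1 => a ⟨g2 + k, by omega⟩) ∈ F)).card
      = N ^ g2 * F.card := by
  classical
  have : (Finset.univ.filter (fun a : Fin (g2 + g1) → ZMod N => (fun k : Fin g1 => a ⟨g2 + k, by omega⟩) ∈ F))
      = ((Finset.univ : Finset (Fin g2 → ZMod N)) ×ˢ F).map (Fin.appendEquiv g2 g1).toEmbedding := by
    ext a
    simp only [Finset.mem_filter, Finset.mem_univ, true_and, Finset.mem_map, Finset.mem_product, Equiv.coe_toEmbedding]
    constructor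
    · intro h
      refine ⟨(Fin.appendEquiv g2 g1).symm a, ?_, Equiv.apply_symm_apply _ _⟩
      exact h
    · rintro ⟨⟨u, v⟩, h, rfl⟩
      convert h using 1
      funext k
      show Fin.append u v (Fin.natAdd g2 k) = v k
      simp
  rw [this, Finset.card_map, Finset.card_product, Finset.card_univ, Fintype.card_fun, ZMod.card, Fintype.card_fin]

open Classical in
theorem good_ae {μ P : Measure (ℤ → A)} [IsProbabilityMeasure μ] [IsProbabilityMeasure P] {ρ : ℤ → A → ℝ} {p : A → ℝ}
    (hμ : IsProductMeasure μ ρ) (hP : IsProductMeasure P (fun _ => p)) (hρ : ∀ i, IsProbVecC (ρ i))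
    (hp : IsProbVecC p) (hp0 : ∀ a, 0 < p a) (hlim : ∀ a, Tendsto (fun i : ℤ => ρ i a) atTop (𝓝 (p a)))
    {η : ℝ} (hη : ((Finset.univ.filter B.Fl).card : ℝ) ≤ η * (N : ℝ) ^ g1)
    (hden : 1 + (L * η) * P.real {x | Q.InJ x 0} < (L + g2) * P.real {x | Q.InJ x 0}) :
    ∀ᵐ x ∂μ, Q.Good B x := by
  set f : (ℤ → A) → ℝ := fun x => (B.es (Q.InJ x) (Q.xi x) 0 : ℝ) with hf
  have hfs : ∀ x z, f (fun j => x (j + z)) = (B.es (Q.InJ x) (Q.xi x) z : ℝ) := by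
    intro x z
    have h1 : Q.InJ (fun j => x (j + z)) = fun j => Q.InJ x (j + z) := by
      funext j; exact propext (Q.equi x j z)
    have h2 : Q.xi (fun j => x (j + z)) = fun j => Q.xi x (j + z) := by
      funext j; exact Q.xi_shift x z j
    simp only [hf]
    rw [h1, h2, B.es_shift, zero_add]
  have hb : ∀ x, |f x| ≤ 1 := by
    intro x
    simp only [hf, Tab.es, ee]
    split_ifs <;> norm_num
  have hgL := Q.gL
  have hloc : ∀ x x' : ℤ → A, (∀ i : ℤ, -((L + 2 * Q.R : ℕ) : ℤ) ≤ i → i ≤ (L + 2 * Q.R : ℕ) → x i = x' i) → f x = f x' := by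
    intro x x' h
    push_cast at h
    have hJ : ∀ z : ℤ, -(L : ℤ) ≤ z → z ≤ L → (Q.InJ x z ↔ Q.InJ x' z) := by
      intro z h1 h2
      apply Q.loc
      intro w h3 h4
      apply h <;> omega
    have hX : ∀ z : ℤ, -(L : ℤ) ≤ z → z ≤ L → Q.xi x z = Q.xi x' z := by
      intro z h1 h2
      apply Q.xi_loc
      intro w h3 h4
      apply h <;> omega
    have hD : B.Dm (Q.InJ x) (Q.xi x) 0 ↔ B.Dm (Q.InJ x') (Q.xi x') 0 := by
      unfold Tab.Dm
      apply forall_congr'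
      intro i
      have := i.2
      have hV : B.Vv (Q.xi x) (0 - (i : ℕ)) = B.Vv (Q.xi x') (0 - (i : ℕ)) := by
        funext l
        have := l.2
        exact hX _ (by push_cast; omega) (by push_cast; omega)
      rw [hJ _ (by omega) (by omega), hV]
    have hU : B.Us (Q.InJ x) 0 ↔ B.Us (Q.InJ x') 0 := by
      unfold Tab.Us
      apply exists_congr
      intro i
      have := i.2
      exact hJ _ (by omega) (by omega)
    simp only [hf, Tab.es, ee, hD, hU]
  have hfm : Measurable f := measurable_of_dep (Finset.Icc (-((L + 2 * Q.R : ℕ) : ℤ)) (L + 2 * Q.R : ℕ)) f (by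
    intro x x' h
    apply hloc
    intro i h1 h2
    exact h i (by simp only [Finset.mem_Icc]; exact ⟨h1, h2⟩))
  set π := P.real {x | Q.InJ x 0} with hπ
  -- score mean
  set FF : Finset (Fin (g2 + g1) → ZMod N) := Finset.univ.filter (fun a : Fin (g2 + g1) → ZMod N =>
    (fun k : Fin g1 => a ⟨g2 + k, by omega⟩) ∈ Finset.univ.filter B.Fl) with hFF
  set Hs : ℤ → Set (ℤ → A) := fun z => {x | Q.InJ x z} with hHs
  set Ks : ℤ → Set (ℤ → A) := fun z => {x | Q.InJ x z ∧ Q.dig (wd L x z) ∈ FF} with hKs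
  have hFl : ∀ x z, Q.InJ x z → (B.Fl (B.Vv (Q.xi x) z) ↔ Q.dig (wd L x z) ∈ FF) := by
    intro x z hz
    simp only [hFF, Finset.mem_filter, Finset.mem_univ, true_and]
    have : B.Vv (Q.xi x) z = fun k : Fin g1 => Q.dig (wd L x z) ⟨g2 + k, by omega⟩ := by
      funext k
      rw [← Q.xi_cov hz]
      rfl
    rw [this]
  have hHm : ∀ z, MeasurableSet (Hs z) := fun z => Q.InJ_meas z
  have hKm : ∀ z, MeasurableSet (Ks z) := by
    intro z
    have hh : MeasurableSet {x | Q.dig (wd L x z) ∈ FF} := ?_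
    · exact (Q.InJ_meas z).inter hh
    rw [measurableSet_setOfPred]
    apply measurable_of_dep (Finset.Icc z (z + L))
    intro x x' h
    have : wd L x z = wd L x' z := by
      funext i
      have := i.2
      exact h _ (by simp only [Finset.mem_Icc]; omega)
    rw [this]
  have hshm : ∀ k : ℤ, Measurable (fun (x : ℤ → A) (j : ℤ) => x (j + k)) := by
    intro k; rw [measurable_pi_iff]; intro i; exact measurable_pi_apply _
  have hneA : Nonempty A := by
    by_contra hh
    rw [not_nonempty_iff] at hh
    have := hp.2.unique (hasSum_empty)
    norm_num at this
  have hinv : ∀ k : ℤ, P.map (fun (x : ℤ → A) (j : ℤ) => x (j + k)) = P := fun k =>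
    prod_unique (shift_prod hP k) hP hneA
  have hHz : ∀ z, P.real (Hs z) = π := by
    intro z
    rw [hπ, Measure.real, Measure.real]
    conv_rhs => rw [← hinv z, Measure.map_apply (hshm z) (Q.InJ_meas 0)]
    congr 2
    ext x
    simp only [hHs, mem_preimage, mem_ofPred_eq, Q.equi, zero_add]
  have hKz : ∀ z, P.real (Ks z) = P.real (Ks 0) := by
    intro z
    rw [Measure.real, Measure.real]
    conv_rhs => rw [← hinv z, Measure.map_apply (hshm z) (hKm 0)]
    congr 2
    ext x
    have : wd L (fun j => x (j + z)) 0 = wd L x z := by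
      funext i; simp only [wd]; congr 1; ring
    simp only [hKs, mem_preimage, mem_ofPred_eq, Q.equi, zero_add, this]
  have hN : (0 : ℝ) < N := by exact_mod_cast Nat.pos_of_ne_zero (NeZero.ne N)
  have hK0 : P.real (Ks 0) ≤ η * π := by
    have h1 := Q.dig_unif hp0 hP FF
    rw [hFF, tail_card, ← hFF] at h1
    have h2 : P.real (Ks 0) * (N : ℝ) ^ (g2 + g1) = (N ^ g2 * (Finset.univ.filter B.Fl).card : ℕ) * π := h1
    push_cast at h2
    have hπ0 : 0 ≤ π := measureReal_nonneg
    have h3 : P.real (Ks 0) * (N : ℝ) ^ (g2 + g1) ≤ (η * π) * (N : ℝ) ^ (g2 + g1) := by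
      rw [h2, pow_add]
      have := mul_le_mul_of_nonneg_right hη hπ0
      have := mul_le_mul_of_nonneg_left this (pow_pos hN g2).le
      linarith
    exact le_of_mul_le_mul_right h3 (by positivity)
  have hpt : ∀ x, f x ≤ 1 - ∑ i : Fin L, (Hs (0 - (i : ℕ))).indicator 1 x + ∑ i : Fin L, (Ks (0 - (i : ℕ))).indicator 1 x
      - ∑ i : Fin g2, (Hs (0 - (i : ℕ))).indicator (1 : (ℤ → A) → ℝ) x := by
    intro x
    have hU : (if B.Us (Q.InJ x) 0 then (1 : ℝ) else 0) = ∑ i : Fin g2, (Hs (0 - (i : ℕ))).indicator (1 : (ℤ → A) → ℝ) x := by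
      by_cases h : B.Us (Q.InJ x) 0
      · rw [if_pos h]
        obtain ⟨i, hi⟩ := h
        rw [Finset.sum_eq_single i]
        · rw [indicator_of_mem]; · rfl
          exact hi
        · intro i' _ hne
          rw [indicator_of_notMem]
          intro hi'
          apply hne
          have := Q.disj' hi' hi (i := i') (i' := i) (by omega) (by omega) (by ring)
          ext; omega
        · simp
      · rw [if_neg h, eq_comm]
        apply Finset.sum_eq_zero
        intro i _
        rw [indicator_of_notMem]
        intro hi
        exact h ⟨i, hi⟩
    have hD : (if B.Dm (Q.InJ x) (Q.xi x) 0 then (1 : ℝ) else 0) ≤ 1 - ∑ i : Fin L, (Hs (0 - (i : ℕ))).indicator 1 x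
        + ∑ i : Fin L, (Ks (0 - (i : ℕ))).indicator 1 x := by
      by_cases h : ∃ i : Fin L, Q.InJ x (0 - (i : ℕ))
      · obtain ⟨i, hi⟩ := h
        have hun : ∀ i' : Fin L, Q.InJ x (0 - (i' : ℕ)) → i' = i := by
          intro i' hi'
          have := Q.disj' hi' hi (i := i') (i' := i) (by omega) (by omega) (by ring)
          ext; omega
        have s1 : ∑ i : Fin L, (Hs (0 - (i : ℕ))).indicator (1 : (ℤ → A) → ℝ) x = 1 := by
          rw [Finset.sum_eq_single i]
          · rw [indicator_of_mem]; · rfl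
            exact hi
          · intro i' _ hne
            rw [indicator_of_notMem]
            exact fun hi' => hne (hun i' hi')
          · simp
        rw [s1]
        split_ifs with hd
        · have := Finset.single_le_sum (f := fun i : Fin L => (Ks (0 - (i : ℕ))).indicator (1 : (ℤ → A) → ℝ) x)
            (fun i _ => indicator_nonneg (fun _ _ => zero_le_one) _) (Finset.mem_univ i)
          have h2 : (Ks (0 - (i : ℕ))).indicator (1 : (ℤ → A) → ℝ) x = 1 := by
            rw [indicator_of_mem]; · rfl
            exact ⟨hi, (hFl x _ hi).1 (hd i hi)⟩
          simp only [h2] at this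
          linarith
        · have := Finset.sum_nonneg (s := Finset.univ) (f := fun i : Fin L => (Ks (0 - (i : ℕ))).indicator (1 : (ℤ → A) → ℝ) x)
            (fun i _ => indicator_nonneg (fun _ _ => zero_le_one) _)
          linarith
      · push Not at h
        have s1 : ∑ i : Fin L, (Hs (0 - (i : ℕ))).indicator (1 : (ℤ → A) → ℝ) x = 0 := by
          apply Finset.sum_eq_zero
          intro i _
          rw [indicator_of_notMem]
          exact h i
        have := Finset.sum_nonneg (s := Finset.univ) (f := fun i : Fin L => (Ks (0 - (i : ℕ))).indicator (1 : (ℤ → A) → ℝ) x)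
            (fun i _ => indicator_nonneg (fun _ _ => zero_le_one) _)
        rw [s1]
        split_ifs <;> linarith
    have : f x = (if B.Dm (Q.InJ x) (Q.xi x) 0 then (1 : ℝ) else 0) - (if B.Us (Q.InJ x) 0 then (1 : ℝ) else 0) := by
      simp only [hf, Tab.es, ee]
      push_cast
      rfl
    rw [this, hU]
    linarith
  have hIH : ∀ z, Integrable ((Hs z).indicator (1 : (ℤ → A) → ℝ)) P := fun z =>
    (integrable_const (1 : ℝ)).indicator (hHm z)
  have hIK : ∀ z, Integrable ((Ks z).indicator (1 : (ℤ → A) → ℝ)) P := fun z =>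
    (integrable_const (1 : ℝ)).indicator (hKm z)
  have i1 : Integrable (fun x => ∑ i : Fin L, (Hs (0 - (i : ℕ))).indicator (1 : (ℤ → A) → ℝ) x) P :=
    integrable_finsetSum _ fun i _ => hIH _
  have i2 : Integrable (fun x => ∑ i : Fin L, (Ks (0 - (i : ℕ))).indicator (1 : (ℤ → A) → ℝ) x) P :=
    integrable_finsetSum _ fun i _ => hIK _
  have i3 : Integrable (fun x => ∑ i : Fin g2, (Hs (0 - (i : ℕ))).indicator (1 : (ℤ → A) → ℝ) x) P :=
    integrable_finsetSum _ fun i _ => hIH _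
  have hneg : ∫ x, f x ∂P < 0 := by
    have hfi : Integrable f P := (memLp_bdd (μ := P) hfm hb).integrable (by norm_num)
    have h1 := integral_mono hfi ((((integrable_const (1 : ℝ)).sub i1).add i2).sub i3) hpt
    have h2 : ∫ x, (1 - ∑ i : Fin L, (Hs (0 - (i : ℕ))).indicator 1 x + ∑ i : Fin L, (Ks (0 - (i : ℕ))).indicator 1 x
      - ∑ i : Fin g2, (Hs (0 - (i : ℕ))).indicator (1 : (ℤ → A) → ℝ) x) ∂P = 1 - L * π + L * P.real (Ks 0) - g2 * π := by
      have j1 : Integrable (fun x => 1 - ∑ i : Fin L, (Hs (0 - (i : ℕ))).indicator (1 : (ℤ → A) → ℝ) x) P :=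
        (integrable_const (1 : ℝ)).sub i1
      have j2 : Integrable (fun x => 1 - ∑ i : Fin L, (Hs (0 - (i : ℕ))).indicator (1 : (ℤ → A) → ℝ) x
        + ∑ i : Fin L, (Ks (0 - (i : ℕ))).indicator (1 : (ℤ → A) → ℝ) x) P := j1.add i2
      rw [integral_sub j2 i3, integral_add j1 i2, integral_sub (integrable_const (1 : ℝ)) i1,
        integral_finsetSum _ fun i _ => hIH _, integral_finsetSum _ fun i _ => hIK _, integral_finsetSum _ fun i _ => hIH _]
      simp only [integral_indicator_one (hHm _), integral_indicator_one (hKm _), hHz]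
      simp only [hKz (0 - _)]
      simp
    have h3 : ∫ x, f x ∂P ≤ 1 - L * π + L * P.real (Ks 0) - g2 * π := by rw [← h2]; exact h1
    have := mul_le_mul_of_nonneg_left hK0 (Nat.cast_nonneg (α := ℝ) L)
    linarith
  filter_upwards [lln hμ hP hρ hp hlim f hb _ hloc hneg] with x hx
  intro z _
  obtain ⟨n, hn⟩ := hx z
  refine ⟨n, ?_⟩
  simp only [hfs] at hn
  unfold SS
  exact_mod_cast hn

end Sys
end NOF

open MeasureTheory Filter Set Topology ENNReal
set_option linter.unusedSectionVars false
set_option linter.unusedVariables false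
set_option linter.unusedSimpArgs false

namespace NOF

/-- word systems -/
structure WS (A : Type*) (a : A) (L g N : ℕ) where
  Gd : (Fin L → A) → Prop
  dig : (Fin L → A) → (Fin g → ZMod N)
  act : (Fin g → ZMod N) → (Fin L → A) → (Fin L → A)
  gL : g ≤ L
  act_zero : ∀ u, act 0 u = u
  act_add : ∀ c c' u, act (c + c') u = act c (act c' u)
  perm : ∀ c u, ∃ σ : Equiv.Perm (Fin L), act c u = u ∘ σ
  dig_act : ∀ c u, Gd u → dig (act c u) = dig u + c
  gd_act : ∀ c u, Gd u → Gd (act c u)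
  ends : ∀ c u, Gd u → ∃ i1 i2 : Fin L, u i1 ≠ a ∧ u i2 ≠ a ∧ act c u i1 = u i1 ∧ act c u i2 = u i2 ∧
    ∀ i, act c u i ≠ u i → i1 < i ∧ i < i2

section marker
variable {A : Type*} (a : A) (L : ℕ)

/-- a marker ends just before `i` -/
def EE (x : ℤ → A) (i : ℤ) : Prop := (∀ k : ℕ, k < L → x (i - 2 - k) = a) ∧ x (i - 1) ≠ a

theorem EE_shift (x : ℤ → A) (i k : ℤ) : EE a L (fun z => x (z + k)) i ↔ EE a L x (i + k) := by
  unfold EE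
  have h1 : ∀ l : ℕ, i - 2 - (l : ℤ) + k = i + k - 2 - l := by intro l; ring
  have h2 : i - 1 + k = i + k - 1 := by ring
  simp only [h1, h2]

theorem EE_loc {x x' : ℤ → A} {i : ℤ} (h : ∀ z, i - 2 - L ≤ z → z < i → x z = x' z) : EE a L x i ↔ EE a L x' i := by
  unfold EE
  have h1 : ∀ l : ℕ, l < L → x (i - 2 - (l : ℤ)) = x' (i - 2 - (l : ℤ)) := by
    intro l hl; apply h <;> omega
  rw [h (i - 1) (by omega) (by omega)]
  apply and_congr_left
  intro _
  apply forall₂_congr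
  intro l hl
  rw [h1 l hl]

theorem EE_of {x x' : ℤ → A} {i : ℤ}
    (h : ∀ w, x w ≠ x' w → ∃ l r, l < w ∧ w < r ∧ r < l + L ∧ x l ≠ a ∧ x r ≠ a)
    (hE : EE a L x i) : EE a L x' i := by
  have hrun : ∀ w, i - 2 - L < w → w ≤ i - 2 → x w = a := by
    intro w h1 h2
    have := hE.1 (i - 2 - w).toNat (by omega)
    rwa [show i - 2 - ((i - 2 - w).toNat : ℤ) = w by omega] at this
  constructor
  · intro k hk
    by_cases hh : x (i - 2 - k) = x' (i - 2 - k)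
    · rw [← hh]; exact hE.1 k hk
    · exfalso
      obtain ⟨l, r, h1, h2, h3, h4, h5⟩ := h _ hh
      have h6 : l ≤ i - 2 - L := by
        by_contra hc
        exact h4 (hrun l (by omega) (by omega))
      have h7 : i - 2 < r := by
        by_contra hc
        exact h5 (hrun r (by omega) (by omega))
      omega
  · by_cases hh : x (i - 1) = x' (i - 1)
    · rw [← hh]; exact hE.2
    · exfalso
      obtain ⟨l, r, h1, h2, h3, h4, h5⟩ := h _ hh
      exact h4 (hrun l (by omega) (by omega))

variable (K : ℕ)

/-- candidate block starts -/
def Cand (x : ℤ → A) (j : ℤ) : Prop := ∃ k : ℕ, k ≤ K ∧ EE a L x (j - k * L) ∧ ∀ i : ℤ, j - k * L < i → i ≤ j → ¬ EE a L x i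

/-- block starts before restricting to good words -/
def PreJ (x : ℤ → A) (j : ℤ) : Prop := Cand a L K x j ∧ ∀ i : ℤ, j < i → i < j + L → ¬ EE a L x i

theorem PreJ_congr {x x' : ℤ → A} {j j' : ℤ} (h : ∀ d : ℤ, -(K * L) ≤ d → d ≤ L → (EE a L x (j + d) ↔ EE a L x' (j' + d))) :
    PreJ a L K x j ↔ PreJ a L K x' j' := by
  have key : ∀ {x x' : ℤ → A} {j j' : ℤ} (h : ∀ d : ℤ, -(K * L) ≤ d → d ≤ L → (EE a L x (j + d) ↔ EE a L x' (j' + d))),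
      PreJ a L K x j → PreJ a L K x' j' := by
    rintro x x' j j' h ⟨⟨k, hk, h1, h2⟩, h3⟩
    have hkK : (k : ℤ) * L ≤ K * L := by
      have : (k : ℤ) ≤ K := by exact_mod_cast hk
      nlinarith
    have hk0 : (0 : ℤ) ≤ k * L := by positivity
    have tr : ∀ i : ℤ, j' - k * L ≤ i → i ≤ j' + L → (EE a L x (j + (i - j')) ↔ EE a L x' i) := by
      intro i h4 h5
      have := h (i - j') (by linarith) (by linarith)
      rwa [show j' + (i - j') = i by ring] at this
    refine ⟨⟨k, hk, ?_, ?_⟩, ?_⟩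
    · rw [← tr _ (by linarith) (by linarith), show j + (j' - k * L - j') = j - k * L by ring]
      exact h1
    · intro i h4 h5
      rw [← tr _ (by linarith) (by linarith)]
      exact h2 _ (by linarith) (by linarith)
    · intro i h4 h5
      rw [← tr _ (by linarith) (by linarith)]
      exact h3 _ (by linarith) (by linarith)
  exact ⟨key h, key fun d h1 h2 => (h d h1 h2).symm⟩

theorem PreJ_disj {x : ℤ → A} {j j' : ℤ} (h : PreJ a L K x j) (h' : PreJ a L K x j') (hlt : j < j') : j + L ≤ j' := by
  by_contra hcon
  obtain ⟨⟨k, hk, h1, h2⟩, h3⟩ := h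
  obtain ⟨⟨k', hk', h1', h2'⟩, h3'⟩ := h'
  have hk0 : (0 : ℤ) ≤ k * L := by positivity
  have hk0' : (0 : ℤ) ≤ k' * L := by positivity
  have e1 : j' - k' * L ≤ j - k * L := by
    by_contra hc
    rcases le_or_gt (j' - k' * L) j with h4 | h4
    · exact h2 _ (by linarith) h4 h1'
    · exact h3 _ h4 (by linarith) h1'
  have e2 : j - k * L ≤ j' - k' * L := by
    by_contra hc
    exact h2' _ (by linarith) (by linarith) h1
  have e3 : j' - j = (k' - k) * L := by linarith
  rcases le_or_gt ((k' : ℤ) - k) 0 with h4 | h4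
  · nlinarith
  · nlinarith
end marker

namespace WS
variable {A : Type*} {a : A} {L g N : ℕ} (W : WS A a L g N) (K : ℕ)

/-- the system of blocks defined by markers -/
def toSys : Sys A L g N where
  InJ x j := PreJ a L K x j ∧ W.Gd (wd L x j)
  dig := W.dig
  act := W.act
  R := K * L + 2 * L + 2
  gL := W.gL
  LR := by have := Nat.zero_le (K * L); omega
  equi x j k := by
    have h1 : wd L (fun z => x (z + k)) j = wd L x (j + k) := by
      funext i; simp only [wd]; congr 1; ring
    rw [h1]
    apply and_congr_left
    intro _
    apply PreJ_congr
    intro d _ _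
    rw [EE_shift]
    rw [show j + d + k = j + k + d by ring]
  loc x x' j h := by
    push_cast at h
    have hKL : (0 : ℤ) ≤ K * L := by positivity
    have h1 : wd L x j = wd L x' j := by
      funext i
      have := i.2
      apply h
      · linarith
      · have : ((i : ℕ) : ℤ) < L := by exact_mod_cast i.2
        linarith
    rw [h1]
    apply and_congr_left
    intro _
    apply PreJ_congr
    intro d h2 h3
    apply EE_loc
    intro z h4 h5
    apply h <;> linarith
  disj x j j' h h' hlt := PreJ_disj a L K h.1 h'.1 hlt
  act_zero := W.act_zero
  act_add := W.act_add
  dig_act x j c h := W.dig_act c _ h.2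
  perm := W.perm
  inv x x' h h' := by
    have hch : ∀ w, x w ≠ x' w → ∃ l r, l < w ∧ w < r ∧ r < l + L ∧ x l ≠ a ∧ x r ≠ a ∧ x' l = x l ∧ x' r = x r := by
      intro w hw
      by_cases hc : ∀ i : Fin L, ¬ (PreJ a L K x (w - (i : ℕ)) ∧ W.Gd (wd L x (w - (i : ℕ))))
      · exact absurd (h' w hc).symm hw
      · push Not at hc
        obtain ⟨i, hi1, hi2⟩ := hc
        obtain ⟨c, hc⟩ := h _ ⟨hi1, hi2⟩
        obtain ⟨i1, i2, h1, h2, h3, h4, h5⟩ := W.ends c _ hi2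
        have h6 := congrFun hc i
        have h7 := congrFun hc i1
        have h8 := congrFun hc i2
        rw [h3] at h7
        rw [h4] at h8
        simp only [wd] at h6 h7 h8 h1 h2
        obtain ⟨h9, h10⟩ := h5 i (by
          rw [← h6]
          simp only [wd]
          rw [sub_add_cancel]
          exact hw.symm)
        refine ⟨w - (i : ℕ) + (i1 : ℕ), w - (i : ℕ) + (i2 : ℕ), ?_, ?_, ?_, h1, h2, h7, h8⟩
        · omega
        · omega
        · omega
    have hE : ∀ i, EE a L x i ↔ EE a L x' i := by
      intro i
      constructor
      · apply EE_of
        intro w hw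
        obtain ⟨l, r, h1, h2, h3, h4, h5, h6, h7⟩ := hch w hw
        exact ⟨l, r, h1, h2, h3, h4, h5⟩
      · apply EE_of
        intro w hw
        obtain ⟨l, r, h1, h2, h3, h4, h5, h6, h7⟩ := hch w hw.symm
        exact ⟨l, r, h1, h2, h3, by rwa [h6], by rwa [h7]⟩
    intro j
    have hP : PreJ a L K x j ↔ PreJ a L K x' j := PreJ_congr a L K fun d _ _ => hE _
    constructor
    · rintro ⟨h1, h2⟩
      have h1' := hP.2 h1
      refine ⟨h1', ?_⟩
      by_contra hG
      have : wd L x' j = wd L x j := by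
        funext k
        apply h'
        rintro i ⟨hi1, hi2⟩
        have hk := k.2
        have hi := i.2
        rcases lt_trichotomy j (j + (k : ℕ) - (i : ℕ)) with hlt | heq | hlt
        · have := PreJ_disj a L K h1' hi1 hlt; omega
        · rw [← heq] at hi2; exact hG hi2
        · have := PreJ_disj a L K hi1 h1' hlt; omega
      rw [this] at h2
      exact hG h2
    · rintro ⟨h1, h2⟩
      refine ⟨hP.1 h1, ?_⟩
      obtain ⟨c, hc⟩ := h j ⟨h1, h2⟩
      rw [hc]
      exact W.gd_act c _ h2

variable [Finite A] [MeasurableSpace A] [MeasurableSingletonClass A]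

theorem EE_meas (i : ℤ) : MeasurableSet {x : ℤ → A | EE a L x i} := by
  rw [measurableSet_setOfPred]
  apply measurable_of_dep (Finset.Icc (i - 2 - L) i)
  intro x x' h
  apply propext
  apply EE_loc
  intro z h1 h2
  exact h z (by simp only [Finset.mem_Icc]; omega)

theorem shift_inv {P : Measure (ℤ → A)} [IsProbabilityMeasure P] {p : A → ℝ} (hP : IsProductMeasure P (fun _ => p))
    (k : ℤ) {S : Set (ℤ → A)} (hS : MeasurableSet S) : P.real ((fun (x : ℤ → A) (j : ℤ) => x (j + k)) ⁻¹' S) = P.real S := by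
  have hne : Nonempty A := by
    obtain ⟨x, _⟩ := nonempty_of_measure_ne_zero (μ := P) (s := univ) (by simp)
    exact ⟨x 0⟩
  have hm : Measurable (fun (x : ℤ → A) (j : ℤ) => x (j + k)) := by
    rw [measurable_pi_iff]; intro i; exact measurable_pi_apply _
  have : P.map (fun (x : ℤ → A) (j : ℤ) => x (j + k)) = P := prod_unique (shift_prod hP k) hP hne
  conv_rhs => rw [← this, Measure.real, Measure.map_apply hm hS]
  rfl

theorem EE_often {P : Measure (ℤ → A)} [IsProbabilityMeasure P] {p : A → ℝ} (hp : IsProbVecC p) (hp0 : ∀ a, 0 < p a)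
    (hP : IsProductMeasure P (fun _ => p)) (b : A) (hb : b ≠ a) (ε : ℝ) (hε : 0 < ε) :
    ∃ M : ℕ, 1 - ε ≤ P.real {x | ∃ e : ℤ, -M ≤ e ∧ e ≤ 0 ∧ EE a L x e} := by
  classical
  set c := P.real {x | EE a L x 0} with hc
  have hcp : 0 < c := by
    set s : Finset ℤ := Finset.Icc (-(L : ℤ) - 2) (-1)
    set y : ℤ → A := fun i => if i = -1 then b else a
    have h1 : P (_root_.cylinder s y) ≠ 0 := by
      rw [hP]
      rw [Finset.prod_ne_zero_iff]
      intro i _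
      simp [hp0]
    have h2 : _root_.cylinder s y ⊆ {x | EE a L x 0} := by
      intro x hx
      have hx' : ∀ i ∈ s, x i = y i := hx
      constructor
      · intro k hk
        rw [hx' _ (by simp only [s, Finset.mem_Icc]; omega)]
        simp only [y]
        rw [if_neg (by omega)]
      · rw [hx' _ (by simp only [s, Finset.mem_Icc]; omega)]
        simp [y, hb]
    rw [hc, measureReal_def]
    apply ENNReal.toReal_pos _ (measure_ne_top _ _)
    intro h0
    exact h1 (measure_mono_null h2 h0)
  set f : (ℤ → A) → ℝ := fun x => c / 2 - {x | EE a L x 0}.indicator 1 x with hf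
  have hc1 : c ≤ 1 := measureReal_le_one
  have hl := lln (f := f) (M := 1) (R := L + 2) hP hP (fun _ => hp) hp (fun a => tendsto_const_nhds) (by
      intro x
      simp only [hf, indicator]
      rw [abs_le]
      split_ifs <;> constructor <;> simp <;> linarith) (by
      intro x x' h
      have : EE a L x 0 ↔ EE a L x' 0 := by
        apply EE_loc
        intro z h1 h2
        push_cast at h
        apply h <;> linarith
      simp only [hf, indicator, mem_ofPred_eq, this, Pi.one_apply]) (by
      simp only [hf]
      have hi : Integrable ({x | EE a L x 0}.indicator (1 : (ℤ → A) → ℝ)) P := (integrable_const (1:ℝ)).indicator (EE_meas 0)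
      rw [integral_sub (integrable_const _) hi, integral_indicator_one (EE_meas 0), integral_const]
      simp
      linarith)
  have hae : ∀ᵐ x ∂P, ∃ M : ℕ, ∃ e : ℤ, 0 ≤ e ∧ e ≤ M ∧ EE a L x e := by
    filter_upwards [hl] with x hx
    obtain ⟨n, hn⟩ := hx 0
    by_contra hcon
    push Not at hcon
    have : ∀ k ∈ Finset.range (n + 1), f (fun j => x (j + (0 + k))) = c / 2 := by
      intro k hk
      simp only [hf, indicator, mem_ofPred_eq]
      rw [if_neg, sub_zero]
      rw [EE_shift]
      have := hcon k k (by positivity) le_rfl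
      simpa using this
    rw [Finset.sum_congr rfl this] at hn
    simp at hn
    have : 0 < ((n : ℝ) + 1) * (c / 2) := by positivity
    linarith
  set G : ℕ → Set (ℤ → A) := fun M => {x | ∃ e : ℤ, 0 ≤ e ∧ e ≤ M ∧ EE a L x e} with hG
  have hGm : Monotone G := by
    rintro M M' h x ⟨e, h1, h2, h3⟩
    exact ⟨e, h1, h2.trans (by exact_mod_cast h), h3⟩
  have hU : P (⋃ M, G M) = 1 := by
    rw [← mem_ae_iff_prob_eq_one₀]
    · filter_upwards [hae] with x hx
      rw [mem_iUnion]; exact hx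
    · apply MeasurableSet.nullMeasurableSet
      apply MeasurableSet.iUnion
      intro M
      have : G M = ⋃ e ∈ Set.Icc (0 : ℤ) M, {x | EE a L x e} := by
        ext x; simp [hG, and_assoc]
      rw [this]
      exact MeasurableSet.biUnion (Set.to_countable _) fun e _ => EE_meas e
  have ht := tendsto_measure_iUnion_atTop (μ := P) hGm
  rw [hU] at ht
  have ht2 : Tendsto (fun M => P.real (G M)) atTop (𝓝 1) := by
    have := (ENNReal.tendsto_toReal (by norm_num : (1 : ℝ≥0∞) ≠ ∞)).comp ht
    exact this
  obtain ⟨M, hM⟩ := (ht2.eventually (lt_mem_nhds (show 1 - ε < 1 by linarith))).exists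
  refine ⟨M, hM.le.trans ?_⟩
  have hGms : MeasurableSet {x : ℤ → A | ∃ e : ℤ, -M ≤ e ∧ e ≤ 0 ∧ EE a L x e} := by
    have : {x : ℤ → A | ∃ e : ℤ, -M ≤ e ∧ e ≤ 0 ∧ EE a L x e} = ⋃ e ∈ Set.Icc (-M : ℤ) 0, {x | EE a L x e} := by
      ext x; simp [and_assoc]
    rw [this]
    exact MeasurableSet.biUnion (Set.to_countable _) fun e _ => EE_meas e
  rw [← shift_inv hP M hGms]
  refine measureReal_mono ?_ (measure_ne_top _ _)
  rintro x ⟨e, h1, h2, h3⟩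
  refine ⟨e - M, by omega, by omega, ?_⟩
  rw [EE_shift, sub_add_cancel]
  exact h3

end WS
end NOF

open MeasureTheory Filter Set Topology ENNReal
set_option linter.unusedSectionVars false
set_option linter.unusedVariables false
set_option linter.unusedSimpArgs false

namespace NOF
namespace WS
variable {A : Type*} {a : A} {L g N : ℕ} (W : WS A a L g N) (K : ℕ)
variable [Finite A] [MeasurableSpace A] [MeasurableSingletonClass A]

theorem Cand_congr {x x' : ℤ → A} {j : ℤ} (h : ∀ i : ℤ, j - K * L ≤ i → i ≤ j → (EE a L x i ↔ EE a L x' i)) :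
    Cand a L K x j ↔ Cand a L K x' j := by
  have key : ∀ {x x' : ℤ → A} (h : ∀ i : ℤ, j - K * L ≤ i → i ≤ j → (EE a L x i ↔ EE a L x' i)),
      Cand a L K x j → Cand a L K x' j := by
    rintro x x' h ⟨k, hk, h1, h2⟩
    have hkK : (k : ℤ) * L ≤ K * L := by
      have : (k : ℤ) ≤ K := by exact_mod_cast hk
      nlinarith
    have hk0 : (0 : ℤ) ≤ k * L := by positivity
    refine ⟨k, hk, (h _ (by linarith) (by linarith)).1 h1, ?_⟩
    intro i h4 h5
    rw [← h i (by linarith) h5]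
    exact h2 i h4 h5
  exact ⟨key h, key fun i h1 h2 => (h i h1 h2).symm⟩

theorem Cand_shift (x : ℤ → A) (j k : ℤ) : Cand a L K (fun z => x (z + k)) j ↔ Cand a L K x (j + k) := by
  unfold Cand
  apply exists_congr; intro l
  apply and_congr_right; intro _
  rw [EE_shift, show j - l * L + k = j + k - l * L by ring]
  apply and_congr_right; intro _
  constructor
  · intro h i h1 h2
    have := h (i - k) (by linarith) (by linarith)
    rwa [EE_shift, sub_add_cancel] at this
  · intro h i h1 h2
    rw [EE_shift]
    exact h (i + k) (by linarith) (by linarith)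

theorem Cand_loc {x x' : ℤ → A} {j : ℤ} (h : ∀ z, z ∈ Finset.Ico (j - K * L - 2 - L) j → x z = x' z) :
    Cand a L K x j = Cand a L K x' j := by
  apply propext
  apply Cand_congr
  intro i h1 h2
  apply EE_loc
  intro z h3 h4
  apply h
  simp only [Finset.mem_Ico]
  constructor <;> linarith

theorem Cand_meas (j : ℤ) : MeasurableSet {x : ℤ → A | Cand a L K x j} := by
  rw [measurableSet_setOfPred]
  exact measurable_of_dep (Finset.Ico (j - K * L - 2 - L) j) _ fun x x' h => Cand_loc K h

theorem EE_le {P : Measure (ℤ → A)} [IsProbabilityMeasure P] {p : A → ℝ} (hp : IsProbVecC p)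
    (hP : IsProductMeasure P (fun _ => p)) (i : ℤ) : P.real {x | EE a L x i} ≤ p a ^ L := by
  have h1 : {x | EE a L x i} ⊆ _root_.cylinder (Finset.Ioc (i - 2 - L) (i - 2)) (fun _ => a) := by
    intro x hx z hz
    simp only [Finset.mem_Ioc] at hz
    have := hx.1 (i - 2 - z).toNat (by omega)
    rwa [show i - 2 - ((i - 2 - z).toNat : ℤ) = z by omega] at this
  refine (measureReal_mono h1 (measure_ne_top _ _)).trans ?_
  rw [measureReal_def, hP, Finset.prod_const, ENNReal.toReal_pow, ENNReal.toReal_ofReal (hp.1 a)]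
  simp

theorem dens {P : Measure (ℤ → A)} [IsProbabilityMeasure P] {p : A → ℝ} (hp : IsProbVecC p) (hp0 : ∀ a, 0 < p a)
    (hP : IsProductMeasure P (fun _ => p)) (b : A) (hb : b ≠ a) (hL : 0 < L) (ε : ℝ) (hε : 0 < ε) :
    ∃ K : ℕ, P.real {x | W.Gd (wd L x 0)} * (1 - ε) - L ^ 2 * p a ^ L ≤ L * P.real {x | (W.toSys K).InJ x 0} := by
  classical
  obtain ⟨M, hM⟩ := EE_often (L := L) hp hp0 hP b hb ε hε
  refine ⟨M, ?_⟩
  have hne : Nonempty A := ⟨a⟩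
  have hC : 1 - ε ≤ L * P.real {x | Cand a L M x 0} := by
    refine hM.trans ?_
    have h1 : {x : ℤ → A | ∃ e : ℤ, -M ≤ e ∧ e ≤ 0 ∧ EE a L x e} ⊆ ⋃ r ∈ Finset.range L, {x | Cand a L M x (-(r : ℤ))} := by
      rintro x ⟨e0, h1, h2, h3⟩
      obtain ⟨e, ⟨he0, heE⟩, hmax⟩ := Int.exists_greatest_of_bdd (P := fun e => e ≤ 0 ∧ EE a L x e) ⟨0, fun z hz => hz.1⟩ ⟨e0, h2, h3⟩
      have hee := hmax e0 ⟨h2, h3⟩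
      obtain ⟨n, hn⟩ := Int.eq_ofNat_of_zero_le (show 0 ≤ -e by linarith)
      have hdm := Nat.div_add_mod n L
      rw [mem_iUnion₂]
      refine ⟨n % L, Finset.mem_range.2 (Nat.mod_lt _ hL), n / L, (Nat.div_le_self _ _).trans (by omega), ?_, ?_⟩
      · have : -((n % L : ℕ) : ℤ) - ((n / L : ℕ) : ℤ) * L = e := by
          have : ((L * (n / L) + n % L : ℕ) : ℤ) = n := by rw [hdm]
          push_cast at this ⊢
          linarith
        rw [this]; exact heE
      · have : -((n % L : ℕ) : ℤ) - ((n / L : ℕ) : ℤ) * L = e := by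
          have : ((L * (n / L) + n % L : ℕ) : ℤ) = n := by rw [hdm]
          push_cast at this ⊢
          linarith
        rw [this]
        intro i hi1 hi2 hi3
        have := hmax i ⟨by omega, hi3⟩
        omega
    refine (measureReal_mono h1 (measure_ne_top _ _)).trans ((measureReal_biUnion_finset_le _ _).trans ?_)
    rw [Finset.sum_congr rfl (g := fun _ => P.real {x | Cand a L M x 0})]
    · simp
    · intro r _
      rw [← shift_inv hP (-(r : ℤ)) (Cand_meas M 0)]
      congr 1
      ext x
      simp only [mem_ofPred_eq, mem_preimage]
      rw [Cand_shift, zero_add]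
  set C := {x : ℤ → A | Cand a L M x 0} with hCdef
  set G := {x : ℤ → A | W.Gd (wd L x 0)} with hGdef
  have hind : P.real (C ∩ G) = P.real C * P.real G := by
    have := indep_dep hP (fun _ => hp) hne (Finset.Ico (0 - (M : ℤ) * L - 2 - L) 0) (Finset.Ico 0 (L : ℤ)) (by
      rw [Finset.disjoint_left]; intro z; simp only [Finset.mem_Ico]; omega)
      (fun x => Cand a L M x 0) (fun x => W.Gd (wd L x 0)) (fun x x' h => Cand_loc M h) (by
        intro x x' h
        have : wd L x 0 = wd L x' 0 := by
          funext i
          have := i.2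
          apply h
          simp only [Finset.mem_Ico]; omega
        simp only [this])
    have h2 := this.measure_inter_preimage_eq_mul {True} {True} (MeasurableSet.singleton _) (MeasurableSet.singleton _)
    have e1 : (fun x => Cand a L M x 0) ⁻¹' {True} = C := by ext x; simp [hCdef]
    have e2 : (fun x => W.Gd (wd L x 0)) ⁻¹' {True} = G := by ext x; simp [hGdef]
    rw [e1, e2] at h2
    rw [measureReal_def, h2, ENNReal.toReal_mul]; rfl
  have hsub : C ∩ G ⊆ {x | (W.toSys M).InJ x 0} ∪ ⋃ i ∈ Finset.range L, {x | EE a L x (i : ℤ)} := by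
    rintro x ⟨h1, h2⟩
    by_cases h : ∀ i : ℤ, 0 < i → i < 0 + L → ¬ EE a L x i
    · left; exact ⟨⟨h1, h⟩, h2⟩
    · right
      push Not at h
      obtain ⟨i, h3, h4, h5⟩ := h
      rw [mem_iUnion₂]
      refine ⟨i.toNat, Finset.mem_range.2 (by omega), ?_⟩
      rw [mem_ofPred_eq, Int.toNat_of_nonneg h3.le]; exact h5
  have hb1 : P.real C * P.real G ≤ P.real {x | (W.toSys M).InJ x 0} + L * p a ^ L := by
    rw [← hind]
    refine (measureReal_mono hsub (measure_ne_top _ _)).trans ((measureReal_union_le _ _).trans ?_)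
    gcongr
    refine (measureReal_biUnion_finset_le _ _).trans ?_
    refine (Finset.sum_le_sum fun i _ => EE_le hp hP _).trans ?_
    simp
  have hG0 : 0 ≤ P.real G := measureReal_nonneg
  have hL' : (0 : ℝ) < L := by exact_mod_cast hL
  have e3 := mul_le_mul_of_nonneg_left hb1 hL'.le
  have e4 := mul_le_mul_of_nonneg_left hC hG0
  nlinarith

end WS
end NOF

open MeasureTheory Filter Set Topology ENNReal
set_option linter.unusedSectionVars false
set_option linter.unusedVariables false
set_option linter.unusedSimpArgs false

namespace NOF

/-- entropy in nats -/
noncomputable def Hn {A : Type*} [Fintype A] (p : A → ℝ) : ℝ := ∑ a, -(p a * Real.log (p a))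

section aep
variable {A : Type*} [Fintype A] [MeasurableSpace A] [MeasurableSingletonClass A]

theorem integral_coord {P : Measure (ℤ → A)} [IsProbabilityMeasure P] {p : A → ℝ} (hp : IsProbVecC p)
    (hP : IsProductMeasure P (fun _ => p)) (F : A → ℝ) (k : ℤ) : ∫ x, F (x k) ∂P = ∑ a, p a * F a := by
  have hm : Measurable (fun x : ℤ → A => x k) := measurable_pi_apply k
  have : IsProbabilityMeasure (P.map (fun x : ℤ → A => x k)) := Measure.isProbabilityMeasure_map hm.aemeasurable
  rw [← integral_map (φ := fun x : ℤ → A => x k) (f := F) hm.aemeasurable (Measurable.of_discrete).aestronglyMeasurable]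
  rw [integral_fintype (Integrable.of_finite)]
  apply Finset.sum_congr rfl
  intro a _
  rw [smul_eq_mul]
  congr 1
  rw [measureReal_def, Measure.map_apply hm (MeasurableSet.singleton a)]
  have : (fun x : ℤ → A => x k) ⁻¹' {a} = _root_.cylinder {k} (fun _ => a) := by
    ext x; simp [_root_.cylinder]
  rw [this, hP]
  simp [ENNReal.toReal_ofReal (hp.1 a)]

theorem word_prob {P : Measure (ℤ → A)} [IsProbabilityMeasure P] {p : A → ℝ} (hp : IsProbVecC p)
    (hP : IsProductMeasure P (fun _ => p)) (L : ℕ) (S : (Fin L → A) → Prop) [DecidablePred S] :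
    P.real {x | S (wd L x 0)} = ∑ u : Fin L → A with S u, ∏ i, p (u i) := by
  classical
  have hm : Measurable (fun x : ℤ → A => wd L x 0) := by
    rw [measurable_pi_iff]; intro i; exact measurable_pi_apply _
  have h1 : {x : ℤ → A | S (wd L x 0)} = (fun x : ℤ → A => wd L x 0) ⁻¹' ((Finset.univ.filter S : Finset (Fin L → A)) : Set (Fin L → A)) := by
    ext x; simp
  have h2 : ∀ u : Fin L → A, P.real ((fun x : ℤ → A => wd L x 0) ⁻¹' {u}) = ∏ i, p (u i) := by
    intro u
    rcases isEmpty_or_nonempty A with hA | ⟨⟨a0⟩⟩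
    · obtain ⟨x, _⟩ := nonempty_of_measure_ne_zero (μ := P) (s := univ) (by simp)
      exact (hA.false (x 0)).elim
    set y : ℤ → A := fun z => if h : z.toNat < L then u ⟨z.toNat, h⟩ else a0
    have h3 : (fun x : ℤ → A => wd L x 0) ⁻¹' {u} = _root_.cylinder ((Finset.univ : Finset (Fin L)).image (fun i : Fin L => ((i : ℕ) : ℤ))) y := by
      ext x
      simp only [mem_preimage, mem_singleton_iff, _root_.cylinder, mem_ofPred_eq, Finset.mem_image, Finset.mem_univ, true_and,
        forall_exists_index, forall_apply_eq_imp_iff]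
      rw [funext_iff]
      apply forall_congr'
      intro i
      simp [wd, y]
    rw [h3, measureReal_def, hP, Finset.prod_image (by intro i _ j _ h; exact Fin.ext (by simpa using h)), ENNReal.toReal_prod]
    apply Finset.prod_congr rfl
    intro i _
    rw [ENNReal.toReal_ofReal (hp.1 _)]
    simp [y]
  have h4 : {x : ℤ → A | S (wd L x 0)} = ⋃ u ∈ (Finset.univ.filter S : Finset (Fin L → A)), (fun x : ℤ → A => wd L x 0) ⁻¹' {u} := by
    ext x; simp
  rw [h4, measureReal_biUnion_finset]
  · exact Finset.sum_congr rfl fun u _ => h2 u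
  · intro u _ v _ huv
    rw [Function.onFun, Set.disjoint_left]
    rintro x hx hy
    exact huv (hx.symm.trans hy)
  · intro u _
    exact hm (MeasurableSet.singleton u)

/-- asymptotic equipartition -/
theorem aep {p : A → ℝ} (hp : IsProbVecC p) (hp0 : ∀ a, 0 < p a) (ε0 δ : ℝ) (hε0 : 0 < ε0) (hδ : 0 < δ) :
    ∀ᶠ L : ℕ in atTop, ∀ P : Measure (ℤ → A), IsProbabilityMeasure P → IsProductMeasure P (fun _ => p) →
      P.real {x | L * ε0 ≤ |-Real.log (∏ i, p (wd L x 0 i)) - L * Hn p|} ≤ δ := by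
  obtain ⟨M, hM⟩ : ∃ M : ℝ, ∀ a, |-Real.log (p a)| ≤ M := by
    refine ⟨∑ a, |-Real.log (p a)|, fun a => Finset.single_le_sum (f := fun a => |-Real.log (p a)|) (fun _ _ => abs_nonneg _) (Finset.mem_univ a)⟩
  have ht : Tendsto (fun L : ℕ => (4 * M ^ 2 / ε0 ^ 2) / (L : ℝ)) atTop (𝓝 0) :=
    tendsto_const_div_atTop_nhds_zero_nat _
  filter_upwards [ht.eventually (gt_mem_nhds hδ), eventually_gt_atTop 0] with L hL hL0 P hPp hP
  have hL' : (0 : ℝ) < L := by exact_mod_cast hL0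
  have hne : Nonempty A := by
    obtain ⟨x, _⟩ := nonempty_of_measure_ne_zero (μ := P) (s := univ) (by simp)
    exact ⟨x 0⟩
  have hch := cheb (μ := P) (X := fun k x => -Real.log (p (x (k : ℤ)))) (M := M) (fun k => by
      apply measurable_of_dep {(k : ℤ)}
      intro x x' h
      rw [h k (by simp)]) (fun k x => hM _) 0 (by
      intro k l hkl
      apply indep_dep hP (fun _ => hp) hne {(k : ℤ)} {(l : ℤ)}
      · simp; omega
      · intro x x' h; rw [h k (by simp)]
      · intro x x' h; rw [h l (by simp)]) L (c := L * ε0) (by positivity)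
  have e1 : ∀ k : ℕ, ∫ x, -Real.log (p (x (k : ℤ))) ∂P = Hn p := by
    intro k
    rw [integral_coord hp hP (fun a => -Real.log (p a)) k]
    unfold Hn
    apply Finset.sum_congr rfl
    intro a _
    ring
  have e2 : ∀ x : ℤ → A, ∑ k ∈ Finset.range L, -Real.log (p (x (k : ℤ))) = -Real.log (∏ i, p (wd L x 0 i)) := by
    intro x
    rw [Real.log_prod (fun i _ => (hp0 _).ne'), Finset.sum_neg_distrib, ← Fin.sum_univ_eq_sum_range (fun k => Real.log (p (x (k : ℤ))))]
    simp [wd]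
  simp only [e1, e2] at hch
  simp only [Finset.sum_const, Finset.card_range, nsmul_eq_mul] at hch
  refine hch.trans (le_trans (le_of_eq ?_) hL.le)
  field_simp
  push_cast
  ring

theorem Hn_le {p : A → ℝ} (hp : IsProbVecC p) (hp0 : ∀ a, 0 < p a) : Hn p ≤ Real.log (Fintype.card A) := by
  have hs : ∑ a, p a = 1 := (hasSum_fintype p).unique hp.2
  have hc : (0 : ℝ) < Fintype.card A := by
    have : Nonempty A := by
      by_contra h
      rw [not_nonempty_iff] at h
      simp at hs
    exact_mod_cast Fintype.card_pos
  have : Hn p - Real.log (Fintype.card A) ≤ 0 := by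
    have e : Hn p - Real.log (Fintype.card A) = ∑ a, p a * Real.log (1 / (p a * Fintype.card A)) := by
      unfold Hn
      conv_lhs => rw [← one_mul (Real.log (Fintype.card A)), ← hs, Finset.sum_mul, ← Finset.sum_sub_distrib]
      apply Finset.sum_congr rfl
      intro a _
      rw [one_div, Real.log_inv, Real.log_mul (hp0 a).ne' hc.ne']
      ring
    rw [e]
    calc ∑ a, p a * Real.log (1 / (p a * Fintype.card A)) ≤ ∑ a, p a * (1 / (p a * Fintype.card A) - 1) := by
          apply Finset.sum_le_sum
          intro a _
          have := hp0 a
          apply mul_le_mul_of_nonneg_left (Real.log_le_sub_one_of_pos (by positivity)) this.le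
      _ = ∑ a : A, (1 / (Fintype.card A : ℝ) - p a) := by
          apply Finset.sum_congr rfl
          intro a _
          have := hp0 a
          field_simp
      _ = 0 := by
          rw [Finset.sum_sub_distrib, hs]
          simp [hc.ne']
  linarith

end aep
end NOF

open MeasureTheory Filter Set Topology ENNReal
set_option linter.unusedSectionVars false
set_option linter.unusedVariables false
set_option linter.unusedSimpArgs false

namespace NOF

theorem fib_perm {X Y : Type*} [Fintype X] [DecidableEq Y] (f f' : X → Y)
    (h : ∀ y, (Finset.univ.filter (fun x => f x = y)).card = (Finset.univ.filter (fun x => f' x = y)).card) :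
    ∃ σ : Equiv.Perm X, f' = f ∘ σ := by
  have e : ∀ y, Nonempty ({x // f' x = y} ≃ {x // f x = y}) := by
    intro y
    rw [← Fintype.card_eq, Fintype.card_subtype, Fintype.card_subtype]
    exact (h y).symm
  refine ⟨(Equiv.sigmaFiberEquiv f').symm.trans ((Equiv.sigmaCongrRight fun y => (e y).some).trans (Equiv.sigmaFiberEquiv f)), ?_⟩
  funext x
  exact (((e (f' x)).some ⟨x, rfl⟩).2).symm

theorem split_one (F Z : Type*) [Fintype F] [AddCommGroup Z] [Fintype Z] :
    ∃ (Gd : F → Prop) (dig : F → Z) (act : Z → F → F), (∀ u, act 0 u = u) ∧ (∀ c c' u, act (c + c') u = act c (act c' u)) ∧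
      (∀ c u, Gd u → dig (act c u) = dig u + c) ∧ (∀ c u, Gd u → Gd (act c u)) ∧
      Nat.card {u // ¬ Gd u} ≤ Fintype.card Z := by
  classical
  have hZ : 0 < Fintype.card Z := Fintype.card_pos
  have hc : Fintype.card F = Fintype.card ((Fin (Fintype.card F / Fintype.card Z) × Z) ⊕ Fin (Fintype.card F % Fintype.card Z)) := by
    simp only [Fintype.card_sum, Fintype.card_prod, Fintype.card_fin]
    rw [mul_comm]
    exact (Nat.div_add_mod _ _).symm
  set e := Fintype.equivOfCardEq hc
  refine ⟨fun u => (e u).isLeft, fun u => Sum.elim (fun p => p.2) (fun _ => 0) (e u),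
    fun c u => e.symm (Sum.map (fun p => (p.1, p.2 + c)) id (e u)), ?_, ?_, ?_, ?_, ?_⟩
  · intro u
    have : (fun p : Fin (Fintype.card F / Fintype.card Z) × Z => (p.1, p.2 + 0)) = id := by funext p; simp
    simp only [this, Sum.map_id_id, id, Equiv.symm_apply_apply]
  · intro c c' u
    simp only
    apply congrArg e.symm
    rw [Equiv.apply_symm_apply]
    rcases e u with p | p
    · simp; abel
    · simp
  · intro c u h
    simp only
    rw [Equiv.apply_symm_apply]
    rcases h' : e u with p | p
    · simp
    · simp [h'] at h
  · intro c u h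
    simp only
    rw [Equiv.apply_symm_apply]
    rcases h' : e u with p | p
    · simp
    · simp [h'] at h
  · have : Nat.card {u // ¬ ((e u).isLeft = true)} ≤ Nat.card (Fin (Fintype.card F % Fintype.card Z)) := by
      apply Nat.card_le_card_of_surjective (f := fun i => ⟨e.symm (Sum.inr i), by simp⟩)
      rintro ⟨u, hu⟩
      rcases h' : e u with p | p
      · simp [h'] at hu
      · exact ⟨p, by rw [Subtype.ext_iff]; simp [← h']⟩
    refine this.trans ?_
    rw [Nat.card_fin]
    exact (Nat.mod_lt _ hZ).le

theorem split_fib {V T : Type*} (Z : Type*) [Fintype V] [Fintype T] [AddCommGroup Z] [Fintype Z] (τ : V → T) :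
    ∃ (Gd : V → Prop) (dig : V → Z) (act : Z → V → V), (∀ u, act 0 u = u) ∧ (∀ c c' u, act (c + c') u = act c (act c' u)) ∧
      (∀ c u, Gd u → dig (act c u) = dig u + c) ∧ (∀ c u, Gd u → Gd (act c u)) ∧ (∀ c u, τ (act c u) = τ u) ∧
      Nat.card {u // ¬ Gd u} ≤ Fintype.card T * Fintype.card Z := by
  classical
  have := fun t : T => split_one {u // τ u = t} Z
  choose Gd dig act h0 ha hd hg hc using this
  have hτ : ∀ c u, τ (act (τ u) c ⟨u, rfl⟩).1 = τ u := fun c u => (act (τ u) c ⟨u, rfl⟩).2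
  have tA : ∀ u t (h : τ u = t) c, (act (τ u) c ⟨u, rfl⟩).1 = (act t c ⟨u, h⟩).1 := by rintro u t rfl c; rfl
  have tD : ∀ u t (h : τ u = t), dig (τ u) ⟨u, rfl⟩ = dig t ⟨u, h⟩ := by rintro u t rfl; rfl
  have tG : ∀ u t (h : τ u = t), Gd (τ u) ⟨u, rfl⟩ ↔ Gd t ⟨u, h⟩ := by rintro u t rfl; rfl
  refine ⟨fun u => Gd (τ u) ⟨u, rfl⟩, fun u => dig (τ u) ⟨u, rfl⟩, fun c u => (act (τ u) c ⟨u, rfl⟩).1, ?_, ?_, ?_, ?_, hτ, ?_⟩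
  · intro u; simp only [h0]
  · intro c c' u
    simp only
    rw [tA _ _ (hτ c' u) c, ha]
  · intro c u h
    simp only at h ⊢
    rw [tD _ _ (hτ c u)]
    exact hd _ _ _ h
  · intro c u h
    simp only at h ⊢
    rw [tG _ _ (hτ c u)]
    exact hg _ _ _ h
  · have : Nat.card {u // ¬ Gd (τ u) ⟨u, rfl⟩} ≤ Nat.card (Σ t : T, {u : {u // τ u = t} // ¬ Gd t u}) := by
      apply Nat.card_le_card_of_injective (f := fun u => ⟨τ u.1, ⟨u.1, rfl⟩, u.2⟩)
      rintro ⟨u, hu⟩ ⟨v, hv⟩ h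
      have : (⟨τ u, ⟨⟨u, rfl⟩, hu⟩⟩ : (Σ t : T, {u : {u // τ u = t} // ¬ Gd t u})).2.1.1 = (⟨τ v, ⟨⟨v, rfl⟩, hv⟩⟩ : (Σ t : T, {u : {u // τ u = t} // ¬ Gd t u})).2.1.1 := by
        exact congrArg (fun s : (Σ t : T, {u : {u // τ u = t} // ¬ Gd t u}) => s.2.1.1) h
      exact Subtype.ext this
    refine this.trans ?_
    rw [Nat.card_sigma, ← Finset.card_univ, ← smul_eq_mul]
    exact Finset.sum_le_card_nsmul _ _ _ fun t _ => hc t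

theorem poly_exp (C : ℝ) (n : ℕ) (ε0 : ℝ) (h : 0 < ε0) :
    Tendsto (fun L : ℕ => C * ((L : ℝ) + 1) ^ n * Real.exp (-(L * ε0))) atTop (𝓝 0) := by
  have h1 : Tendsto (fun L : ℕ => ((L : ℝ) + 1) * ε0) atTop atTop :=
    Filter.Tendsto.atTop_mul_const h (tendsto_atTop_add_const_right _ _ tendsto_natCast_atTop_atTop)
  have h2 := ((Real.tendsto_pow_mul_exp_neg_atTop_nhds_zero n).comp h1).const_mul (C * Real.exp ε0 / ε0 ^ n)
  rw [mul_zero] at h2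
  refine h2.congr fun L => ?_
  simp only [Function.comp]
  rw [mul_pow, show -(((L : ℝ) + 1) * ε0) = -(L * ε0) - ε0 by ring, Real.exp_sub]
  have := Real.exp_pos ε0
  field_simp

section
variable {A : Type*} [Fintype A] [MeasurableSpace A] [MeasurableSingletonClass A]

theorem exists_ends (a : A) {L : ℕ} (u : Fin L → A) (h : ∃ i, u i ≠ a) : ∃ e : Fin L × Fin L,
    u e.1 ≠ a ∧ u e.2 ≠ a ∧ (∀ i, i < e.1 → u i = a) ∧ (∀ i, e.2 < i → u i = a) := by
  classical
  set s := Finset.univ.filter (fun i => u i ≠ a)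
  have hs : s.Nonempty := by obtain ⟨i, hi⟩ := h; exact ⟨i, by simp [s, hi]⟩
  refine ⟨(s.min' hs, s.max' hs), ?_, ?_, ?_, ?_⟩
  · have := s.min'_mem hs; simpa [s] using this
  · have := s.max'_mem hs; simpa [s] using this
  · intro i hi
    by_contra hc
    exact absurd (s.min'_le i (by simp [s, hc])) (not_le.2 hi)
  · intro i hi
    by_contra hc
    exact absurd (s.le_max' i (by simp [s, hc])) (not_le.2 hi)

theorem exists_WS (a : A) {p : A → ℝ} (hp : IsProbVecC p) (hp0 : ∀ a, 0 < p a) (ha : p a < 1) (N : ℕ) [NeZero N]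
    (ε0 δ : ℝ) (hε0 : 0 < ε0) (hδ : 0 < δ) :
    ∀ᶠ L : ℕ in atTop, ∀ g : ℕ, g ≤ L → (N : ℝ) ^ g ≤ Real.exp (L * (Hn p - 2 * ε0)) →
      ∃ W : WS A a L g N, ∀ P : Measure (ℤ → A), IsProbabilityMeasure P → IsProductMeasure P (fun _ => p) →
        1 - δ ≤ P.real {x | W.Gd (wd L x 0)} := by
  classical
  have t1 := (tendsto_pow_atTop_nhds_zero_of_lt_one (hp.1 a) ha).eventually (gt_mem_nhds (show 0 < δ / 3 by positivity))
  have t2 := (poly_exp ((Fintype.card A : ℝ) ^ 2) (Fintype.card A + 2) ε0 hε0).eventually (gt_mem_nhds (show 0 < δ / 3 by positivity))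
  filter_upwards [t1, t2, aep hp hp0 ε0 (δ / 3) hε0 (by positivity), eventually_gt_atTop 0] with L h1 h2 h3 hL0 g hgL hN
  have : NeZero L := ⟨hL0.ne'⟩
  set ed : (Fin L → A) → Fin L × Fin L := fun u => if h : ∃ i, u i ≠ a then (exists_ends a u h).choose else (0, 0) with hed
  have hedp : ∀ u, (∃ i, u i ≠ a) → u (ed u).1 ≠ a ∧ u (ed u).2 ≠ a ∧ (∀ i, i < (ed u).1 → u i = a) ∧ (∀ i, (ed u).2 < i → u i = a) := by
    intro u h
    simp only [hed, dif_pos h]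
    exact (exists_ends a u h).choose_spec
  set cnt : (Fin L → A) → A → Fin (L + 1) := fun u b => ⟨(Finset.univ.filter (fun i => u i = b)).card,
    Nat.lt_succ_of_le ((Finset.card_le_univ _).trans (by simp))⟩ with hcnt
  obtain ⟨Gd, dig, act, e0, ea, edg, eg, eτ, ec⟩ := split_fib (Fin g → ZMod N) (fun u : Fin L → A => (cnt u, ed u, u (ed u).1, u (ed u).2))
  have hperm : ∀ c u, ∃ σ : Equiv.Perm (Fin L), act c u = u ∘ σ := by
    intro c u
    apply fib_perm
    intro b
    have h5 := congrFun (congrArg Prod.fst (eτ c u)) b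
    simp only [hcnt, Fin.mk.injEq] at h5
    exact h5.symm
  let W : WS A a L g N :=
    { Gd := fun u => Gd u ∧ ∃ i, u i ≠ a
      dig := dig
      act := act
      gL := hgL
      act_zero := e0
      act_add := ea
      perm := hperm
      dig_act := fun c u h => edg c u h.1
      gd_act := by
        rintro c u ⟨h, i, hi⟩
        refine ⟨eg c u h, ?_⟩
        obtain ⟨σ, hσ⟩ := hperm c u
        exact ⟨σ.symm i, by rw [hσ]; simpa using hi⟩
      ends := by
        rintro c u ⟨h, hi⟩
        have hi' : ∃ i, act c u i ≠ a := by
          obtain ⟨i, hi⟩ := hi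
          obtain ⟨σ, hσ⟩ := hperm c u
          exact ⟨σ.symm i, by rw [hσ]; simpa using hi⟩
        obtain ⟨f1, f2, f3, f4⟩ := hedp u hi
        obtain ⟨f1', f2', f3', f4'⟩ := hedp _ hi'
        have q := eτ c u
        simp only [Prod.mk.injEq] at q
        obtain ⟨_, q1, q2, q3⟩ := q
        rw [q1] at q2 q3 f3' f4'
        refine ⟨(ed u).1, (ed u).2, f1, f2, q2, q3, ?_⟩
        intro i hne
        constructor
        · by_contra hc
          rcases (not_lt.1 hc).lt_or_eq with hlt | heq
          · exact hne (by rw [f3 i hlt, f3' i hlt])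
          · exact hne (by rw [heq, q2])
        · by_contra hc
          rcases (not_lt.1 hc).lt_or_eq with hlt | heq
          · exact hne (by rw [f4 i hlt, f4' i hlt])
          · exact hne (by rw [← heq, q3]) }
  refine ⟨W, fun P hPp hP => ?_⟩
  have h3' := h3 P hPp hP
  have hm : MeasurableSet {x : ℤ → A | W.Gd (wd L x 0)} := by
    have hm : Measurable (fun x : ℤ → A => wd L x 0) := by
      rw [measurable_pi_iff]; intro i; exact measurable_pi_apply _
    exact hm (Set.Finite.measurableSet (Set.toFinite {u | W.Gd u}))
  have hcompl : P.real {x : ℤ → A | ¬ W.Gd (wd L x 0)} ≤ δ := by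
    have hsub : {x : ℤ → A | ¬ W.Gd (wd L x 0)} ⊆ ({x | (fun u => ∀ i, u i = a) (wd L x 0)} ∪
        {x | L * ε0 ≤ |-Real.log (∏ i, p (wd L x 0 i)) - L * Hn p|}) ∪
        {x | (fun u => ¬ Gd u ∧ ∏ i, p (u i) ≤ Real.exp (-(L * (Hn p - ε0)))) (wd L x 0)} := by
      intro x hx
      by_cases k1 : ∀ i, wd L x 0 i = a
      · left; left; exact k1
      by_cases k2 : L * ε0 ≤ |-Real.log (∏ i, p (wd L x 0 i)) - L * Hn p|
      · left; right; exact k2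
      right
      constructor
      · intro k3
        apply hx
        push Not at k1
        exact ⟨k3, k1⟩
      · rw [not_le, abs_lt] at k2
        have hpos : 0 < ∏ i, p (wd L x 0 i) := Finset.prod_pos fun i _ => hp0 _
        rw [← Real.log_le_iff_le_exp hpos]
        linarith
    refine (measureReal_mono hsub (measure_ne_top _ _)).trans ((measureReal_union_le _ _).trans
      ((add_le_add_left (measureReal_union_le _ _) _).trans ?_))
    have b1 : P.real {x | (fun u => ∀ i, u i = a) (wd L x 0)} ≤ δ / 3 := by
      rw [word_prob hp hP L (fun u => ∀ i, u i = a)]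
      have : Finset.univ.filter (fun u : Fin L → A => ∀ i, u i = a) = {fun _ => a} := by
        ext u; simp [funext_iff]
      rw [this]
      simpa using h1.le
    have b2 : P.real {x | (fun u => ¬ Gd u ∧ ∏ i, p (u i) ≤ Real.exp (-(L * (Hn p - ε0)))) (wd L x 0)} ≤ δ / 3 := by
      rw [word_prob hp hP L (fun u => ¬ Gd u ∧ ∏ i, p (u i) ≤ Real.exp (-(L * (Hn p - ε0))))]
      refine (Finset.sum_le_card_nsmul _ _ (Real.exp (-(L * (Hn p - ε0)))) fun u hu => ?_).trans ?_
      · exact (Finset.mem_filter.1 hu).2.2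
      have hcc : ((Finset.univ.filter (fun u => ¬ Gd u ∧ ∏ i, p (u i) ≤ Real.exp (-(L * (Hn p - ε0))))).card : ℝ) ≤
          ((L : ℝ) + 1) ^ Fintype.card A * (L ^ 2 * (Fintype.card A) ^ 2) * (N : ℝ) ^ g := by
        have k1 : (Finset.univ.filter (fun u => ¬ Gd u ∧ ∏ i, p (u i) ≤ Real.exp (-(L * (Hn p - ε0))))).card ≤ Nat.card {u // ¬ Gd u} := by
          rw [Nat.card_eq_fintype_card, Fintype.card_subtype]
          apply Finset.card_le_card
          intro u hu
          simp only [Finset.mem_filter, Finset.mem_univ, true_and] at hu ⊢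
          exact hu.1
        have k2 := k1.trans ec
        have k3 : ((Finset.univ.filter (fun u => ¬ Gd u ∧ ∏ i, p (u i) ≤ Real.exp (-(L * (Hn p - ε0))))).card : ℝ) ≤ _ := Nat.cast_le.2 k2
        refine k3.trans (le_of_eq ?_)
        simp only [Fintype.card_prod, Fintype.card_fun, Fintype.card_fin, ZMod.card]
        push_cast
        ring
      rw [nsmul_eq_mul]
      calc _ ≤ (((L : ℝ) + 1) ^ Fintype.card A * (L ^ 2 * (Fintype.card A) ^ 2) * (N : ℝ) ^ g) * Real.exp (-(L * (Hn p - ε0))) := by gcongr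
        _ ≤ (((L : ℝ) + 1) ^ Fintype.card A * ((L + 1) ^ 2 * (Fintype.card A) ^ 2) * Real.exp (L * (Hn p - 2 * ε0))) * Real.exp (-(L * (Hn p - ε0))) := by
          gcongr; linarith
        _ = (Fintype.card A : ℝ) ^ 2 * ((L : ℝ) + 1) ^ (Fintype.card A + 2) * (Real.exp (L * (Hn p - 2 * ε0)) * Real.exp (-(L * (Hn p - ε0)))) := by ring
        _ = (Fintype.card A : ℝ) ^ 2 * ((L : ℝ) + 1) ^ (Fintype.card A + 2) * Real.exp (-(L * ε0)) := by
          rw [← Real.exp_add]; congr 2; ring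
        _ ≤ δ / 3 := h2.le
    linarith
  have hc := probReal_compl_eq_one_sub (μ := P) hm
  have : {x : ℤ → A | W.Gd (wd L x 0)}ᶜ = {x : ℤ → A | ¬ W.Gd (wd L x 0)} := rfl
  rw [this] at hc
  linarith

end
end NOF

open MeasureTheory Filter Set Topology ENNReal
set_option linter.unusedSectionVars false
set_option linter.unusedVariables false
set_option linter.unusedSimpArgs false

namespace NOF

theorem perm_ext {S U : Type*} [Finite U] (i1 i2 : S → U) (h1 : Function.Injective i1) (h2 : Function.Injective i2) :
    ∃ σ : Equiv.Perm U, ∀ s, σ (i1 s) = i2 s := by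
  classical
  have := Fintype.ofFinite U
  let e : {x // x ∈ range i1} ≃ {x // x ∈ range i2} := (Equiv.ofInjective i1 h1).symm.trans (Equiv.ofInjective i2 h2)
  refine ⟨e.extendSubtype, fun s => ?_⟩
  rw [e.extendSubtype_apply_of_mem _ (mem_range_self s)]
  have : (⟨i1 s, mem_range_self s⟩ : {x // x ∈ range i1}) = Equiv.ofInjective i1 h1 s := rfl
  rw [this]
  simp [e]

open Classical in
theorem tab_comb (X Y O : Type*) [Fintype X] [Fintype Y] [Fintype O] [Nonempty X] [Nonempty Y] [DecidableEq O] (f : Y → O) :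
    ∃ (σ : Equiv.Perm (X × Y)) (Fl : X → Prop), (∀ v, ¬ Fl v → ∀ t t', f (σ (v, t)).2 = f (σ (v, t')).2) ∧
      ∀ D : Finset O, ((Finset.univ.filter Fl).card : ℝ) ≤ Fintype.card X -
        ∑ y ∈ D, ((Fintype.card X : ℝ) * ((Finset.univ.filter (fun t => f t = y)).card : ℝ) / Fintype.card Y - 1) := by
  set w : O → ℕ := fun y => (Finset.univ.filter (fun t => f t = y)).card with hw
  have hY : 0 < Fintype.card Y := Fintype.card_pos
  have hY' : (0 : ℝ) < Fintype.card Y := by exact_mod_cast hY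
  set cc : O → ℕ := fun y => Fintype.card X * w y / Fintype.card Y with hcc
  have hcY : ∀ y, cc y * Fintype.card Y ≤ Fintype.card X * w y := fun y => Nat.div_mul_le_self _ _
  have hwsum : ∑ y, w y = Fintype.card Y := by
    simp only [hw]
    rw [← Finset.card_univ, Finset.card_eq_sum_card_fiberwise (f := f) (t := Finset.univ) (by simp)]
  have hsum : ∑ y, cc y ≤ Fintype.card X := by
    have : (∑ y, cc y) * Fintype.card Y ≤ Fintype.card X * Fintype.card Y := by
      rw [Finset.sum_mul]
      refine (Finset.sum_le_sum fun y _ => hcY y).trans ?_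
      rw [← Finset.mul_sum, hwsum]
    exact Nat.le_of_mul_le_mul_right this hY
  obtain ⟨ι⟩ : Nonempty ((Σ y, Fin (cc y)) ↪ X) := by
    apply Function.Embedding.nonempty_of_card_le
    simpa using hsum
  have he : ∀ y, Nonempty ((Fin (cc y) × Y) ↪ {z : X × Y // f z.2 = y}) := by
    intro y
    apply Function.Embedding.nonempty_of_card_le
    have : Fintype.card {z : X × Y // f z.2 = y} = Fintype.card X * w y := by
      rw [Fintype.card_subtype]
      have : Finset.univ.filter (fun z : X × Y => f z.2 = y) = Finset.univ ×ˢ (Finset.univ.filter (fun t => f t = y)) := by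
        ext z; simp
      rw [this, Finset.card_product, Finset.card_univ]
    rw [this]
    simpa using hcY y
  set e := fun y => (he y).some
  obtain ⟨σ, hσ⟩ := perm_ext (S := (Σ y, Fin (cc y)) × Y) (U := X × Y) (fun s => (ι s.1, s.2)) (fun s => (e s.1.1 (s.1.2, s.2)).1) (by
      rintro ⟨s, t⟩ ⟨s', t'⟩ h
      simp only [Prod.mk.injEq] at h
      rw [ι.injective h.1, h.2]) (by
      rintro ⟨⟨y, k⟩, t⟩ ⟨⟨y', k'⟩, t'⟩ h
      simp only at h
      have hy : y = y' := by
        rw [← (e y (k, t)).2, ← (e y' (k', t')).2, h]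
      subst hy
      have := (e y).injective (Subtype.ext h)
      simp only [Prod.mk.injEq] at this
      rw [this.1, this.2])
  refine ⟨σ, fun v => v ∉ range ι, ?_, ?_⟩
  · intro v hv t t'
    rw [not_not] at hv
    obtain ⟨s, rfl⟩ := hv
    have a1 := hσ (s, t)
    have a2 := hσ (s, t')
    simp only at a1 a2
    rw [a1, a2, (e s.1 (s.2, t)).2, (e s.1 (s.2, t')).2]
  · intro D
    have h1 : (Finset.univ.filter (fun v => v ∉ range ι)).card + ∑ y, cc y = Fintype.card X := by
      have : ∑ y, cc y = (Finset.univ.filter (fun v => v ∈ range ι)).card := by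
        have h2 : (Finset.univ.filter (fun v => v ∈ range ι)) = Finset.univ.map ι := by
          ext v; simp
        rw [h2, Finset.card_map]; simp
      rw [this, add_comm, Finset.card_filter_add_card_filter_not, Finset.card_univ]
    have h2 : ((Finset.univ.filter (fun v => v ∉ range ι)).card : ℝ) = Fintype.card X - ∑ y, (cc y : ℝ) := by
      rw [eq_sub_iff_add_eq]; exact_mod_cast h1
    refine le_trans (b := (Fintype.card X : ℝ) - ∑ y, (cc y : ℝ)) (le_of_eq (by convert h2)) ?_
    apply sub_le_sub_left
    calc ∑ y ∈ D, ((Fintype.card X : ℝ) * (w y : ℝ) / Fintype.card Y - 1) ≤ ∑ y ∈ D, (cc y : ℝ) := by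
          apply Finset.sum_le_sum
          intro y _
          have : Fintype.card X * w y < (cc y + 1) * Fintype.card Y := Nat.lt_mul_of_div_lt (Nat.lt_succ_self (cc y)) hY
          have h3 : (Fintype.card X : ℝ) * w y < ((cc y : ℝ) + 1) * Fintype.card Y := by exact_mod_cast this
          rw [sub_le_iff_le_add, div_le_iff₀ hY']
          exact h3.le
      _ ≤ ∑ y, (cc y : ℝ) := Finset.sum_le_sum_of_subset_of_nonneg (Finset.subset_univ _) fun _ _ _ => by positivity

open Classical in
theorem exists_Tab {N m : ℕ} [NeZero N] (β : ZMod N → Fin m) {q : Fin m → ℝ}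
    (hq : ∀ b, q b = ((Finset.univ.filter (fun a => β a = b)).card : ℝ) / N) (hq0 : ∀ b, 0 < q b) (hqp : IsProbVecC q)
    (ε0 η : ℝ) (hε0 : 0 < ε0) (hη : 0 < η) :
    ∀ᶠ L : ℕ in atTop, ∀ g1 g2 : ℕ, g2 + g1 ≤ L → Real.exp (L * (Hn q + 2 * ε0)) ≤ (N : ℝ) ^ g1 →
      ∃ B : Tab L g1 g2 N m, B.β = β ∧ ((Finset.univ.filter B.Fl).card : ℝ) ≤ η * (N : ℝ) ^ g1 := by
  have t2 := (poly_exp 1 0 ε0 hε0).eventually (gt_mem_nhds (show 0 < η / 2 by positivity))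
  filter_upwards [t2, aep hqp hq0 ε0 (η / 2) hε0 (by positivity)] with L h2 h3 g1 g2 hgL hN
  have hNpos : (0 : ℝ) < N := by exact_mod_cast Nat.pos_of_ne_zero (NeZero.ne N)
  obtain ⟨σ, Fl, hc, hcard⟩ := tab_comb (Fin g1 → ZMod N) (Fin L → ZMod N) (Fin L → Fin m) (fun t i => β (t i))
  let vv : (Fin L → ZMod N × ZMod N) → (Fin g1 → ZMod N) := fun w k => (w ⟨g2 + k, by omega⟩).1
  let tt : (Fin L → ZMod N × ZMod N) → (Fin L → ZMod N) := fun w k => (w k).2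
  let pf : (Fin L → ZMod N × ZMod N) → (Fin L → ZMod N × ZMod N) := fun w k =>
    (if h : g2 ≤ k ∧ k < g2 + g1 then (σ (vv w, tt w)).1 ⟨k - g2, by omega⟩ else (w k).1, (σ (vv w, tt w)).2 k)
  have hpf : Function.Injective pf := by
    intro w w' h
    have e1 : (σ (vv w, tt w)).2 = (σ (vv w', tt w')).2 := by
      funext k; exact congrArg Prod.snd (congrFun h k)
    have e2 : (σ (vv w, tt w)).1 = (σ (vv w', tt w')).1 := by
      funext k
      have := congrArg Prod.fst (congrFun h ⟨g2 + k, by omega⟩)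
      simp only [pf] at this
      rw [dif_pos (by omega), dif_pos (by omega)] at this
      simpa using this
    have e3 := σ.injective (Prod.ext e2 e1)
    simp only [Prod.mk.injEq] at e3
    funext k
    apply Prod.ext
    · by_cases hk : g2 ≤ k ∧ k < g2 + g1
      · have := congrFun e3.1 ⟨k - g2, by omega⟩
        simp only [vv] at this
        have hkk : (⟨g2 + (k - g2), by omega⟩ : Fin L) = k := Fin.ext (by simp; omega)
        rwa [hkk] at this
      · have := congrArg Prod.fst (congrFun h k)
        simp only [pf] at this
        rwa [dif_neg hk, dif_neg hk] at this
    · exact congrFun e3.2 k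
  let B : Tab L g1 g2 N m :=
    { out := fun v t i => β ((σ (v, t)).2 i)
      Fl := Fl
      β := β
      hL := hgL
      const := hc
      hpp := ⟨Equiv.ofBijective pf (Finite.injective_iff_bijective.1 hpf), fun w i => rfl⟩ }
  refine ⟨B, rfl, ?_⟩
  have hwq : ∀ y : Fin L → Fin m, ((Finset.univ.filter (fun t : Fin L → ZMod N => (fun i => β (t i)) = y)).card : ℝ) / (N : ℝ) ^ L = ∏ i, q (y i) := by
    intro y
    have : (Finset.univ.filter (fun t : Fin L → ZMod N => (fun i => β (t i)) = y)) =
        Fintype.piFinset (fun i => Finset.univ.filter (fun a => β a = y i)) := by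
      ext t; simp [funext_iff]
    rw [this, Fintype.card_piFinset]
    simp only [hq]
    rw [Finset.prod_div_distrib]
    simp
  set D : Finset (Fin L → Fin m) := Finset.univ.filter (fun y => ¬ (L * ε0 ≤ |-Real.log (∏ i, q (y i)) - L * Hn q|)) with hD
  have hne : Nonempty (Fin m) := ⟨β 0⟩
  obtain ⟨P, hP⟩ := exists_prod (fun _ : ℤ => q) (fun _ => hqp)
  have hPp := prod_prob hP hne
  have hbad := h3 P hPp hP
  rw [word_prob hqp hP L (fun u => L * ε0 ≤ |-Real.log (∏ i, q (u i)) - L * Hn q|)] at hbad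
  have hall : ∑ u : Fin L → Fin m, ∏ i, q (u i) = 1 := by
    have := word_prob hqp hP L (fun u => True)
    simpa using this.symm
  have hgoodp : 1 - η / 2 ≤ ∑ y ∈ D, ∏ i, q (y i) := by
    have := Finset.sum_filter_add_sum_filter_not Finset.univ (fun u : Fin L → Fin m => L * ε0 ≤ |-Real.log (∏ i, q (u i)) - L * Hn q|) (fun u => ∏ i, q (u i))
    rw [hall] at this
    linarith
  have hDcard : (D.card : ℝ) ≤ Real.exp (L * (Hn q + ε0)) := by
    have h4 : ∀ y ∈ D, Real.exp (-(L * (Hn q + ε0))) ≤ ∏ i, q (y i) := by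
      intro y hy
      have hy' := (Finset.mem_filter.1 hy).2
      rw [not_le, abs_lt] at hy'
      have hpos : 0 < ∏ i, q (y i) := Finset.prod_pos fun i _ => hq0 _
      rw [← Real.le_log_iff_exp_le hpos]
      linarith
    have h5 := Finset.card_nsmul_le_sum _ _ _ h4
    have h6 : ∑ y ∈ D, ∏ i, q (y i) ≤ 1 := by
      rw [← hall]
      exact Finset.sum_le_sum_of_subset_of_nonneg (Finset.subset_univ _) fun y _ _ => Finset.prod_nonneg fun i _ => (hq0 _).le
    rw [nsmul_eq_mul, Real.exp_neg] at h5
    have := h5.trans h6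
    rwa [← div_eq_mul_inv, div_le_one (Real.exp_pos _)] at this
  have := hcard D
  refine this.trans ?_
  simp only [Fintype.card_fun, Fintype.card_fin, ZMod.card, Nat.cast_pow]
  have e5 : ∑ y ∈ D, ((N : ℝ) ^ g1 * ((Finset.univ.filter (fun t : Fin L → ZMod N => (fun i => β (t i)) = y)).card : ℝ) / (N : ℝ) ^ L - 1)
      = (N : ℝ) ^ g1 * ∑ y ∈ D, ∏ i, q (y i) - D.card := by
    rw [Finset.sum_sub_distrib, Finset.mul_sum]
    simp only [mul_div_assoc, hwq]
    simp
  rw [e5]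
  have hX : (0 : ℝ) < (N : ℝ) ^ g1 := by positivity
  have e6 : (D.card : ℝ) ≤ η / 2 * (N : ℝ) ^ g1 := by
    calc (D.card : ℝ) ≤ Real.exp (L * (Hn q + ε0)) := hDcard
      _ = Real.exp (-(L * ε0)) * Real.exp (L * (Hn q + 2 * ε0)) := by rw [← Real.exp_add]; congr 1; ring
      _ ≤ η / 2 * (N : ℝ) ^ g1 := by
        apply mul_le_mul _ hN (Real.exp_pos _).le (by positivity)
        simpa using h2.le
  nlinarith [mul_le_mul_of_nonneg_left hgoodp hX.le]

end NOF

open MeasureTheory Filter Set Topology ENNReal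
set_option linter.unusedSectionVars false
set_option linter.unusedVariables false
set_option linter.unusedSimpArgs false

namespace NOF

theorem exists_beta {m N : ℕ} [NeZero N] (cnt : Fin m → ℕ) (h : ∑ b, cnt b = N) :
    ∃ β : ZMod N → Fin m, ∀ b, (Finset.univ.filter (fun a => β a = b)).card = cnt b := by
  classical
  have e : Fintype.card (ZMod N) = Fintype.card (Σ b, Fin (cnt b)) := by simp [ZMod.card, h]
  let f := Fintype.equivOfCardEq e
  refine ⟨fun a => (f a).1, fun b => ?_⟩
  have h1 : (Finset.univ.filter (fun a => (f a).1 = b)) = (Finset.univ : Finset (Fin (cnt b))).image (fun i => f.symm ⟨b, i⟩) := by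
    ext a
    simp only [Finset.mem_filter, Finset.mem_univ, true_and, Finset.mem_image]
    constructor
    · rintro rfl
      exact ⟨(f a).2, by simp⟩
    · rintro ⟨i, rfl⟩; simp
  rw [h1, Finset.card_image_of_injective]
  · simp
  · intro i j hij
    have := f.symm.injective hij
    simpa using this

theorem exists_q (α h : ℝ) (hα : 0 ≤ α) (hlt : α < h) (c : ℕ) (hc : 0 < c) :
    ∃ (N m : ℕ) (_ : NeZero N) (β : ZMod N → Fin m) (q : Fin m → ℝ), c ≤ N ∧ 
      (∀ b, q b = ((Finset.univ.filter (fun a => β a = b)).card : ℝ) / N) ∧ (∀ b, 0 < q b) ∧ IsProbVecC q ∧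
      α < Hn q ∧ Hn q < h := by
  obtain ⟨k, hk⟩ := exists_nat_gt (Real.exp h)
  have hK : h < Real.log ((k : ℝ) + 1) := by
    rw [Real.lt_log_iff_exp_lt (by positivity)]; linarith
  have hK0 : (0 : ℝ) < (k : ℝ) + 1 := by positivity
  set qq : ℝ → Fin (k + 1) → ℝ := fun s b => s / (k + 1) + if b = 0 then 1 - s else 0 with hqq
  set F : ℝ → ℝ := fun s => ∑ b, Real.negMulLog (qq s b) with hF
  have hFc : Continuous F := by
    apply continuous_finsetSum
    intro b _
    apply Real.continuous_negMulLog.comp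
    simp only [hqq]
    split_ifs
    · fun_prop
    · fun_prop
  have hF0 : F 0 = 0 := by
    simp only [hF, hqq]
    apply Finset.sum_eq_zero
    intro b _
    split_ifs <;> simp
  have hF1 : F 1 = Real.log ((k : ℝ) + 1) := by
    simp only [hF, hqq, sub_self, ite_self, add_zero]
    simp only [Finset.sum_const, Finset.card_univ, Fintype.card_fin, nsmul_eq_mul, Real.negMulLog, one_div, Real.log_inv]
    push_cast
    field_simp
  have hiv := intermediate_value_Ioo (zero_le_one (α := ℝ)) hFc.continuousOn
  obtain ⟨s0, hs0, hs0'⟩ := hiv (show (α + h) / 2 ∈ Ioo (F 0) (F 1) by rw [hF0, hF1]; constructor <;> linarith)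
  have hop : IsOpen (Ioo (0 : ℝ) 1 ∩ F ⁻¹' Ioo α h) := isOpen_Ioo.inter (isOpen_Ioo.preimage hFc)
  obtain ⟨s, hs⟩ := Rat.denseRange_cast.exists_mem_open hop ⟨s0, hs0, by rw [mem_preimage, hs0']; constructor <;> linarith⟩
  obtain ⟨⟨hs1, hs2⟩, hs3, hs4⟩ := hs
  have hs1' : 0 < s := by exact_mod_cast hs1
  have hs2' : s < 1 := by exact_mod_cast hs2
  obtain ⟨r, n, hr, hrn, hsr⟩ : ∃ r n : ℕ, 0 < r ∧ r < n ∧ (s : ℝ) = (r : ℝ) / n := by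
    have hn := Rat.num_pos.2 hs1'
    obtain ⟨r, hr⟩ := Int.eq_ofNat_of_zero_le hn.le
    have hsd : (s : ℝ) = (r : ℝ) / s.den := by
      have := Rat.num_div_den s
      rw [hr] at this
      have h2 := congrArg (fun t : ℚ => (t : ℝ)) this
      push_cast at h2
      exact h2.symm
    refine ⟨r, s.den, by omega, ?_, hsd⟩
    have hd : (0 : ℝ) < s.den := by exact_mod_cast s.den_pos
    rw [hsd, div_lt_one hd] at hs2
    exact_mod_cast hs2
  have hn0 : 0 < n := by omega
  have hNpos : 0 < n * (k + 1) * c := by positivity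
  have hNz : NeZero (n * (k + 1) * c) := ⟨hNpos.ne'⟩
  obtain ⟨β, hβ⟩ := exists_beta (N := n * (k + 1) * c) (fun b : Fin (k + 1) => r * c + if b = 0 then (n - r) * (k + 1) * c else 0) (by
    rw [Finset.sum_add_distrib]
    simp
    obtain ⟨d, rfl⟩ := Nat.exists_eq_add_of_lt hrn
    have : r + d + 1 - r = d + 1 := by omega
    rw [this]; ring)
  have hqe : ∀ b, qq s b = ((Finset.univ.filter (fun a => β a = b)).card : ℝ) / (n * (k + 1) * c : ℕ) := by
    intro b
    rw [hβ]
    simp only [hqq, hsr]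
    have hn' : (0 : ℝ) < n := by exact_mod_cast hn0
    have hc' : (0 : ℝ) < c := by exact_mod_cast hc
    split_ifs
    · push_cast [Nat.cast_sub hrn.le]; field_simp
    · push_cast; field_simp; ring
  have hpos : ∀ b, 0 < qq s b := by
    intro b
    simp only [hqq]
    have : 0 < (s : ℝ) / (k + 1) := by positivity
    split_ifs
    · linarith
    · linarith
  have hH : Hn (qq s) = F s := by
    simp only [Hn, hF, Real.negMulLog]
    apply Finset.sum_congr rfl; intro b _; ring
  refine ⟨n * (k + 1) * c, k + 1, hNz, β, qq s, ?_, hqe, hpos, ⟨fun b => (hpos b).le, ?_⟩, ?_, ?_⟩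
  · exact Nat.le_mul_of_pos_left _ (by positivity)
  · have : ∑ b, qq s b = 1 := by
      simp only [hqq]
      rw [Finset.sum_add_distrib]
      simp
      field_simp
      ring
    rw [← this]
    exact hasSum_fintype _
  · rw [hH]; exact hs3
  · rw [hH]; exact hs4

section
variable {A : Type*} [Fintype A] [MeasurableSpace A] [MeasurableSingletonClass A]

theorem fin_core {μ : Measure (ℤ → A)} [IsProbabilityMeasure μ] {ρ : ℤ → A → ℝ} {p : A → ℝ}
    (hμ : IsProductMeasure μ ρ) (hρ : ∀ i, IsProbVecC (ρ i))
    (hp : IsProbVecC p) (hp0 : ∀ a, 0 < p a) (hlim : ∀ a, Tendsto (fun i : ℤ => ρ i a) atTop (𝓝 (p a)))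
    (hac : ∀ (L g N : ℕ) (_ : NeZero N) (Q : Sys A L g N) c, μ.map (Q.T c) ≪ μ)
    (a b : A) (hab : b ≠ a) (α : ℝ) (hα : 0 ≤ α) (hαp : α < Hn p) :
    ∃ (m : ℕ) (q : Fin m → ℝ), (∀ b, 0 < q b) ∧ IsProbVecC q ∧ α < Hn q ∧
      ∀ ν : Measure (ℤ → Fin m), IsProductMeasure ν (fun _ => q) →
      ∃ φ : (ℤ → A) → (ℤ → Fin m), Measurable φ ∧ (∀ x k z, φ (fun j => x (j + k)) z = φ x (z + k)) ∧
      MeasEquiv (μ.map φ) ν ∧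
      ∀ᵐ x ∂μ, ∃ n : ℕ, ∀ x', (∀ i : ℤ, -n ≤ i → i ≤ n → x' i = x i) → φ x' 0 = φ x 0 := by
  classical
  have hcard : 2 ≤ Fintype.card A := Fintype.one_lt_card_iff.2 ⟨b, a, hab⟩
  obtain ⟨N, m, hNz, β, q, hcN, hqe, hq0, hqp, hαq, hqh⟩ := exists_q α (Hn p) hα hαp (Fintype.card A) (by omega)
  refine ⟨m, q, hq0, hqp, hαq, fun ν hν => ?_⟩
  have hN1 : (1 : ℝ) < N := by
    have : 1 < N := by omega
    exact_mod_cast this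
  have hlN : 0 < Real.log N := Real.log_pos hN1
  have hplN : Hn p ≤ Real.log N := (Hn_le hp hp0).trans (Real.log_le_log (by positivity) (by exact_mod_cast hcN))
  have hq00 : 0 < Hn q := lt_of_le_of_lt hα hαq
  obtain ⟨ε0, hε⟩ : ∃ ε0, ε0 = (Hn p - Hn q) / 10 := ⟨_, rfl⟩
  have hε0 : 0 < ε0 := by rw [hε]; linarith
  obtain ⟨δ, hδ⟩ : ∃ δ, δ = min 1 (5 * ε0 / Real.log N) := ⟨_, rfl⟩
  have hδ0 : 0 < δ := by rw [hδ]; exact lt_min one_pos (by positivity)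
  have hδ1 : δ ≤ 1 := by rw [hδ]; exact min_le_left _ _
  have hδ2 : δ * Real.log N ≤ 5 * ε0 := by
    have : δ ≤ 5 * ε0 / Real.log N := by rw [hδ]; exact min_le_right _ _
    rwa [le_div_iff₀ hlN] at this
  have hs : ∑ a, p a = 1 := (hasSum_fintype p).unique hp.2
  have hpa : p a < 1 := by
    have h1 := Finset.sum_le_sum_of_subset_of_nonneg (f := p) (Finset.subset_univ {a, b}) (fun i _ _ => hp.1 i)
    rw [Finset.sum_pair hab.symm, hs] at h1
    linarith [hp0 b]
  have t1 := (tendsto_pow_const_mul_const_pow_of_lt_one 2 (hp.1 a) hpa).eventually (gt_mem_nhds (show 0 < δ / 16 by positivity))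
  have t2 : ∀ᶠ L : ℕ in atTop, 2 * Real.log N / ε0 ≤ L := tendsto_natCast_atTop_atTop.eventually_ge_atTop _
  obtain ⟨L, hWS, hTab, h1, h2, hL0⟩ := ((exists_WS a hp hp0 hpa N ε0 (δ / 16) hε0 (by positivity)).and
    ((exists_Tab β hqe hq0 hqp ε0 (δ / 4) hε0 (by positivity)).and (t1.and (t2.and (eventually_gt_atTop 0))))).exists
  have hL' : (0 : ℝ) < L := by exact_mod_cast hL0
  rw [div_le_iff₀ hε0] at h2
  obtain ⟨g, hg⟩ : ∃ g, g = ⌊L * (Hn p - 2 * ε0) / Real.log N⌋₊ := ⟨_, rfl⟩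
  obtain ⟨g1, hg1⟩ : ∃ g1, g1 = ⌈L * (Hn q + 2 * ε0) / Real.log N⌉₊ := ⟨_, rfl⟩
  have n1 : (g : ℝ) ≤ L * (Hn p - 2 * ε0) / Real.log N := by
    rw [hg]; apply Nat.floor_le
    have : 0 ≤ Hn p - 2 * ε0 := by rw [hε]; linarith
    positivity
  have n2 : L * (Hn p - 2 * ε0) / Real.log N < g + 1 := by rw [hg]; exact Nat.lt_floor_add_one _
  have n3 : L * (Hn q + 2 * ε0) / Real.log N ≤ g1 := by rw [hg1]; exact Nat.le_ceil _
  have n4 : (g1 : ℝ) < L * (Hn q + 2 * ε0) / Real.log N + 1 := by rw [hg1]; apply Nat.ceil_lt_add_one; positivity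
  rw [le_div_iff₀ hlN] at n1
  rw [div_lt_iff₀ hlN] at n2
  rw [div_le_iff₀ hlN] at n3
  rw [← sub_lt_iff_lt_add, lt_div_iff₀ hlN] at n4
  have n5 : (δ * L : ℝ) * Real.log N ≤ ((g : ℝ) - g1) * Real.log N := by nlinarith
  have n6 : δ * L ≤ (g : ℝ) - g1 := le_of_mul_le_mul_right n5 hlN
  have hgg : g1 ≤ g := by
    have : (0 : ℝ) < δ * L := by positivity
    have : (g1 : ℝ) ≤ g := by linarith
    exact_mod_cast this
  obtain ⟨g2, rfl⟩ := Nat.exists_eq_add_of_le' hgg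
  push_cast at n6
  have n7 : δ * L ≤ g2 := by linarith
  have hgL : g2 + g1 ≤ L := by
    have : (((g2 + g1 : ℕ) : ℝ)) * Real.log N ≤ L * Real.log N := by
      refine n1.trans ?_
      apply mul_le_mul_of_nonneg_left _ hL'.le
      linarith
    exact_mod_cast le_of_mul_le_mul_right this hlN
  obtain ⟨W, hW⟩ := hWS (g2 + g1) hgL (by
    rw [← Real.rpow_natCast, Real.rpow_def_of_pos (by linarith), Real.exp_le_exp]
    linarith)
  obtain ⟨B, hBβ, hB⟩ := hTab g1 g2 hgL (by
    rw [← Real.rpow_natCast, Real.rpow_def_of_pos (by linarith), Real.exp_le_exp]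
    linarith)
  have hne : Nonempty A := ⟨a⟩
  obtain ⟨P, hP⟩ := exists_prod (fun _ : ℤ => p) (fun _ => hp)
  have hPp := prod_prob hP hne
  have hW' := hW P hPp hP
  obtain ⟨K, hK⟩ := W.dens hp hp0 hP b hab hL0 (δ / 16) (by positivity)
  set π := P.real {x | (W.toSys K).InJ x 0} with hπ
  have hLπ : 1 - δ / 4 ≤ L * π := by nlinarith
  have hgood : ∀ᵐ x ∂μ, (W.toSys K).Good B x := by
    refine Sys.good_ae (W.toSys K) B hμ hP hρ hp hp0 hlim (η := δ / 4) ?_ ?_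
    · convert hB
    · rw [← hπ]
      have hπ0 : 0 ≤ π := measureReal_nonneg
      have : δ * L * π ≤ g2 * π := mul_le_mul_of_nonneg_right n7 hπ0
      nlinarith
  refine Sys.core (W.toSys K) B (hac L (g2 + g1) N hNz _) hgood ?_
  rw [hBβ]
  have : (fun (_ : ℤ) (b : Fin m) => ((Finset.univ.filter (fun a => β a = b)).card : ℝ) / N) = fun _ => q := by
    funext _ b; rw [hqe]
  rw [this]
  exact hν

end
end NOF

open MeasureTheory Filter Set Topology ENNReal
set_option linter.unusedSectionVars false
set_option linter.unusedVariables false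
set_option linter.unusedSimpArgs false

namespace NOF
open ProbabilityTheory

section l2
variable {A : Type*} [Countable A] [MeasurableSpace A] [MeasurableSingletonClass A]

theorem coord_real {μ : Measure (ℤ → A)} {ρ : ℤ → A → ℝ} (hμ : IsProductMeasure μ ρ)
    (i : ℤ) (a : A) : μ {x | x i = a} = ENNReal.ofReal (ρ i a) := by
  have := hμ {i} (fun _ => a)
  simpa [_root_.cylinder] using this

theorem cheb2 {μ : Measure (ℤ → A)} {ρ : ℤ → A → ℝ} (hμ : IsProductMeasure μ ρ)
    (hρ : ∀ i, IsProbVecC (ρ i)) (a : A) (d : ℤ → ℝ) (s : Finset ℤ)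
    (hV : 0 < ∑ i ∈ s, d i ^ 2) :
    μ {x | (∑ i ∈ s, d i ^ 2) / 2 ≤ |∑ i ∈ s, d i * ({x : ℤ → A | x i = a}.indicator 1 x) - ∑ i ∈ s, d i * ρ i a|}
      ≤ ENNReal.ofReal (4 / ∑ i ∈ s, d i ^ 2) := by
  have hP := prod_prob hμ ⟨a⟩
  set V := ∑ i ∈ s, d i ^ 2 with hVd
  set X : ℤ → (ℤ → A) → ℝ := fun i x => d i * ({x : ℤ → A | x i = a}.indicator 1 x) with hX
  have hms : ∀ i : ℤ, MeasurableSet {x : ℤ → A | x i = a} := fun i =>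
    (measurable_pi_apply i : Measurable fun x : ℤ → A => x i) (measurableSet_singleton a)
  have hm : ∀ i, Measurable (X i) := fun i =>
    (measurable_one.indicator (hms i)).const_mul _
  have hb : ∀ i x, |X i x| ≤ |d i| := by
    intro i x
    simp only [hX, abs_mul]
    by_cases h : x ∈ {x : ℤ → A | x i = a}
    · simp [indicator_of_mem h]
    · simp [indicator_of_notMem h]
  have hL : ∀ i, MemLp (X i) 2 μ := fun i => memLp_bdd (hm i) (hb i)
  have hS : MemLp (fun x => ∑ i ∈ s, X i x) 2 μ := memLp_finsetSum _ fun k _ => hL k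
  have hXint : ∀ i, ∫ x, X i x ∂μ = d i * ρ i a := by
    intro i
    simp only [hX]
    rw [integral_const_mul, integral_indicator_one (hms i), Measure.real, coord_real hμ,
      ENNReal.toReal_ofReal ((hρ i).1 a)]
  have h2 : ∫ x, ∑ k ∈ s, X k x ∂μ = ∑ k ∈ s, d k * ρ k a := by
    rw [integral_finsetSum _ fun k _ => (hL k).integrable (by norm_num)]
    simp only [hXint]
  have h1 := meas_ge_le_variance_div_sq hS (c := V / 2) (by positivity)
  rw [h2] at h1
  refine h1.trans ?_
  apply ENNReal.ofReal_le_ofReal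
  have hv : variance (fun x => ∑ i ∈ s, X i x) μ ≤ V := by
    have he : (fun x => ∑ i ∈ s, X i x) = ∑ i ∈ s, X i := by ext x; simp
    rw [he, IndepFun.variance_sum (fun i _ => hL i)]
    · apply Finset.sum_le_sum
      intro i _
      refine (variance_le_expectation_sq (hm i).aestronglyMeasurable).trans ?_
      have : ∫ x, (X i ^ 2) x ∂μ ≤ ∫ x, d i ^ 2 ∂μ := by
        apply integral_mono_of_nonneg
        · exact Filter.Eventually.of_forall fun x => by simp [sq_nonneg]
        · exact integrable_const _
        · exact Filter.Eventually.of_forall fun x => by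
            simp only [Pi.pow_apply]
            exact sq_le_sq.2 (hb i x)
      simpa using this
    · intro i _ j _ hij
      apply indep_dep hμ hρ ⟨a⟩ {i} {j} (by simpa using hij)
      · intro x x' h
        have := h i (by simp)
        classical
        simp only [hX, indicator_apply, mem_ofPred_eq, this, Pi.one_apply]
      · intro x x' h
        have := h j (by simp)
        classical
        simp only [hX, indicator_apply, mem_ofPred_eq, this, Pi.one_apply]
  calc _ ≤ V / (V / 2) ^ 2 := by gcongr
    _ = 4 / V := by field_simp; norm_num

theorem l2_of_ac {μ ν : Measure (ℤ → A)} {ρ σ : ℤ → A → ℝ} (hμ : IsProductMeasure μ ρ)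
    (hν : IsProductMeasure ν σ) (hρ : ∀ i, IsProbVecC (ρ i)) (hσ : ∀ i, IsProbVecC (σ i))
    (hac : ν ≪ μ) (a : A) : Summable (fun i => (σ i a - ρ i a) ^ 2) := by
  by_contra hns
  have hPν := prod_prob hν ⟨a⟩
  set d : ℤ → ℝ := fun i => σ i a - ρ i a with hd
  have hbig : ∀ c : ℝ, ∃ s : Finset ℤ, c < ∑ i ∈ s, d i ^ 2 := by
    intro c
    by_contra hc
    push Not at hc
    exact hns (summable_of_sum_le (fun i => sq_nonneg _) hc)
  choose s hs using fun n : ℕ => hbig (4 * 2 ^ n)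
  set V : ℕ → ℝ := fun n => ∑ i ∈ s n, d i ^ 2 with hV
  have hV0 : ∀ n, 0 < V n := fun n => lt_trans (by positivity) (hs n)
  set Y : ℕ → (ℤ → A) → ℝ := fun n x => ∑ i ∈ s n, d i * ({x : ℤ → A | x i = a}.indicator 1 x) with hY
  set E : ℕ → Set (ℤ → A) := fun n => {x | ∑ i ∈ s n, d i * ρ i a + V n / 2 ≤ Y n x} with hE
  have hle : ∀ n, ENNReal.ofReal (4 / V n) ≤ ENNReal.ofReal ((1 / 2) ^ n) := by
    intro n
    apply ENNReal.ofReal_le_ofReal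
    rw [div_le_iff₀ (hV0 n)]
    have := hs n
    have h2 : (1 / 2 : ℝ) ^ n * 2 ^ n = 1 := by rw [← mul_pow]; norm_num
    have h3 : (0 : ℝ) < (1 / 2) ^ n := by positivity
    nlinarith [mul_lt_mul_of_pos_left this h3]
  have hEμ : ∀ n, μ (E n) ≤ ENNReal.ofReal ((1 / 2) ^ n) := by
    intro n
    refine (measure_mono ?_).trans ((cheb2 hμ hρ a d (s n) (hV0 n)).trans (hle n))
    intro x hx
    simp only [hE, hY, mem_ofPred_eq] at hx ⊢
    refine le_trans ?_ (le_abs_self _)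
    linarith
  have hEν : ∀ n, ν (E n)ᶜ ≤ ENNReal.ofReal ((1 / 2) ^ n) := by
    intro n
    refine (measure_mono ?_).trans ((cheb2 hν hσ a d (s n) (hV0 n)).trans (hle n))
    intro x hx
    simp only [hE, hY, mem_compl_iff, mem_ofPred_eq, not_le] at hx ⊢
    refine le_trans ?_ (neg_le_abs _)
    have : ∑ i ∈ s n, d i * σ i a = ∑ i ∈ s n, d i * ρ i a + V n := by
      simp only [hV, ← Finset.sum_add_distrib, hd]
      apply Finset.sum_congr rfl; intro i _; ring
    rw [this]
    simp only [hV] at hx ⊢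
    linarith
  have hsum : ∑' n : ℕ, ENNReal.ofReal ((1 / 2 : ℝ) ^ n) ≠ ∞ := by
    rw [← ENNReal.ofReal_tsum_of_nonneg (fun n => by positivity) (summable_geometric_of_lt_one (by norm_num) (by norm_num))]
    exact ENNReal.ofReal_ne_top
  have h1 : ∀ᵐ x ∂μ, ∀ᶠ n in atTop, x ∉ E n :=
    ae_eventually_notMem (ne_top_of_le_ne_top hsum (ENNReal.tsum_le_tsum hEμ))
  have h2 : ∀ᵐ x ∂ν, ∀ᶠ n in atTop, x ∉ (E n)ᶜ :=
    ae_eventually_notMem (ne_top_of_le_ne_top hsum (ENNReal.tsum_le_tsum hEν))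
  have h3 := hac.ae_le h1
  have : ∀ᵐ x ∂ν, False := by
    filter_upwards [h2, h3] with x hx hx'
    obtain ⟨n, hn1, hn2⟩ := (hx.and hx').exists
    exact hn1 hn2
  simp at this
  exact (IsProbabilityMeasure.ne_zero ν) this

end l2

section finite
variable {A : Type*} [MeasurableSpace A] [MeasurableSingletonClass A]

theorem shift_meas : Measurable (shift : (ℤ → A) → ℤ → A) := by
  rw [measurable_pi_iff]; intro i; exact measurable_pi_apply _

theorem pos_of_ns [Countable A] {μ : Measure (ℤ → A)} {ρ : ℤ → A → ℝ} {p : A → ℝ} (hμ : IsProductMeasure μ ρ)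
    (hρ : ∀ i, IsProbVecC (ρ i)) (hns : MeasEquiv (μ.map shift) μ) (hp0 : ∀ a, 0 < p a)
    (hlim : ∀ a, Tendsto (fun i : ℤ => ρ i a) cofinite (𝓝 (p a))) (i : ℤ) (a : A) : 0 < ρ i a := by
  by_contra hc
  have hc0 : ρ i a = 0 := le_antisymm (not_lt.1 hc) ((hρ i).1 a)
  have hms : ∀ i : ℤ, MeasurableSet {x : ℤ → A | x i = a} := fun i =>
    (measurable_pi_apply i : Measurable fun x : ℤ → A => x i) (measurableSet_singleton a)
  have key : ∀ j : ℤ, ρ j a = 0 ↔ ρ (j + 1) a = 0 := by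
    intro j
    have e1 : ∀ j, ρ j a = 0 ↔ μ {x | x j = a} = 0 := by
      intro j
      rw [coord_real hμ, ENNReal.ofReal_eq_zero]
      exact ⟨fun h => h.le, fun h => le_antisymm h ((hρ j).1 a)⟩
    have e2 : (μ.map shift) {x | x j = a} = μ {x | x (j + 1) = a} := by
      rw [Measure.map_apply shift_meas (hms j)]; rfl
    rw [e1, e1, ← e2]
    exact ⟨fun h => hns.1 h, fun h => hns.2 h⟩
  have all : ∀ j : ℤ, ρ j a = 0 := by
    intro j
    induction j using Int.inductionOn' (b := i) with
    | zero => exact hc0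
    | succ k _ h => exact (key k).1 h
    | pred k _ h => exact (key (k - 1)).2 (by simpa using h)
  have h1 := hlim a
  simp only [all] at h1
  have := tendsto_nhds_unique h1 tendsto_const_nhds
  exact (hp0 a).ne' this

theorem exists_delta [Fintype A] [Nonempty A] {ρ : ℤ → A → ℝ} {p : A → ℝ} (h0 : ∀ i a, 0 < ρ i a) (hp0 : ∀ a, 0 < p a)
    (hlim : ∀ a, Tendsto (fun i : ℤ => ρ i a) cofinite (𝓝 (p a))) : ∃ δ : ℝ, 0 < δ ∧ ∀ i a, δ ≤ ρ i a := by
  have h1 : ∀ a, ∃ δ : ℝ, 0 < δ ∧ ∀ i, δ ≤ ρ i a := by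
    intro a
    have he : ∀ᶠ i in cofinite, p a / 2 < ρ i a := (hlim a).eventually (lt_mem_nhds (by linarith [hp0 a]))
    have hf : {i : ℤ | ¬ p a / 2 < ρ i a}.Finite := he
    rcases Set.eq_empty_or_nonempty {i : ℤ | ¬ p a / 2 < ρ i a} with h | h
    · refine ⟨p a / 2, by linarith [hp0 a], fun i => ?_⟩
      by_contra hc
      have : i ∈ {i : ℤ | ¬ p a / 2 < ρ i a} := fun h => hc h.le
      rw [h] at this; exact this
    · obtain ⟨i0, _, hi0⟩ := Set.exists_min_image _ (fun i => ρ i a) hf h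
      refine ⟨min (p a / 2) (ρ i0 a), lt_min (by linarith [hp0 a]) (h0 _ _), fun i => ?_⟩
      by_cases hi : p a / 2 < ρ i a
      · exact (min_le_left _ _).trans hi.le
      · exact (min_le_right _ _).trans (hi0 i hi)
  choose δ hδ hδ' using h1
  obtain ⟨a0, ha0⟩ := Finite.exists_min δ
  exact ⟨δ a0, hδ a0, fun i a => (ha0 a).trans (hδ' a i)⟩

theorem abs_prod_sub {ι : Type*} (s : Finset ι) (f g : ι → ℝ) (hf : ∀ i, |f i| ≤ 1) (hg : ∀ i, |g i| ≤ 1) :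
    |∏ i ∈ s, f i - ∏ i ∈ s, g i| ≤ ∑ i ∈ s, |f i - g i| := by
  classical
  induction s using Finset.induction_on with
  | empty => simp
  | insert a s ha ih =>
    rw [Finset.prod_insert ha, Finset.prod_insert ha, Finset.sum_insert ha]
    have : f a * ∏ i ∈ s, f i - g a * ∏ i ∈ s, g i = (f a - g a) * ∏ i ∈ s, f i + g a * (∏ i ∈ s, f i - ∏ i ∈ s, g i) := by ring
    rw [this]
    refine (abs_add_le _ _).trans ?_
    rw [abs_mul, abs_mul]
    have h1 : |∏ i ∈ s, f i| ≤ 1 := by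
      rw [Finset.abs_prod]
      exact Finset.prod_le_one (fun i _ => abs_nonneg _) (fun i _ => hf i)
    have := hg a
    nlinarith [abs_nonneg (f a - g a), abs_nonneg (∏ i ∈ s, f i - ∏ i ∈ s, g i)]

theorem fin_hac [Fintype A] [Nonempty A] {μ : Measure (ℤ → A)} {ρ : ℤ → A → ℝ} {p : A → ℝ} (hμ : IsProductMeasure μ ρ)
    (hρ : ∀ i, IsProbVecC (ρ i)) (hns : MeasEquiv (μ.map shift) μ) (hp0 : ∀ a, 0 < p a)
    (hlim : ∀ a, Tendsto (fun i : ℤ => ρ i a) cofinite (𝓝 (p a)))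
    (L g N : ℕ) (_ : NeZero N) (Q : Sys A L g N) (c) : μ.map (Q.T c) ≪ μ := by
  have h0 := pos_of_ns hμ hρ hns hp0 hlim
  have hPr := prod_prob hμ inferInstance
  obtain ⟨δ, hδ, hδ'⟩ := exists_delta h0 hp0 hlim
  have hl2 : ∀ a, Summable (fun i : ℤ => (ρ (i + 1) a - ρ i a) ^ 2) := fun a =>
    l2_of_ac hμ (shift_prod hμ 1) hρ (fun i => hρ (i + 1)) hns.1 a
  have hl3 : ∀ (n : ℕ) a, Summable (fun j : ℤ => (ρ (j + n) a - ρ j a) ^ 2) := by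
    intro n a
    induction n with
    | zero => simp
    | succ n ih =>
      have h1 : Summable (fun j : ℤ => (ρ (j + n + 1) a - ρ (j + n) a) ^ 2) :=
        (hl2 a).comp_injective (i := fun j : ℤ => j + n) (add_left_injective _)
      refine Summable.of_nonneg_of_le (fun j => sq_nonneg _) (fun j => ?_) ((ih.mul_left 2).add (h1.mul_left 2))
      have : j + ((n + 1 : ℕ) : ℤ) = j + n + 1 := by push_cast; ring
      rw [this]
      nlinarith [sq_nonneg ((ρ (j + n) a - ρ j a) - (ρ (j + n + 1) a - ρ (j + n) a))]
  set e : ℤ → Fin L × A → ℝ := fun j ia => |ρ (j + (ia.1 : ℕ)) ia.2 - ρ j ia.2| with he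
  set B : ℤ → ℝ := fun j => ∑ ia, e j ia with hB
  have hBn : ∀ j, 0 ≤ B j := fun j => Finset.sum_nonneg fun _ _ => abs_nonneg _
  have hBs : Summable (fun j => B j ^ 2) := by
    have hs : Summable (fun j => (Fintype.card (Fin L × A) : ℝ) * ∑ ia, e j ia ^ 2) := by
      apply Summable.mul_left
      apply summable_sum
      intro ia _
      simp only [he, sq_abs]
      exact hl3 _ _
    refine Summable.of_nonneg_of_le (fun j => sq_nonneg _) (fun j => ?_) hs
    exact sq_sum_le_card_mul_sum_sq
  refine Q.absCont hμ h0 (fun j => (2 / δ ^ L) ^ 2 * B j ^ 2) ?_ (hBs.mul_left _) c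
  intro j d x
  rw [← mul_pow]
  apply sq_le_sq.2
  have hD : 0 < δ ^ L := by positivity
  rw [abs_of_nonneg (a := 2 / δ ^ L * B j) (mul_nonneg (by positivity) (hBn j))]
  unfold Sys.rr
  split_ifs with hJ
  · obtain ⟨τ, hτ⟩ := Q.perm (-d) (wd L x j)
    have hab : ∀ i a, |ρ i a| ≤ 1 := fun i a => by
      rw [abs_of_pos (h0 i a)]; exact IsProbVecC.le_one (hρ i) a
    have hw : ∀ w : Fin L → A, |∏ i : Fin L, ρ (j + (i : ℕ)) (w i) - ∏ i : Fin L, ρ j (w i)| ≤ B j := by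
      intro w
      refine (abs_prod_sub _ _ _ (fun i => hab _ _) (fun i => hab _ _)).trans ?_
      simp only [hB]
      rw [Fintype.sum_prod_type]
      apply Finset.sum_le_sum
      intro i _
      exact Finset.single_le_sum (f := fun a => e j (i, a)) (fun a _ => abs_nonneg _) (Finset.mem_univ (w i))
    have h1 := hw (wd L x j)
    have h2 := hw (Q.act (-d) (wd L x j))
    have h3 : ∏ i : Fin L, ρ j (Q.act (-d) (wd L x j) i) = ∏ i : Fin L, ρ j (wd L x j i) := by
      rw [hτ]
      exact Equiv.prod_comp τ (fun i => ρ j (wd L x j i))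
    rw [h3] at h2
    rw [Finset.prod_div_distrib]
    set P := ∏ i : Fin L, ρ (j + (i : ℕ)) (wd L x j i) with hP
    set P' := ∏ i : Fin L, ρ (j + (i : ℕ)) (Q.act (-d) (wd L x j) i) with hP'
    have hPd : δ ^ L ≤ P := by
      calc δ ^ L = ∏ i : Fin L, δ := by simp
        _ ≤ P := Finset.prod_le_prod (fun i _ => hδ.le) (fun i _ => hδ' _ _)
    have hP0 : 0 < P := hD.trans_le hPd
    have h4 : |P' - P| ≤ 2 * B j := by
      rw [abs_le] at *
      constructor <;> linarith [h1.1, h1.2, h2.1, h2.2]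
    have : P' / P - 1 = (P' - P) / P := by field_simp
    rw [this, abs_div, abs_of_pos hP0]
    calc _ ≤ 2 * B j / δ ^ L := by gcongr
      _ = _ := by ring
  · simp; exact mul_nonneg (by positivity) (hBn j)

end finite
end NOF

open MeasureTheory Filter Set Topology ENNReal
set_option linter.unusedSectionVars false
set_option linter.unusedVariables false
set_option linter.unusedSimpArgs false

namespace NOF

theorem pv_le_one {A : Type*} {p : A → ℝ} (h : IsProbVecC p) (a : A) : p a ≤ 1 := by
  have := h.2.summable.le_tsum a (fun b _ => h.1 b)
  rwa [h.2.tsum_eq] at this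

section lump
variable {A B : Type*} [Countable A] [MeasurableSpace A] [MeasurableSingletonClass A]

/-- push-forward of a probability vector -/
noncomputable def lump (π : A → B) (q : A → ℝ) (b : B) : ℝ := ∑' a, (π ⁻¹' {b}).indicator q a

theorem lump_nonneg (π : A → B) {q : A → ℝ} (hq : ∀ a, 0 ≤ q a) (b : B) : 0 ≤ lump π q b :=
  tsum_nonneg fun a => indicator_nonneg (fun a _ => hq a) a

theorem lump_prob [Fintype B] (π : A → B) {q : A → ℝ} (hq : IsProbVecC q) : IsProbVecC (lump π q) := by
  classical
  refine ⟨lump_nonneg π hq.1, ?_⟩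
  have : ∑ b, lump π q b = 1 := by
    unfold lump
    rw [← Summable.tsum_finsetSum fun b _ => hq.2.summable.indicator _]
    rw [← hq.2.tsum_eq]
    congr 1; funext a
    rw [Finset.sum_eq_single (π a)]
    · simp
    · intro b _ hb
      apply indicator_of_notMem
      simpa using hb.symm
    · simp
  rw [← this]
  exact hasSum_fintype _

theorem lump_lim (π : A → B) {ρ : ℤ → A → ℝ} {p : A → ℝ} (hρ : ∀ i, IsProbVecC (ρ i)) (hp : IsProbVecC p)
    (hlim : Tendsto (fun i : ℤ => ∑' a, |ρ i a - p a|) cofinite (𝓝 0)) (b : B) :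
    Tendsto (fun i => lump π (ρ i) b) cofinite (𝓝 (lump π p b)) := by
  rw [tendsto_iff_norm_sub_tendsto_zero]
  refine squeeze_zero (fun i => norm_nonneg _) (fun i => ?_) hlim
  have hs : Summable (fun a => |ρ i a - p a|) := ((hρ i).2.summable.sub hp.2.summable).abs
  unfold lump
  rw [← Summable.tsum_sub ((hρ i).2.summable.indicator _) (hp.2.summable.indicator _)]
  have hle : ∀ a, ‖(π ⁻¹' {b}).indicator (ρ i) a - (π ⁻¹' {b}).indicator p a‖ ≤ |ρ i a - p a| := by
    intro a
    by_cases h : a ∈ π ⁻¹' {b}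
    · simp [indicator_of_mem h]
    · simp [indicator_of_notMem h]
  exact tsum_of_norm_bounded hs.hasSum hle

theorem pm_set (q : A → ℝ) (hq : IsProbVecC q) (S : Set A) : pm q S = ENNReal.ofReal (∑' a, S.indicator q a) := by
  classical
  rw [pm, Measure.sum_apply _ (Set.to_countable S).measurableSet,
    ENNReal.ofReal_tsum_of_nonneg (fun a => indicator_nonneg (fun a _ => hq.1 a) a) (hq.2.summable.indicator _)]
  congr 1; funext a
  by_cases h : a ∈ S
  · simp [h]
  · simp [h]

theorem lump_prod [Countable B] [MeasurableSpace B] [MeasurableSingletonClass B] (π : A → B)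
    {μ : Measure (ℤ → A)} {ρ : ℤ → A → ℝ} (hμ : IsProductMeasure μ ρ) (hρ : ∀ i, IsProbVecC (ρ i))
    (hne : Nonempty A) : IsProductMeasure (μ.map (fun x i => π (x i))) (fun i => lump π (ρ i)) := by
  have : ∀ i, IsProbabilityMeasure (pm (ρ i)) := fun i => pm_prob (hρ i).1 (hρ i).2
  intro s y
  have hπ : Measurable π := measurable_of_countable π
  have hm : Measurable (fun (x : ℤ → A) i => π (x i)) := by
    rw [measurable_pi_iff]; intro i; exact hπ.comp (measurable_pi_apply i)
  rw [Measure.map_apply hm (measurableSet_cyl _ _)]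
  have he : (fun (x : ℤ → A) i => π (x i)) ⁻¹' _root_.cylinder s y = Set.pi (s : Set ℤ) (fun i => π ⁻¹' {y i}) := by
    ext x; simp [_root_.cylinder]
  rw [he, prod_eq_infinitePi hμ hρ hne, Measure.infinitePi_pi _ (fun i _ => (Set.to_countable _).measurableSet)]
  apply Finset.prod_congr rfl
  intro i _
  exact pm_set _ (hρ i) _

theorem finitary_of_loc {C : Type*} {μ : Measure (ℤ → A)} (hne : Nonempty A) {φ : (ℤ → A) → ℤ → C}
    (hloc : ∀ᵐ x ∂μ, ∃ n : ℕ, ∀ x' : ℤ → A, (∀ i : ℤ, -n ≤ i → i ≤ n → x' i = x i) → φ x' 0 = φ x 0)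
    (h0 : ∀ b, μ {x | φ x 0 = b} ≠ 0) : IsFinitary μ φ := by
  intro b
  obtain ⟨a0⟩ := hne
  let T := Σ n : ℕ, (Finset.Icc (-n : ℤ) n → A)
  let ex : T → ℤ → A := fun t i => if h : i ∈ Finset.Icc (-t.1 : ℤ) t.1 then t.2 ⟨i, h⟩ else a0
  let S : T → Finset ℤ := fun t => Finset.Icc (-t.1 : ℤ) t.1
  let G : Set T := {t | ∀ x ∈ _root_.cylinder (S t) (ex t), φ x 0 = b}
  have key : ∀ x, (∃ n : ℕ, ∀ x' : ℤ → A, (∀ i : ℤ, -n ≤ i → i ≤ n → x' i = x i) → φ x' 0 = φ x 0) →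
      φ x 0 = b → ∃ t ∈ G, x ∈ _root_.cylinder (S t) (ex t) := by
    rintro x ⟨n, hn⟩ hx
    have hexx : ∀ i ∈ S ⟨n, fun i => x i⟩, ex ⟨n, fun i => x i⟩ i = x i := by
      intro i hi
      simp only [ex]
      rw [dif_pos hi]
    refine ⟨⟨n, fun i => x i⟩, ?_, ?_⟩
    · intro x' hx'
      rw [hn x', hx]
      intro i h1 h2
      have hi : i ∈ S ⟨n, fun i => x i⟩ := Finset.mem_Icc.2 ⟨h1, h2⟩
      rw [hx' i hi, hexx i hi]
    · intro i hi
      rw [hexx i hi]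
  have hGne : G.Nonempty := by
    by_contra hG
    apply h0 b
    have : ∀ᵐ x ∂μ, φ x 0 ≠ b := by
      filter_upwards [hloc] with x hx hb
      obtain ⟨t, ht, _⟩ := key x hx hb
      exact hG ⟨t, ht⟩
    simpa [ae_iff] using this
  have : Nonempty G := hGne.to_subtype
  obtain ⟨f, hf⟩ := exists_surjective_nat G
  refine ⟨fun k => S (f k), fun k => ex (f k), ?_⟩
  have hsub : symmDiff {x | φ x 0 = b} (⋃ k, _root_.cylinder (S (f k)) (ex (f k))) ⊆
      {x | ¬ ∃ n : ℕ, ∀ x' : ℤ → A, (∀ i : ℤ, -n ≤ i → i ≤ n → x' i = x i) → φ x' 0 = φ x 0} := by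
    rintro x (⟨h1, h2⟩ | ⟨h1, h2⟩)
    · intro hx
      obtain ⟨t, ht, hxt⟩ := key x hx h1
      obtain ⟨k, hk⟩ := hf ⟨t, ht⟩
      apply h2
      rw [mem_iUnion]
      refine ⟨k, ?_⟩
      rw [hk]; exact hxt
    · rw [mem_iUnion] at h1
      obtain ⟨k, hk⟩ := h1
      exact absurd ((f k).2 x hk) h2
  exact measure_mono_null hsub hloc

theorem exists_lump {p : A → ℝ} (hp : IsProbVecC p) (α : ℝ) (h0 : 0 ≤ α)
    (hα : (α : EReal) < ((entropyENN p : ℝ≥0∞) : EReal)) :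
    ∃ (k : ℕ) (π : A → Fin k), (∀ b, 0 < lump π p b) ∧ α * Real.log 2 < Hn (lump π p) := by
  classical
  have hl2 : 0 < Real.log 2 := Real.log_pos (by norm_num)
  suffices h : ∃ (B : Type _) (_ : Fintype B) (π : A → B), (∀ b, 0 < lump π p b) ∧ α * Real.log 2 < Hn (lump π p) by
    obtain ⟨B, _, π, h1, h2⟩ := h
    let e := Fintype.equivFin B
    have he : ∀ b, lump (e ∘ π) p (e b) = lump π p b := by
      intro b
      unfold lump
      have : (e ∘ π) ⁻¹' {e b} = π ⁻¹' {b} := by ext a; simp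
      rw [this]
    refine ⟨_, e ∘ π, fun b => ?_, ?_⟩
    · obtain ⟨b, rfl⟩ := e.surjective b
      rw [he]; exact h1 b
    · have : Hn (lump (e ∘ π) p) = Hn (lump π p) := by
        unfold Hn
        rw [← e.sum_comp]
        simp only [he]
      rw [this]; exact h2
  have hα' : ENNReal.ofReal α < entropyENN p := by
    rw [← EReal.coe_ennreal_lt_coe_ennreal_iff, EReal.coe_ennreal_ofReal, max_eq_left h0]
    exact hα
  rw [entropyENN, ENNReal.tsum_eq_iSup_sum, lt_iSup_iff] at hα'
  obtain ⟨F0, hF0⟩ := hα'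
  have hnn : ∀ a, 0 ≤ -(p a * Real.logb 2 (p a)) := by
    intro a
    have := Real.logb_nonpos (b := 2) (by norm_num) (hp.1 a) (pv_le_one hp a)
    nlinarith [hp.1 a]
  rw [← ENNReal.ofReal_sum_of_nonneg fun a _ => hnn a, ENNReal.ofReal_lt_ofReal_iff_of_nonneg h0] at hF0
  set F := F0.filter (fun a => 0 < p a) with hF
  have hFs : ∑ a ∈ F0, -(p a * Real.logb 2 (p a)) = ∑ a ∈ F, -(p a * Real.logb 2 (p a)) := by
    rw [hF, Finset.sum_filter]
    apply Finset.sum_congr rfl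
    intro a _
    split_ifs with h
    · rfl
    · have : p a = 0 := le_antisymm (not_lt.1 h) (hp.1 a)
      simp [this]
  rw [hFs] at hF0
  have hF1 : α * Real.log 2 < ∑ a : F, -(p a * Real.log (p a)) := by
    rw [Finset.sum_coe_sort F (fun a => -(p a * Real.log (p a)))]
    calc α * Real.log 2 < (∑ a ∈ F, -(p a * Real.logb 2 (p a))) * Real.log 2 := by gcongr
      _ = _ := by
        rw [Finset.sum_mul]
        apply Finset.sum_congr rfl; intro a _
        rw [Real.logb]; field_simp
  have hFpos : ∀ a : F, 0 < p a := fun a => (Finset.mem_filter.1 a.2).2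
  have hone : ∀ a : A, ∑' a', ({a} : Set A).indicator p a' = p a := by
    intro a
    rw [tsum_eq_single a]
    · simp
    · intro b hb; simp [hb]
  by_cases hr : ∃ a1, a1 ∉ F ∧ 0 < p a1
  · obtain ⟨a1, ha1, hpa1⟩ := hr
    refine ⟨Option F, inferInstance, fun a => if h : a ∈ F then some ⟨a, h⟩ else none, ?_⟩
    set π : A → Option F := fun a => if h : a ∈ F then some ⟨a, h⟩ else none with hπ
    have hsome : ∀ a : F, lump π p (some a) = p a := by
      intro a
      unfold lump
      have : π ⁻¹' {some a} = {(a : A)} := by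
        ext x
        simp only [hπ, mem_preimage, mem_singleton_iff]
        by_cases hx : x ∈ F
        · simp [hx, Subtype.ext_iff]
        · simp only [hx, dite_false]
          constructor
          · intro h; cases h
          · rintro rfl; exact absurd a.2 hx
      rw [this, hone]
    have hnone : 0 < lump π p none := by
      unfold lump
      apply lt_of_lt_of_le hpa1
      have := (hp.2.summable.indicator (π ⁻¹' {none})).le_tsum a1 (fun b _ => indicator_nonneg (fun a _ => hp.1 a) b)
      rwa [indicator_of_mem] at this
      simp [hπ, ha1]
    refine ⟨?_, ?_⟩
    · rintro (_ | a)
      · exact hnone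
      · rw [hsome]; exact hFpos a
    · unfold Hn
      rw [Fintype.sum_option]
      simp only [hsome]
      have h1 : lump π p none ≤ 1 := pv_le_one (lump_prob π hp) none
      have h2 := Real.log_nonpos hnone.le h1
      nlinarith
  · push Not at hr
    have hz : ∀ a, a ∉ F → p a = 0 := fun a ha => le_antisymm (hr a ha) (hp.1 a)
    have hFne : Nonempty F := by
      by_contra hne
      rw [not_nonempty_iff] at hne
      simp at hF1
      have := mul_nonneg h0 hl2.le
      linarith
    obtain ⟨a0⟩ := hFne
    refine ⟨F, inferInstance, fun a => if h : a ∈ F then ⟨a, h⟩ else a0, ?_⟩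
    set π : A → F := fun a => if h : a ∈ F then ⟨a, h⟩ else a0 with hπ
    have hsome : ∀ a : F, lump π p a = p a := by
      intro a
      unfold lump
      rw [tsum_eq_single (a : A)]
      · apply indicator_of_mem
        simp [hπ]
      · intro b hb
        by_cases hbF : b ∈ F
        · apply indicator_of_notMem
          simp only [hπ, hbF, dite_true, mem_preimage, mem_singleton_iff, Subtype.ext_iff]
          exact hb
        · rw [indicator_apply, hz b hbF]; simp
    refine ⟨fun a => by rw [hsome]; exact hFpos a, ?_⟩
    unfold Hn
    simp only [hsome]
    exact hF1

end lump
end NOF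

/-- A nonsingular Bernoulli shift on a countable alphabet with limiting measure `p` (in total
variation) has near optimal entropy finitary iid factors: for every real `α < H(p)` there is a
finitary iid factor of entropy greater than `α`. -/
theorem near_optimal_finitary_factors_countable {A : Type*} [Countable A]
    [MeasurableSpace A] [MeasurableSingletonClass A]
    (ρ : ℤ → A → ℝ) (hρ : ∀ i, IsProbVecC (ρ i))
    (μ : Measure (ℤ → A)) (hprod : IsProductMeasure μ ρ)
    (hns : MeasEquiv (μ.map shift) μ)
    (p : A → ℝ) (hp : IsProbVecC p)
    (hlim : Tendsto (fun i : ℤ => ∑' a, |ρ i a - p a|) cofinite (𝓝 0))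
    (α : ℝ) (hα : (α : EReal) < ((entropyENN p : ℝ≥0∞) : EReal)) :
    ∃ (m : ℕ) (q : Fin m → ℝ), IsProbVec q ∧ α < entropy q ∧
      ∃ (ν : Measure (ℤ → Fin m)) (φ : (ℤ → A) → (ℤ → Fin m)),
        IsProductMeasure ν (fun _ => q) ∧ Measurable φ ∧
        (∀ᵐ x ∂μ, φ (shift x) = shift (φ x)) ∧
        MeasEquiv (μ.map φ) ν ∧ IsFinitary μ φ := by
  have hA : Nonempty A := by
    by_contra h
    rw [not_nonempty_iff] at h
    have := hp.2.unique (hasSum_empty (f := p))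
    norm_num at this
  have hPμ := NOF.prod_prob hprod hA
  have hl2 : 0 < Real.log 2 := Real.log_pos (by norm_num)
  rcases lt_or_ge α 0 with hneg | hpos
  · have hq : IsProbVecC (fun _ : Fin 1 => (1 : ℝ)) := by
      refine ⟨fun _ => zero_le_one, ?_⟩
      simp
    have hm : Measurable (fun (_ : ℤ → A) (_ : ℤ) => (0 : Fin 1)) := measurable_const
    refine ⟨1, fun _ => 1, ⟨fun _ => zero_le_one, by simp⟩, by simpa [entropy] using hneg,
      μ.map (fun _ _ => 0), fun _ _ => 0, ?_, hm, Filter.Eventually.of_forall fun x => rfl,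
      ⟨Measure.AbsolutelyContinuous.rfl, Measure.AbsolutelyContinuous.rfl⟩, ?_⟩
    · intro s y
      have : _root_.cylinder s y = univ := by
        ext x; simp [_root_.cylinder, eq_iff_true_of_subsingleton]
      rw [this, Measure.map_apply hm MeasurableSet.univ]
      simp
    · intro b
      refine ⟨fun _ => ∅, fun _ _ => Classical.choice hA, ?_⟩
      have h1 : {x : ℤ → A | (0 : Fin 1) = b} = univ := by
        ext x; simp [eq_iff_true_of_subsingleton]
      rw [h1]
      rw [iUnion_const]
      simp [_root_.cylinder]
  · obtain ⟨k, π, hpos', hH⟩ := NOF.exists_lump hp α hpos hα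
    have hρ' : ∀ i, IsProbVecC (NOF.lump π (ρ i)) := fun i => NOF.lump_prob π (hρ i)
    have hp' := NOF.lump_prob π hp
    have hμ' := NOF.lump_prod π hprod hρ hA
    have hlim' := NOF.lump_lim π hρ hp hlim
    have hk : Nonempty (Fin k) := hA.map π
    have hπm : Measurable π := measurable_of_countable π
    have hPim : Measurable (fun (x : ℤ → A) i => π (x i)) := by
      rw [measurable_pi_iff]; intro i; exact hπm.comp (measurable_pi_apply i)
    have hPμ' := NOF.prod_prob hμ' hk
    have hcomm : (μ.map (fun x i => π (x i))).map shift = (μ.map shift).map (fun x i => π (x i)) := by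
      rw [Measure.map_map NOF.shift_meas hPim, Measure.map_map hPim NOF.shift_meas]
      rfl
    have hns' : MeasEquiv ((μ.map (fun x i => π (x i))).map shift) (μ.map (fun x i => π (x i))) := by
      rw [hcomm]
      exact ⟨hns.1.map hPim, hns.2.map hPim⟩
    have hac := NOF.fin_hac hμ' hρ' hns' hpos' hlim'
    have h0α : 0 ≤ α * Real.log 2 := mul_nonneg hpos hl2.le
    obtain ⟨a, b, hab⟩ : ∃ a b : Fin k, b ≠ a := by
      by_contra hc
      push Not at hc
      have hs : Subsingleton (Fin k) := ⟨fun x y => hc y x⟩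
      obtain ⟨a⟩ := hk
      have h1 := (hasSum_fintype (NOF.lump π p)).unique hp'.2
      rw [Fintype.sum_subsingleton _ a] at h1
      unfold NOF.Hn at hH
      rw [Fintype.sum_subsingleton _ a, h1] at hH
      simp at hH
      linarith
    obtain ⟨m, q, hq0, hq, hqH, hall⟩ := NOF.fin_core hμ' hρ' hp' hpos'
      (fun a => (hlim' a).mono_left (by rw [Int.cofinite_eq]; exact le_sup_right)) hac a b hab _ h0α hH
    obtain ⟨ν, hν⟩ := NOF.exists_prod (fun _ : ℤ => q) (fun _ => hq)
    obtain ⟨φ, hφm, hφe, hφq, hφl⟩ := hall ν hν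
    have hmap : μ.map (fun x => φ (fun i => π (x i))) = (μ.map (fun x i => π (x i))).map φ := by
      rw [Measure.map_map hφm hPim]; rfl
    have hm : Measurable (fun x : ℤ → A => φ (fun i => π (x i))) := hφm.comp hPim
    refine ⟨m, q, ⟨hq.1, (hasSum_fintype q).unique hq.2⟩, ?_, ν, fun x => φ (fun i => π (x i)), hν, hm, ?_, ?_, ?_⟩
    · have : entropy q = NOF.Hn q / Real.log 2 := by
        unfold entropy NOF.Hn
        rw [Finset.sum_neg_distrib, neg_div, Finset.sum_div]
        congr 1
        apply Finset.sum_congr rfl; intro b _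
        rw [Real.logb]; ring
      rw [this, lt_div_iff₀ hl2]
      exact hqH
    · refine Filter.Eventually.of_forall fun x => ?_
      funext z
      exact hφe (fun i => π (x i)) 1 z
    · rw [hmap]; exact hφq
    · apply NOF.finitary_of_loc hA
      · have := ae_of_ae_map hPim.aemeasurable hφl
        filter_upwards [this] with x hx
        obtain ⟨n, hn⟩ := hx
        exact ⟨n, fun x' hx' => hn _ fun i h1 h2 => by rw [hx' i h1 h2]⟩
      · intro b hb
        have h1 : (μ.map (fun x => φ (fun i => π (x i)))) {y | y 0 = b} = 0 := by
          have hms : MeasurableSet {y : ℤ → Fin m | y 0 = b} :=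
            (measurable_pi_apply 0 : Measurable fun y : ℤ → Fin m => y 0) (measurableSet_singleton b)
          rw [Measure.map_apply hm hms]
          exact hb
        rw [hmap] at h1
        have h2 := hφq.2 h1
        rw [NOF.coord_real hν, ENNReal.ofReal_eq_zero] at h2
        exact absurd (hq0 b) (not_lt.2 h2)
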